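/- arXiv:1409.4508 — 2 statements merged into one kernel-verified Lean document; each statement's English description precedes it below -/
import Mathlib

section
/- Let 0 ≤ λ < 2/√3 − 1 and set ℓ = 1 + λ. Let T² = conv{t_1, t_2, t_3} be a regular triangle of side length 2 in E² and set σ̄_2(λ) = vol_2(T² ∩ ⋃_{i=1}^{3} (t_i + ℓB²)) / vol_2(T²). Then the supremum, over all infinite packings of unit disks in E² with centers c_1, c_2, …, of limsup_{R→∞} vol_2((⋃_i (c_i + ℓB²)) ∩ RB²) / vol_2(RB²) equals σ̄_2(λ); in particular, there exists an infinite packing of unit disks whose outer parallel domain of outer radius λ has upper density exactly σ̄_2(λ). -/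
open MeasureTheory Metric
open scoped Pointwise

namespace SoftDisk

/-- The Euclidean plane. -/
abbrev E := EuclideanSpace ℝ (Fin 2)

lemma nsq (p : E) : ‖p‖ ^ 2 = p 0 ^ 2 + p 1 ^ 2 := by
  rw [EuclideanSpace.norm_sq_eq]; simp [Fin.sum_univ_two]

lemma mem_cb (p : E) {l : ℝ} (hl : 0 ≤ l) : p ∈ closedBall (0 : E) l ↔ p 0 ^ 2 + p 1 ^ 2 ≤ l ^ 2 := by
  rw [mem_closedBall_zero_iff, ← nsq, sq_le_sq₀ (norm_nonneg _) hl]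

/-- No three points pairwise at distance at least `2` in a disk of squared radius `4/3`, unless all
are on the boundary. -/
lemma three_points (p q r : E) (hpq : 2 ≤ ‖p - q‖) (hqr : 2 ≤ ‖q - r‖) (hpr : 2 ≤ ‖p - r‖)
    (hp : ‖p‖ ^ 2 ≤ 4 / 3) (hq : ‖q‖ ^ 2 ≤ 4 / 3) (hr : ‖r‖ ^ 2 < 4 / 3) : False := by
  have h1 : (2 : ℝ) ^ 2 ≤ ‖p - q‖ ^ 2 := by gcongr
  have h2 : (2 : ℝ) ^ 2 ≤ ‖q - r‖ ^ 2 := by gcongr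
  have h3 : (2 : ℝ) ^ 2 ≤ ‖p - r‖ ^ 2 := by gcongr
  rw [nsq] at *
  simp only [PiLp.sub_apply] at *
  nlinarith [sq_nonneg (p 0 + q 0 + r 0), sq_nonneg (p 1 + q 1 + r 1)]

/-- The isosceles triangle with apex at `0`, height `h` and legs of squared length `4/3`. -/
def T (h : ℝ) : Set E := {p | 0 < p 0 ∧ 3 * h ^ 2 * (p 0 ^ 2 + p 1 ^ 2) < 4 * p 0 ^ 2 ∧ p 0 < h}

/-- The diagonal linear map. -/
noncomputable def diag (a b : ℝ) : E →ₗ[ℝ] E where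
  toFun p := !₂[a * p 0, b * p 1]
  map_add' p q := by ext i; fin_cases i <;> simp [mul_add]
  map_smul' c p := by ext i; fin_cases i <;> simp <;> ring

@[simp] lemma diag_zero (a b : ℝ) (p : E) : diag a b p 0 = a * p 0 := by simp [diag]
@[simp] lemma diag_one (a b : ℝ) (p : E) : diag a b p 1 = b * p 1 := by simp [diag]

lemma ext2 {p q : E} (h0 : p 0 = q 0) (h1 : p 1 = q 1) : p = q := by
  ext i; fin_cases i <;> assumption

lemma tri_density (l h : ℝ) (hl : 0 ≤ l) (h1 : 1 ≤ h) (h2 : 3 * h ^ 2 < 4) (s : ENNReal)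
    (hs : volume (T 1 ∩ closedBall 0 l) ≤ s * volume (T 1)) :
    volume (T h ∩ closedBall 0 l) ≤ s * volume (T h) := by
  obtain ⟨w, hw0, hw⟩ : ∃ w : ℝ, 0 < w ∧ w ^ 2 = 4 - 3 * h ^ 2 :=
    ⟨√(4 - 3 * h ^ 2), Real.sqrt_pos.2 (by linarith), Real.sq_sqrt (by linarith)⟩
  have hh0 : 0 < h := by linarith
  have surj : ∀ p : E, diag h w (diag h⁻¹ w⁻¹ p) = p := by
    intro p
    apply ext2 <;> simp <;> field_simp
  have key : ∀ p : E, diag h w p ∈ T h ↔ p ∈ T 1 := by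
    intro p
    simp only [T, Set.mem_ofPred_eq, diag_zero, diag_one]
    have e : 3 * h ^ 2 * ((h * p 0) ^ 2 + (w * p 1) ^ 2) < 4 * (h * p 0) ^ 2 ↔
        3 * 1 ^ 2 * (p 0 ^ 2 + p 1 ^ 2) < 4 * p 0 ^ 2 := by
      have e1 : 4 * (h * p 0) ^ 2 - 3 * h ^ 2 * ((h * p 0) ^ 2 + (w * p 1) ^ 2) =
        (h ^ 2 * w ^ 2) * (4 * p 0 ^ 2 - 3 * 1 ^ 2 * (p 0 ^ 2 + p 1 ^ 2)) := by
        have : 4 = w ^ 2 + 3 * h ^ 2 := by linarith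
        rw [mul_pow, mul_pow]
        linear_combination (h ^ 2 * p 0 ^ 2) * this
      have e2 : 0 < h ^ 2 * w ^ 2 := by positivity
      rw [← sub_pos, e1, mul_pos_iff_of_pos_left e2, sub_pos]
    rw [e, mul_pos_iff_of_pos_left hh0, mul_lt_iff_lt_one_right hh0]
  have im : T h = diag h w '' T 1 := by
    ext p
    constructor
    · intro hp
      refine ⟨diag h⁻¹ w⁻¹ p, ?_, surj p⟩
      rw [← key, surj]; exact hp
    · rintro ⟨q, hq, rfl⟩
      rwa [key]
  have sub : T h ∩ closedBall 0 l ⊆ diag h w '' (T 1 ∩ closedBall 0 l) := by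
    rintro p ⟨hp, hpl⟩
    rw [im] at hp
    obtain ⟨q, hq, rfl⟩ := hp
    refine ⟨q, ⟨hq, ?_⟩, rfl⟩
    rw [mem_cb _ hl] at hpl ⊢
    simp only [diag_zero, diag_one, mul_pow, hw] at hpl
    obtain ⟨a, b, c⟩ := hq
    nlinarith [mul_nonneg (sub_nonneg.2 (one_le_pow₀ h1 : 1 ≤ h ^ 2)) (by linarith : 0 ≤ q 0 ^ 2 - 3 * q 1 ^ 2)]
  calc volume (T h ∩ closedBall 0 l) ≤ volume (diag h w '' (T 1 ∩ closedBall 0 l)) := measure_mono sub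
    _ = ENNReal.ofReal |LinearMap.det (diag h w)| * volume (T 1 ∩ closedBall 0 l) :=
        Measure.addHaar_image_linearMap _ _ _
    _ ≤ ENNReal.ofReal |LinearMap.det (diag h w)| * (s * volume (T 1)) := by gcongr
    _ = s * (ENNReal.ofReal |LinearMap.det (diag h w)| * volume (T 1)) := by ring
    _ = s * volume (T h) := by rw [im, Measure.addHaar_image_linearMap]

lemma finrankE : Module.finrank ℝ E = 2 := by simp

lemma tri_lower (l : ℝ) (hl : 0 < l) (hl2 : 3 * l ^ 2 < 4) (s : ENNReal)
    (h0 : volume (T 1) ≠ 0) (hinf : volume (T 1) ≠ ⊤)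
    (hs : volume (T 1 ∩ closedBall 0 l) = s * volume (T 1)) :
    ENNReal.ofReal (3 / 4 * l ^ 2) ≤ s := by
  obtain ⟨k, hk0, hk⟩ : ∃ k : ℝ, 0 < k ∧ k ^ 2 = 3 / 4 * l ^ 2 :=
    ⟨√(3 / 4 * l ^ 2), Real.sqrt_pos.2 (by positivity), Real.sq_sqrt (by positivity)⟩
  have hk1 : k < 1 := by nlinarith
  have sub : k • T 1 ⊆ T 1 ∩ closedBall 0 l := by
    rintro _ ⟨p, ⟨a, b, c⟩, rfl⟩
    refine ⟨⟨?_, ?_, ?_⟩, ?_⟩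
    · simp; positivity
    · simp only [PiLp.smul_apply, smul_eq_mul]
      have : 0 < k ^ 2 := by positivity
      nlinarith
    · simp only [PiLp.smul_apply, smul_eq_mul]
      nlinarith
    · rw [mem_cb _ hl.le]
      simp only [PiLp.smul_apply, smul_eq_mul, mul_pow]
      rw [← mul_add, hk]
      have : p 0 ^ 2 + p 1 ^ 2 ≤ 4 / 3 := by nlinarith
      have : 0 < l ^ 2 := by positivity
      nlinarith
  have h := measure_mono (μ := volume) sub
  rw [Measure.addHaar_smul_of_nonneg _ hk0.le, finrankE, hk, hs] at h
  exact (ENNReal.mul_le_mul_iff_left h0 hinf).1 h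

lemma exists_frame1 (v : E) (hv : v ≠ 0) :
    ∃ φ : E ≃ₗᵢ[ℝ] E, ∀ x, φ x 0 * ‖v‖ = inner ℝ x v := by
  have ho : Orthonormal ℝ (({0} : Set (Fin 2)).domRestrict (fun _ => (‖v‖⁻¹ • v : E))) := by
    rw [orthonormal_iff_ite]
    rintro ⟨i, hi⟩ ⟨j, hj⟩
    simp only [Set.mem_singleton_iff] at hi hj
    subst hi hj
    have : ‖v‖ ≠ 0 := by simpa
    simp only [Set.domRestrict_apply, inner_smul_left, inner_smul_right, real_inner_self_eq_norm_sq]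
    simp
    field_simp
  obtain ⟨b, hb⟩ := ho.exists_orthonormalBasis_extension_of_card_eq (by simp)
  refine ⟨b.repr, fun x => ?_⟩
  rw [b.repr_apply_apply, hb 0 rfl, inner_smul_left, real_inner_comm]
  have : ‖v‖ ≠ 0 := by simpa
  simp
  field_simp

lemma isOpenT (h : ℝ) : IsOpen (T h) := by
  have : T h = {p : E | 0 < p 0} ∩ ({p : E | 3 * h ^ 2 * (p 0 ^ 2 + p 1 ^ 2) < 4 * p 0 ^ 2} ∩
    {p : E | p 0 < h}) := by ext x; simp [T]
  rw [this]
  exact (isOpen_lt (by fun_prop) (by fun_prop)).inter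
    ((isOpen_lt (by fun_prop) (by fun_prop)).inter (isOpen_lt (by fun_prop) (by fun_prop)))

lemma measT (h : ℝ) : MeasurableSet (T h) := (isOpenT h).measurableSet

lemma iso_vol (φ : E ≃ₗᵢ[ℝ] E) {A : Set E} (hA : MeasurableSet A) :
    volume (φ ⁻¹' A) = volume A :=
  φ.measurePreserving.measure_preimage hA.nullMeasurableSet

/-- The open cone over the cap cut off by the bisector of `0` and `v`. -/
def S (v : E) : Set E := {x | 0 < inner ℝ x v ∧ 3 * ‖v‖ ^ 4 * ‖x‖ ^ 2 < 16 * (inner ℝ x v) ^ 2}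

lemma isOpenS (v : E) : IsOpen (S v) := by
  have : S v = {x : E | 0 < inner ℝ x v} ∩
      {x : E | 3 * ‖v‖ ^ 4 * ‖x‖ ^ 2 < 16 * (inner ℝ x v) ^ 2} := by ext x; simp [S]
  rw [this]
  exact (isOpen_lt (by fun_prop) (by fun_prop)).inter (isOpen_lt (by fun_prop) (by fun_prop))

lemma S_density (l : ℝ) (hl : 0 ≤ l) (v : E) (hv : 2 ≤ ‖v‖) (s : ENNReal)
    (hs : volume (T 1 ∩ closedBall 0 l) ≤ s * volume (T 1)) :
    volume ((S v ∩ {x | 2 * inner ℝ x v < ‖v‖ ^ 2}) ∩ closedBall 0 l) ≤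
      s * volume (S v ∩ {x | 2 * inner ℝ x v < ‖v‖ ^ 2}) := by
  have hv0 : v ≠ 0 := by rintro rfl; norm_num at hv
  have hn : 0 < ‖v‖ := by linarith
  by_cases h16 : 3 * ‖v‖ ^ 2 < 16
  · obtain ⟨φ, hφ⟩ := exists_frame1 v hv0
    have e1 : S v ∩ {x | 2 * inner ℝ x v < ‖v‖ ^ 2} = φ ⁻¹' T (‖v‖ / 2) := by
      ext x
      simp only [S, T, Set.mem_inter_iff, Set.mem_ofPred_eq, Set.mem_preimage, ← hφ, ← nsq,
        LinearIsometryEquiv.norm_map]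
      set n := ‖v‖
      set a := φ x 0
      have c1 : 0 < a * n ↔ 0 < a := by rw [mul_pos_iff_of_pos_right hn]
      have c2 : 3 * n ^ 4 * ‖x‖ ^ 2 < 16 * (a * n) ^ 2 ↔ 3 * (n / 2) ^ 2 * ‖x‖ ^ 2 < 4 * a ^ 2 := by
        have : 16 * (a * n) ^ 2 - 3 * n ^ 4 * ‖x‖ ^ 2 =
          (4 * n ^ 2) * (4 * a ^ 2 - 3 * (n / 2) ^ 2 * ‖x‖ ^ 2) := by ring
        rw [← sub_pos, this, mul_pos_iff_of_pos_left (by positivity), sub_pos]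
      have c3 : 2 * (a * n) < n ^ 2 ↔ a < n / 2 := by
        have : n ^ 2 - 2 * (a * n) = (2 * n) * (n / 2 - a) := by ring
        rw [← sub_pos, this, mul_pos_iff_of_pos_left (by positivity), sub_pos]
      rw [c1, c2, c3, and_assoc]
    have e2 : closedBall (0 : E) l = φ ⁻¹' closedBall 0 l := by
      ext x; simp
    rw [e1]
    nth_rw 1 [e2]
    rw [← Set.preimage_inter, iso_vol _ (measT _), iso_vol _ ((measT _).inter measurableSet_closedBall)]
    exact tri_density l _ hl (by linarith) (by linarith) s hs
  · have : S v = ∅ := by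
      ext x
      simp only [S, Set.mem_ofPred_eq, Set.mem_empty_iff_false, iff_false, not_and, not_lt]
      intro h
      have h1 : inner ℝ x v ≤ ‖x‖ * ‖v‖ := real_inner_le_norm x v
      have h2 : (inner ℝ x v) ^ 2 ≤ (‖x‖ * ‖v‖) ^ 2 := by gcongr
      have h3 : 0 ≤ (‖x‖ * ‖v‖) ^ 2 := by positivity
      nlinarith
    simp [this]

lemma S_disj (v w : E) (hv : 2 ≤ ‖v‖) (hw : 2 ≤ ‖w‖) (hvw : 2 ≤ ‖v - w‖) : Disjoint (S v) (S w) := by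
  rw [Set.disjoint_left]
  intro x hx hy
  have hx0 : x ≠ 0 := by rintro rfl; simp [S] at hx
  have hn : 0 < ‖x‖ := by simpa
  obtain ⟨k, hk0, hk⟩ : ∃ k : ℝ, 0 < k ∧ k ^ 2 * ‖x‖ ^ 2 = 4 / 3 := by
    refine ⟨√(4 / 3) / ‖x‖, by positivity, ?_⟩
    rw [div_pow, Real.sq_sqrt (by norm_num)]
    field_simp
  have key : ∀ u : E, x ∈ S u → ‖k • x - u‖ ^ 2 < 4 / 3 := by
    rintro u ⟨h1, h2⟩
    rw [norm_sub_sq_real, norm_smul, mul_pow, Real.norm_eq_abs, sq_abs, hk, real_inner_smul_left]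
    set i : ℝ := inner ℝ x u
    have : (‖u‖ ^ 2) ^ 2 < (2 * (k * i)) ^ 2 := by
      have h3 : 0 < k ^ 2 := by positivity
      have h4 := mul_lt_mul_of_pos_left h2 h3
      have : k ^ 2 * (3 * ‖u‖ ^ 4 * ‖x‖ ^ 2) = 4 * ‖u‖ ^ 4 := by
        linear_combination 3 * ‖u‖ ^ 4 * hk
      rw [this] at h4
      nlinarith
    have := lt_of_pow_lt_pow_left₀ 2 (by positivity) this
    linarith
  have := key v hx
  have := key w hy
  refine three_points (k • x) (k • x - v) (k • x - w) (by simpa) ?_ (by simpa) ?_ (by linarith) (by linarith)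
  · rw [sub_sub_sub_cancel_left, norm_sub_rev]; exact hvw
  · rw [norm_smul, mul_pow, Real.norm_eq_abs, sq_abs, hk]

/-- The (open) truncated Voronoi cell of `0`. -/
def W (C : Set E) : Set E := {x | ‖x‖ ^ 2 < 4 / 3 ∧ ∀ v ∈ C, 2 * inner ℝ x v < ‖v‖ ^ 2}

lemma cell_density (l : ℝ) (hl : 0 < l) (hl2 : 3 * l ^ 2 < 4) (s : ENNReal)
    (h0 : volume (T 1) ≠ 0) (hinf : volume (T 1) ≠ ⊤)
    (hs : volume (T 1 ∩ closedBall 0 l) = s * volume (T 1))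
    (C : Set E) (hC : C.Countable) (hC2 : ∀ v ∈ C, 2 ≤ ‖v‖)
    (hCC : ∀ v ∈ C, ∀ w ∈ C, v ≠ w → 2 ≤ ‖v - w‖) :
    volume (W C ∩ closedBall 0 l) ≤ s * volume (W C) := by
  have hWm : MeasurableSet (W C) := by
    have : W C = {x : E | ‖x‖ ^ 2 < 4 / 3} ∩ ⋂ v ∈ C, {x : E | 2 * inner ℝ x v < ‖v‖ ^ 2} := by
      ext x; simp [W]
    rw [this]
    refine (isOpen_lt (by fun_prop) (by fun_prop)).measurableSet.inter
      (MeasurableSet.biInter hC fun v _ => (isOpen_lt (by fun_prop) (by fun_prop)).measurableSet)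
  set U : Set E := ⋃ v ∈ C, S v with hU
  have hUm : MeasurableSet U := (isOpen_biUnion fun v _ => isOpenS v).measurableSet
  have hdis : C.PairwiseDisjoint S := by
    intro v hv w hw hvw
    exact S_disj v w (hC2 v hv) (hC2 w hw) (hCC v hv w hw hvw)
  have split : ∀ A : Set E, MeasurableSet A →
      volume A = (∑' v : C, volume (A ∩ S v)) + volume (A \ U) := by
    intro A hA
    rw [← measure_inter_add_sdiff A hUm, hU, Set.inter_iUnion₂, measure_biUnion hC]
    · intro v hv w hw hvw
      exact (hdis hv hw hvw).mono Set.inter_subset_right Set.inter_subset_right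
    · intro v _
      exact hA.inter (isOpenS v).measurableSet
  have mem_S : ∀ x : E, ‖x‖ ^ 2 < 4 / 3 → ∀ v ∈ C, ¬ (2 * inner ℝ x v < ‖v‖ ^ 2) → x ∈ S v := by
    intro x hx v hv h
    have hn := hC2 v hv
    rw [not_lt] at h
    have hn2 : 0 < ‖v‖ ^ 2 := by positivity
    refine ⟨by linarith, ?_⟩
    set i : ℝ := inner ℝ x v
    have h4 : (‖v‖ ^ 2) ^ 2 ≤ (2 * i) ^ 2 := by gcongr
    have h5 : 0 < ‖v‖ ^ 4 := by positivity
    nlinarith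
  have Spiece : ∀ v ∈ C, W C ∩ S v = S v ∩ {x | 2 * inner ℝ x v < ‖v‖ ^ 2} := by
    intro v hv
    ext x
    constructor
    · rintro ⟨h1, h2⟩
      exact ⟨h2, h1.2 v hv⟩
    · rintro ⟨h1, h2⟩
      have hx : ‖x‖ ^ 2 < 4 / 3 := by
        obtain ⟨h3, h4⟩ := h1
        have h2' : 2 * inner ℝ x v < ‖v‖ ^ 2 := h2
        set i : ℝ := inner ℝ x v
        have h5 : (2 * i) ^ 2 < (‖v‖ ^ 2) ^ 2 := by gcongr
        have h6 : 0 < ‖v‖ ^ 4 := by have := hC2 v hv; positivity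
        by_contra h7
        rw [not_lt] at h7
        nlinarith
      refine ⟨⟨hx, fun w hw => ?_⟩, h1⟩
      by_cases hwv : w = v
      · rw [hwv]; exact h2
      · by_contra h8
        exact Set.disjoint_left.1 (hdis hw hv hwv) (mem_S x hx w hw h8) h1
  have Kpiece : W C \ U = {x : E | ‖x‖ ^ 2 < 4 / 3} \ U := by
    ext x
    constructor
    · rintro ⟨h1, h2⟩
      exact ⟨h1.1, h2⟩
    · rintro ⟨h1, h2⟩
      refine ⟨⟨h1, fun v hv => ?_⟩, h2⟩
      by_contra h3
      exact h2 (Set.mem_biUnion hv (mem_S x h1 v hv h3))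
  have Ucone : ∀ k : ℝ, 0 < k → ∀ x, k • x ∈ U → x ∈ U := by
    intro k hk x hx
    simp only [hU, Set.mem_iUnion] at hx ⊢
    obtain ⟨v, hv, h1, h2⟩ := hx
    refine ⟨v, hv, ?_, ?_⟩
    · rw [real_inner_smul_left] at h1
      exact (mul_pos_iff_of_pos_left hk).1 h1
    · rw [real_inner_smul_left, norm_smul, Real.norm_eq_abs, mul_pow, sq_abs] at h2
      have : 0 < k ^ 2 := by positivity
      by_contra h3
      nlinarith
  obtain ⟨k, hk0, hk⟩ : ∃ k : ℝ, 0 < k ∧ k ^ 2 = 3 / 4 * l ^ 2 :=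
    ⟨√(3 / 4 * l ^ 2), Real.sqrt_pos.2 (by positivity), Real.sq_sqrt (by positivity)⟩
  have Kdens : volume ((W C ∩ closedBall 0 l) \ U) ≤ s * volume (W C \ U) := by
    have sub : (W C ∩ closedBall 0 l) \ U ⊆ k • (W C \ U) ∪ sphere 0 l := by
      rintro x ⟨⟨h1, h2⟩, h3⟩
      rw [mem_closedBall_zero_iff] at h2
      rcases h2.lt_or_eq with h4 | h4
      · left
        rw [Kpiece]
        refine ⟨k⁻¹ • x, ⟨?_, ?_⟩, ?_⟩
        · simp only [Set.mem_ofPred_eq, norm_smul, Real.norm_eq_abs, mul_pow, sq_abs, inv_pow, hk]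
          have : ‖x‖ ^ 2 < l ^ 2 := by gcongr
          rw [inv_mul_lt_iff₀ (by positivity)]
          linarith
        · exact fun h => h3 (Ucone _ (by positivity) x h)
        · exact smul_inv_smul₀ hk0.ne' x
      · right; simpa using h4
    calc _ ≤ volume (k • (W C \ U) ∪ sphere 0 l) := measure_mono sub
      _ ≤ volume (k • (W C \ U)) + volume (sphere (0 : E) l) := measure_union_le _ _
      _ = ENNReal.ofReal (3 / 4 * l ^ 2) * volume (W C \ U) := by
        rw [Measure.addHaar_sphere, add_zero, Measure.addHaar_smul_of_nonneg _ hk0.le, finrankE, hk]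
      _ ≤ _ := by gcongr; exact tri_lower l hl hl2 s h0 hinf hs
  rw [split _ hWm, split _ (hWm.inter measurableSet_closedBall), mul_add, ← ENNReal.tsum_mul_left]
  gcongr with v
  have e : W C ∩ closedBall 0 l ∩ S v = W C ∩ S v ∩ closedBall 0 l := Set.inter_right_comm _ _ _
  rw [e, Spiece _ v.2]
  exact S_density l hl.le v (hC2 _ v.2) s hs.le

end SoftDisk
namespace SoftDisk

lemma null_bisector {a b : E} (hab : a ≠ b) : volume {x : E | ‖x - a‖ = ‖x - b‖} = 0 := by
  have : {x : E | ‖x - a‖ = ‖x - b‖} = (AffineSubspace.perpBisector a b : Set E) := by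
    ext x
    simp [AffineSubspace.mem_perpBisector_iff_dist_eq, dist_eq_norm]
  rw [this]
  exact Measure.addHaar_affineSubspace _ _ (by simpa using hab)

lemma vol_pre_sub (c : E) {A : Set E} (hA : MeasurableSet A) :
    volume ((fun x => x - c) ⁻¹' A) = volume A :=
  (measurePreserving_sub_right volume c).measure_preimage hA.nullMeasurableSet

lemma measW {C : Set E} (hC : C.Countable) : MeasurableSet (W C) := by
  have : W C = {x : E | ‖x‖ ^ 2 < 4 / 3} ∩ ⋂ v ∈ C, {x : E | 2 * inner ℝ x v < ‖v‖ ^ 2} := by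
    ext x; simp [W]
  rw [this]
  exact (isOpen_lt (by fun_prop) (by fun_prop)).measurableSet.inter
    (MeasurableSet.biInter hC fun v _ => (isOpen_lt (by fun_prop) (by fun_prop)).measurableSet)

lemma closer_iff (x a b : E) :
    2 * inner ℝ (x - a) (b - a) < ‖b - a‖ ^ 2 ↔ ‖x - a‖ < ‖x - b‖ := by
  have e : x - b = (x - a) - (b - a) := by abel
  have := norm_sub_sq_real (x - a) (b - a)
  rw [← e] at this
  rw [← sq_lt_sq₀ (norm_nonneg _) (norm_nonneg _), this]
  constructor <;> intro h <;> linarith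

/-- difference vectors from the `i`-th center -/
def Cd (c : ℕ → E) (i : ℕ) : Set E := (fun j => c j - c i) '' {j | j ≠ i}

/-- truncated Voronoi cell of the `i`-th center -/
def V (c : ℕ → E) (i : ℕ) : Set E := (fun x => x - c i) ⁻¹' W (Cd c i)

lemma Cd_countable (c : ℕ → E) (i : ℕ) : (Cd c i).Countable := (Set.to_countable _).image _

lemma measV (c : ℕ → E) (i : ℕ) : MeasurableSet (V c i) :=
  (measW (Cd_countable c i)).preimage (by fun_prop)

lemma mem_V (c : ℕ → E) (i : ℕ) (x : E) :
    x ∈ V c i ↔ ‖x - c i‖ ^ 2 < 4 / 3 ∧ ∀ j, j ≠ i → ‖x - c i‖ < ‖x - c j‖ := by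
  simp only [V, W, Cd, Set.mem_preimage, Set.mem_ofPred_eq, Set.forall_mem_image, closer_iff]

lemma upper (l : ℝ) (hl : 0 < l) (hl2 : 3 * l ^ 2 < 4) (s : ENNReal)
    (h0 : volume (T 1) ≠ 0) (hinf : volume (T 1) ≠ ⊤)
    (hs : volume (T 1 ∩ closedBall 0 l) = s * volume (T 1))
    (c : ℕ → E) (hc : ∀ j k : ℕ, j ≠ k → 2 ≤ ‖c j - c k‖) (R : ℝ) :
    volume ((⋃ i : ℕ, closedBall (c i) l) ∩ closedBall 0 R) ≤
      s * volume (closedBall (0 : E) (R + 4)) := by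
  have hl3 : l < 2 := by nlinarith
  set I : Set ℕ := {i | ‖c i‖ ≤ R + 2} with hI
  set N : Set E := ⋃ i : ℕ, ⋃ j ∈ {j : ℕ | j ≠ i}, {x : E | ‖x - c i‖ = ‖x - c j‖} with hN
  have cne : ∀ i j, j ≠ i → c i ≠ c j := by
    intro i j hij h
    have := hc i j hij.symm
    rw [h] at this; norm_num at this
  have hN0 : volume N = 0 := by
    rw [hN, measure_iUnion_null_iff]
    intro i
    rw [measure_biUnion_null_iff (Set.to_countable _)]
    intro j hj
    exact null_bisector (cne i j hj)
  have cell : ∀ i, volume (V c i ∩ closedBall (c i) l) ≤ s * volume (V c i) := by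
    intro i
    have e : closedBall (c i) l = (fun x => x - c i) ⁻¹' closedBall 0 l := by
      ext x; simp [dist_eq_norm]
    rw [e, V, ← Set.preimage_inter, vol_pre_sub _ (measW (Cd_countable c i)),
      vol_pre_sub _ ((measW (Cd_countable c i)).inter measurableSet_closedBall)]
    apply cell_density l hl hl2 s h0 hinf hs _ (Cd_countable c i)
    · rintro _ ⟨j, hj, rfl⟩
      exact hc _ _ hj
    · rintro _ ⟨j, hj, rfl⟩ _ ⟨k, hk, rfl⟩ hjk
      simp only [sub_sub_sub_cancel_right]
      apply hc
      rintro rfl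
      exact hjk rfl
  have sub : (⋃ i : ℕ, closedBall (c i) l) ∩ closedBall 0 R ⊆
      (⋃ i ∈ I, (V c i ∩ closedBall (c i) l)) ∪ N := by
    rintro x ⟨h1, h2⟩
    by_cases hx : x ∈ N
    · exact Or.inr hx
    left
    have ht : ∀ i j, j ≠ i → ‖x - c i‖ ≠ ‖x - c j‖ := by
      intro i j hij h
      exact hx (Set.mem_iUnion.2 ⟨i, Set.mem_biUnion hij h⟩)
    obtain ⟨i, hi⟩ := Set.mem_iUnion.1 h1
    rw [mem_closedBall, dist_eq_norm] at hi
    have small : ∀ j, ‖x - c j‖ ≤ l → ‖x - c j‖ ^ 2 < 4 / 3 := by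
      intro j hj
      have : ‖x - c j‖ ^ 2 ≤ l ^ 2 := by gcongr
      linarith
    have fin : ∀ j, ‖x - c j‖ ≤ l → (∀ k, k ≠ j → ‖x - c j‖ < ‖x - c k‖) →
        x ∈ ⋃ i ∈ I, (V c i ∩ closedBall (c i) l) := by
      intro j hj hk
      refine Set.mem_biUnion (x := j) ?_ ⟨(mem_V c j x).2 ⟨small j hj, hk⟩, ?_⟩
      · have h3 : ‖c j‖ ≤ ‖x‖ + ‖x - c j‖ := by
          have := norm_sub_le x (x - c j); simpa using this
        rw [mem_closedBall_zero_iff] at h2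
        change ‖c j‖ ≤ R + 2
        linarith
      · rw [mem_closedBall, dist_eq_norm]; exact hj
    by_cases h3 : ∀ k, k ≠ i → ‖x - c i‖ < ‖x - c k‖
    · exact fin i hi h3
    push Not at h3
    obtain ⟨j, hji, h3⟩ := h3
    have h3 := lt_of_le_of_ne h3 (ht i j hji).symm
    by_cases h4 : ∀ k, k ≠ j → ‖x - c j‖ < ‖x - c k‖
    · exact fin j (by linarith) h4
    push Not at h4
    obtain ⟨k, hkj, h4⟩ := h4
    have h4 := lt_of_le_of_ne h4 (ht j k hkj).symm
    have hki : k ≠ i := by rintro rfl; linarith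
    exfalso
    refine three_points (x - c i) (x - c j) (x - c k) ?_ ?_ ?_ (small i hi).le
      (small j (by linarith)).le (small k (by linarith))
    · simpa using hc j i hji
    · simpa using hc k j hkj
    · simpa using hc k i hki
  calc _ ≤ volume ((⋃ i ∈ I, (V c i ∩ closedBall (c i) l)) ∪ N) := measure_mono sub
    _ ≤ volume (⋃ i ∈ I, (V c i ∩ closedBall (c i) l)) + volume N := measure_union_le _ _
    _ = volume (⋃ i ∈ I, (V c i ∩ closedBall (c i) l)) := by rw [hN0, add_zero]
    _ ≤ ∑' i : I, volume (V c i ∩ closedBall (c i) l) := measure_biUnion_le _ (Set.to_countable _) _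
    _ ≤ ∑' i : I, s * volume (V c i) := ENNReal.tsum_le_tsum fun i => cell i
    _ = s * volume (⋃ i ∈ I, V c i) := by
      rw [ENNReal.tsum_mul_left, measure_biUnion (Set.to_countable _)]
      · intro i _ j _ hij
        rw [Function.onFun, Set.disjoint_left]
        intro x hi hj
        have := ((mem_V c i x).1 hi).2 j hij.symm
        have := ((mem_V c j x).1 hj).2 i hij
        linarith
      · intro i _; exact measV c i
    _ ≤ s * volume (closedBall (0 : E) (R + 4)) := by
      gcongr
      intro x hx
      obtain ⟨i, hi, hx⟩ := Set.mem_iUnion₂.1 hx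
      have h1 := ((mem_V c i x).1 hx).1
      have h2 : ‖x - c i‖ < 2 := by nlinarith [norm_nonneg (x - c i)]
      have h3 : ‖c i‖ ≤ R + 2 := hi
      rw [mem_closedBall_zero_iff]
      have := norm_add_le (x - c i) (c i)
      rw [sub_add_cancel] at this
      linarith

end SoftDisk
namespace SoftDisk

lemma exists_frame2 (t : Fin 3 → E) (ht : ∀ i j : Fin 3, i ≠ j → ‖t i - t j‖ = 2) :
    ∃ φ : E ≃ₗᵢ[ℝ] E, φ (t 1 - t 0) = !₂[2, 0] ∧ φ (t 2 - t 0) = !₂[1, √3] := by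
  set a := t 1 - t 0 with ha
  set b := t 2 - t 0 with hb
  have haa : inner ℝ a a = (4 : ℝ) := by
    rw [real_inner_self_eq_norm_sq, ha, ht 1 0 (by decide)]; norm_num
  have hbb : inner ℝ b b = (4 : ℝ) := by
    rw [real_inner_self_eq_norm_sq, hb, ht 2 0 (by decide)]; norm_num
  have hab : inner ℝ a b = (2 : ℝ) := by
    have h1 := norm_sub_sq_real a b
    have h2 : a - b = t 1 - t 2 := by simp [ha, hb]
    rw [h2, ht 1 2 (by decide), ← real_inner_self_eq_norm_sq, ← real_inner_self_eq_norm_sq, haa, hbb] at h1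
    linarith
  have hba : inner ℝ b a = (2 : ℝ) := by rw [real_inner_comm]; exact hab
  have h3 : √3 ^ 2 = (3 : ℝ) := Real.sq_sqrt (by norm_num)
  have h30 : √3 ≠ 0 := by positivity
  set f : Fin 2 → E := ![(1 / 2 : ℝ) • a, (√3)⁻¹ • (b - (1 / 2 : ℝ) • a)] with hf
  have ho : Orthonormal ℝ ((Set.univ : Set (Fin 2)).domRestrict f) := by
    rw [orthonormal_iff_ite]
    rintro ⟨i, hi⟩ ⟨j, hj⟩
    fin_cases i <;> fin_cases j <;>
      simp [hf, inner_smul_left, inner_smul_right, inner_sub_left, inner_sub_right, haa, hab, hbb,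
        hba, -inner_self_eq_norm_sq_to_K] <;> (try norm_num) <;> field_simp <;> linarith
  obtain ⟨B, hB⟩ := ho.exists_orthonormalBasis_extension_of_card_eq (by simp)
  refine ⟨B.repr, ?_, ?_⟩
  · apply ext2
    · rw [B.repr_apply_apply, hB 0 (Set.mem_univ _)]
      simp [hf, inner_smul_left, haa, -inner_self_eq_norm_sq_to_K]; norm_num
    · rw [B.repr_apply_apply, hB 1 (Set.mem_univ _)]
      simp [hf, inner_smul_left, inner_sub_left, haa, hba, -inner_self_eq_norm_sq_to_K]; norm_num
  · apply ext2
    · rw [B.repr_apply_apply, hB 0 (Set.mem_univ _)]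
      simp [hf, inner_smul_left, hab]
    · rw [B.repr_apply_apply, hB 1 (Set.mem_univ _)]
      simp [hf, inner_smul_left, inner_sub_left, hab, hbb, -inner_self_eq_norm_sq_to_K]
      field_simp; linarith

lemma mem_hull (t : Fin 3 → E) (x : E) : x ∈ convexHull ℝ (Set.range t) ↔
    ∃ a b : ℝ, 0 ≤ a ∧ 0 ≤ b ∧ a + b ≤ 1 ∧ x - t 0 = a • (t 1 - t 0) + b • (t 2 - t 0) := by
  constructor
  · intro hx
    have : convexHull ℝ (Set.range t) ⊆ {x | ∃ a b : ℝ, 0 ≤ a ∧ 0 ≤ b ∧ a + b ≤ 1 ∧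
        x - t 0 = a • (t 1 - t 0) + b • (t 2 - t 0)} := by
      apply convexHull_min
      · rintro _ ⟨i, rfl⟩
        fin_cases i
        · exact ⟨0, 0, by simp⟩
        · exact ⟨1, 0, by simp⟩
        · exact ⟨0, 1, by simp⟩
      · rintro x ⟨a, b, ha, hb, hab, hx⟩ y ⟨a', b', ha', hb', hab', hy⟩ u v hu hv huv
        refine ⟨u * a + v * a', u * b + v * b', by positivity, by positivity, by nlinarith, ?_⟩
        have : u • x + v • y - t 0 = u • (x - t 0) + v • (y - t 0) := by
          have : t 0 = (u + v) • t 0 := by rw [huv, one_smul]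
          nth_rw 1 [this]
          module
        rw [this, hx, hy]
        module
    exact this hx
  · rintro ⟨a, b, ha, hb, hab, hx⟩
    have hc := convex_convexHull ℝ (Set.range t)
    have hm : ∀ i, t i ∈ convexHull ℝ (Set.range t) := fun i => subset_convexHull _ _ ⟨i, rfl⟩
    have e : x = ∑ i : Fin 3, ![1 - a - b, a, b] i • t i := by
      rw [Fin.sum_univ_three]
      simp only [Matrix.cons_val]
      have : x = t 0 + (a • (t 1 - t 0) + b • (t 2 - t 0)) := by rw [← hx]; abel
      rw [this]; module
    rw [e]
    apply hc.sum_mem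
    · intro i _; fin_cases i <;> simp <;> linarith
    · rw [Fin.sum_univ_three]; simp; ring
    · intro i _; exact hm i

/-- Right triangle. -/
def H : Set E := {p | 0 ≤ p 1 ∧ √3 * p 1 < p 0 ∧ p 0 < 1}

lemma measH : MeasurableSet H := by
  have : H = {p : E | 0 ≤ p 1} ∩ ({p : E | √3 * p 1 < p 0} ∩ {p : E | p 0 < 1}) := by
    ext x; simp [H]
  rw [this]
  exact (isClosed_le (by fun_prop) (by fun_prop)).measurableSet.inter
    ((isOpen_lt (by fun_prop) (by fun_prop)).measurableSet.inter
      (isOpen_lt (by fun_prop) (by fun_prop)).measurableSet)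

/-- Piece of the triangle nearest to `t 0`, then `t 1`, then `t 2`. -/
def Hp (t : Fin 3 → E) : Set E :=
  {x | x ∈ convexHull ℝ (Set.range t) ∧ ‖x - t 0‖ < ‖x - t 1‖ ∧ ‖x - t 1‖ < ‖x - t 2‖}

lemma Hp_vol (l : ℝ) (t : Fin 3 → E) (ht : ∀ i j : Fin 3, i ≠ j → ‖t i - t j‖ = 2) :
    volume (Hp t) = volume H ∧
    volume (Hp t ∩ ⋃ i : Fin 3, closedBall (t i) l) = volume (H ∩ closedBall 0 l) := by
  obtain ⟨φ, h1, h2⟩ := exists_frame2 t ht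
  have h3 : √3 ^ 2 = (3 : ℝ) := Real.sq_sqrt (by norm_num)
  have h30 : 0 < √3 := by positivity
  have e1 : Hp t = (fun x => x - t 0) ⁻¹' (φ ⁻¹' H) := by
    ext x
    simp only [Hp, H, Set.mem_ofPred_eq, Set.mem_preimage, mem_hull]
    set p := φ (x - t 0) with hp
    have d0 : ‖x - t 0‖ ^ 2 = p 0 ^ 2 + p 1 ^ 2 := by
      rw [← nsq, hp, LinearIsometryEquiv.norm_map]
    have d1 : ‖x - t 1‖ ^ 2 = (p 0 - 2) ^ 2 + p 1 ^ 2 := by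
      have : x - t 1 = (x - t 0) - (t 1 - t 0) := by abel
      rw [this, ← φ.norm_map, map_sub, nsq, h1, ← hp]; simp
    have d2 : ‖x - t 2‖ ^ 2 = (p 0 - 1) ^ 2 + (p 1 - √3) ^ 2 := by
      have : x - t 2 = (x - t 0) - (t 2 - t 0) := by abel
      rw [this, ← φ.norm_map, map_sub, nsq, h2, ← hp]; simp
    rw [← sq_lt_sq₀ (norm_nonneg _) (norm_nonneg _), ← sq_lt_sq₀ (norm_nonneg _) (norm_nonneg _),
      d0, d1, d2]
    have e : ∀ a b : ℝ, x - t 0 = a • (t 1 - t 0) + b • (t 2 - t 0) ↔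
        p 0 = 2 * a + b ∧ p 1 = √3 * b := by
      intro a b
      rw [← φ.injective.eq_iff, map_add, map_smul, map_smul, h1, h2, ← hp]
      constructor
      · intro h
        rw [h]; constructor <;> simp <;> ring
      · rintro ⟨h, h'⟩
        apply ext2
        · rw [h]; simp; ring
        · rw [h']; simp; ring
    simp only [e]
    constructor
    · rintro ⟨⟨a, b, ha, hb, hab, hp0, hp1⟩, hA, hB⟩
      refine ⟨by rw [hp1]; positivity, by nlinarith, by nlinarith⟩
    · rintro ⟨hA, hB, hC⟩
      have hb : √3 * (p 1 / √3) = p 1 := by field_simp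
      have hb0 : 0 ≤ p 1 / √3 := by positivity
      set b := p 1 / √3
      have hb3 : √3 * p 1 = 3 * b := by rw [← hb]; linear_combination b * h3
      refine ⟨⟨(p 0 - b) / 2, b, by linarith, hb0, by linarith, by ring, hb.symm⟩, by nlinarith, by nlinarith⟩
  have e2 : Hp t ∩ ⋃ i : Fin 3, closedBall (t i) l =
      (fun x => x - t 0) ⁻¹' (φ ⁻¹' (H ∩ closedBall 0 l)) := by
    rw [Set.preimage_inter, Set.preimage_inter, ← e1]
    ext x
    simp only [Set.mem_inter_iff, Set.mem_iUnion, mem_closedBall, dist_eq_norm, Set.mem_preimage,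
      sub_zero, φ.norm_map]
    refine and_congr_right fun hx => ⟨?_, fun h => ⟨0, h⟩⟩
    rintro ⟨i, hi⟩
    have := hx.2.1
    have := hx.2.2
    fin_cases i <;> simp at hi <;> linarith
  have mφ : ∀ A : Set E, MeasurableSet A → MeasurableSet (φ ⁻¹' A) := fun A hA =>
    hA.preimage φ.continuous.measurable
  rw [e2, e1, vol_pre_sub _ (mφ _ measH), iso_vol _ measH,
    vol_pre_sub _ (mφ _ (measH.inter measurableSet_closedBall)),
    iso_vol _ (measH.inter measurableSet_closedBall)]
  exact ⟨rfl, rfl⟩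

lemma measHp (t : Fin 3 → E) : MeasurableSet (Hp t) := by
  have : Hp t = convexHull ℝ (Set.range t) ∩ ({x : E | ‖x - t 0‖ < ‖x - t 1‖} ∩
    {x : E | ‖x - t 1‖ < ‖x - t 2‖}) := by
    ext x; rfl
  rw [this]
  exact (Set.finite_range t).isCompact_convexHull (𝕜 := ℝ) |>.measurableSet.inter
    ((isOpen_lt (by fun_prop) (by fun_prop)).measurableSet.inter
      (isOpen_lt (by fun_prop) (by fun_prop)).measurableSet)

lemma Hp_sum (t : Fin 3 → E) (ht : ∀ i j : Fin 3, i ≠ j → ‖t i - t j‖ = 2) (X : Set E)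
    (hX : MeasurableSet X) :
    volume (convexHull ℝ (Set.range t) ∩ X) =
      ∑ π : Equiv.Perm (Fin 3), volume (Hp (t ∘ π) ∩ X) := by
  set N : Set E := ⋃ i : Fin 3, ⋃ j ∈ {j : Fin 3 | j ≠ i}, {x : E | ‖x - t i‖ = ‖x - t j‖} with hN
  have hN0 : volume N = 0 := by
    rw [hN, measure_iUnion_null_iff]
    intro i
    rw [measure_biUnion_null_iff (Set.to_countable _)]
    intro j hj
    apply null_bisector
    intro h
    have := ht j i hj
    rw [h] at this; norm_num at this
  have hr : ∀ π : Equiv.Perm (Fin 3), Set.range (t ∘ π) = Set.range t := fun π =>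
    π.surjective.range_comp t
  have mono : ∀ (π : Equiv.Perm (Fin 3)) x, x ∈ Hp (t ∘ π) →
      StrictMono ((fun i => ‖x - t i‖) ∘ π) := by
    intro π x hx
    rw [Fin.strictMono_iff_lt_succ]
    intro i
    fin_cases i
    · exact hx.2.1
    · exact hx.2.2
  have hd : Pairwise (Function.onFun Disjoint fun π : Equiv.Perm (Fin 3) => Hp (t ∘ π) ∩ X) := by
    intro π π' hne
    rw [Function.onFun, Set.disjoint_left]
    rintro x ⟨h1, _⟩ ⟨h2, _⟩
    have m1 := mono π x h1
    have m2 := mono π' x h2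
    have e := Tuple.unique_monotone m1.monotone m2.monotone
    apply hne
    have inj : Function.Injective (fun i => ‖x - t i‖) := by
      have := m1.injective.comp π.symm.injective
      simpa [Function.comp_assoc] using this
    ext i
    exact congrArg _ (inj (congrFun e i))
  have hU : volume (⋃ π : Equiv.Perm (Fin 3), Hp (t ∘ π) ∩ X) =
      ∑ π : Equiv.Perm (Fin 3), volume (Hp (t ∘ π) ∩ X) := by
    rw [measure_iUnion hd (fun π => (measHp _).inter hX), tsum_fintype]
  rw [← hU]
  apply le_antisymm
  · have sub : convexHull ℝ (Set.range t) ∩ X ⊆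
        (⋃ π : Equiv.Perm (Fin 3), Hp (t ∘ π) ∩ X) ∪ N := by
      rintro x ⟨h1, h2⟩
      by_cases hx : x ∈ N
      · exact Or.inr hx
      left
      have inj : Function.Injective (fun i => ‖x - t i‖) := by
        intro i j hij
        by_contra hne
        exact hx (Set.mem_iUnion.2 ⟨i, Set.mem_biUnion (fun h => hne h.symm) hij⟩)
      set f : Fin 3 → ℝ := fun i => ‖x - t i‖
      have sm : StrictMono (f ∘ Tuple.sort f) :=
        (Tuple.monotone_sort f).strictMono_of_injective (inj.comp (Tuple.sort f).injective)
      refine Set.mem_iUnion.2 ⟨Tuple.sort f, ⟨?_, ?_, ?_⟩, h2⟩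
      · rw [hr]; exact h1
      · exact sm (by decide : (0 : Fin 3) < 1)
      · exact sm (by decide : (1 : Fin 3) < 2)
    calc _ ≤ _ := measure_mono sub
      _ ≤ _ := measure_union_le _ _
      _ = _ := by rw [hN0, add_zero]
  · apply measure_mono
    apply Set.iUnion_subset
    rintro π x ⟨h1, h2⟩
    refine ⟨?_, h2⟩
    rw [← hr π]
    exact h1.1

lemma D_vol (l : ℝ) (t : Fin 3 → E) (ht : ∀ i j : Fin 3, i ≠ j → ‖t i - t j‖ = 2) :
    volume (convexHull ℝ (Set.range t)) = 6 * volume H ∧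
    volume (convexHull ℝ (Set.range t) ∩ ⋃ i : Fin 3, closedBall (t i) l) =
      6 * volume (H ∩ closedBall 0 l) := by
  have ht' : ∀ π : Equiv.Perm (Fin 3), ∀ i j : Fin 3, i ≠ j → ‖(t ∘ π) i - (t ∘ π) j‖ = 2 :=
    fun π i j hij => ht _ _ (fun h => hij (π.injective h))
  have hc : Fintype.card (Equiv.Perm (Fin 3)) = 6 := by decide
  constructor
  · have := Hp_sum t ht Set.univ MeasurableSet.univ
    simp only [Set.inter_univ, (Hp_vol l _ (ht' _)).1] at this
    rw [this, Finset.sum_const, Finset.card_univ, hc]; simp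
  · have := Hp_sum t ht (⋃ i : Fin 3, closedBall (t i) l)
      (MeasurableSet.iUnion fun i => measurableSet_closedBall)
    rw [this]
    have e : ∀ π : Equiv.Perm (Fin 3), volume (Hp (t ∘ π) ∩ ⋃ i : Fin 3, closedBall (t i) l) =
        volume (H ∩ closedBall 0 l) := by
      intro π
      rw [← (Hp_vol l _ (ht' π)).2]
      congr 2
      exact (π.surjective.iUnion_comp fun i => closedBall (t i) l).symm
    simp only [e]
    rw [Finset.sum_const, Finset.card_univ, hc]; simp

lemma null_p1 : volume {p : E | p 1 = 0} = 0 := by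
  have h : (!₂[0, 1] : E) ≠ !₂[0, -1] := by
    intro h
    have := congrArg (fun p : E => p 1) h
    norm_num at this
  convert null_bisector h using 2
  ext p
  simp only [Set.mem_ofPred_eq]
  rw [← sq_eq_sq₀ (norm_nonneg _) (norm_nonneg _), nsq, nsq]
  simp
  constructor
  · intro h; rw [h]; norm_num
  · intro h; linarith

lemma T_vol (l : ℝ) (hl : 0 ≤ l) : volume (T 1) = 2 * volume H ∧
    volume (T 1 ∩ closedBall 0 l) = 2 * volume (H ∩ closedBall 0 l) := by
  have h3 : √3 ^ 2 = (3 : ℝ) := Real.sq_sqrt (by norm_num)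
  have h30 : 0 < √3 := by positivity
  have hoI : Orthonormal ℝ ((Set.univ : Set (Fin 2)).domRestrict
      (![!₂[1, 0], !₂[0, -1]] : Fin 2 → E)) := by
    rw [orthonormal_iff_ite]
    rintro ⟨i, hi⟩ ⟨j, hj⟩
    fin_cases i <;> fin_cases j <;> simp [PiLp.inner_apply, -inner_self_eq_norm_sq_to_K]
  obtain ⟨B, hB⟩ := hoI.exists_orthonormalBasis_extension_of_card_eq (by simp)
  have hB0 : ∀ p : E, B.repr p 0 = p 0 := by
    intro p
    rw [B.repr_apply_apply, hB 0 (Set.mem_univ _)]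
    simp [PiLp.inner_apply]
  have hB1 : ∀ p : E, B.repr p 1 = - p 1 := by
    intro p
    rw [B.repr_apply_apply, hB 1 (Set.mem_univ _)]
    simp [PiLp.inner_apply]
  have e : T 1 = H ∪ B.repr ⁻¹' H := by
    ext p
    simp only [T, H, Set.mem_union, Set.mem_preimage, Set.mem_ofPred_eq, hB0, hB1]
    constructor
    · rintro ⟨a, b, c⟩
      rcases le_total 0 (p 1) with h | h
      · left; exact ⟨h, by nlinarith, c⟩
      · right; exact ⟨by linarith, by nlinarith, c⟩
    · rintro (⟨a, b, c⟩ | ⟨a, b, c⟩)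
      · have : 0 ≤ √3 * p 1 := by positivity
        exact ⟨by linarith, by nlinarith, c⟩
      · have : 0 ≤ √3 * (- p 1) := by positivity
        exact ⟨by linarith, by nlinarith, c⟩
  have main : ∀ X : Set E, MeasurableSet X → B.repr ⁻¹' X = X → volume (T 1 ∩ X) =
      2 * volume (H ∩ X) := by
    intro X hX hBX
    rw [e, Set.union_inter_distrib_right]
    have hm : MeasurableSet (B.repr ⁻¹' (H ∩ X)) :=
      (measH.inter hX).preimage B.repr.continuous.measurable
    nth_rw 2 [← hBX]
    rw [← Set.preimage_inter, measure_union₀ hm.nullMeasurableSet, iso_vol _ (measH.inter hX), two_mul]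
    apply measure_mono_null _ null_p1
    rintro p ⟨⟨h1, _⟩, ⟨h2, _⟩⟩
    have h1 := h1.1
    have h2 := h2.1
    rw [hB1] at h2
    change p 1 = 0
    linarith
  constructor
  · simpa using main Set.univ MeasurableSet.univ rfl
  · apply main _ measurableSet_closedBall
    ext x; simp

lemma H_pos : volume H ≠ 0 := by
  have ho : IsOpen ({p : E | 0 < p 1} ∩ ({p : E | √3 * p 1 < p 0} ∩ {p : E | p 0 < 1})) :=
    (isOpen_lt (by fun_prop) (by fun_prop)).inter
    ((isOpen_lt (by fun_prop) (by fun_prop)).inter (isOpen_lt (by fun_prop) (by fun_prop)))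
  have hne : ({p : E | 0 < p 1} ∩ ({p : E | √3 * p 1 < p 0} ∩ {p : E | p 0 < 1})).Nonempty := by
    refine ⟨!₂[1 / 2, 1 / 8], ?_, ?_, ?_⟩
    · simp
    · simp
      nlinarith [Real.sq_sqrt (show (0 : ℝ) ≤ 3 by norm_num), Real.sqrt_nonneg 3]
    · simp; norm_num
  refine fun h => (ho.measure_pos volume hne).ne' (measure_mono_null ?_ h)
  rintro p ⟨h1, h2, h3⟩
  exact ⟨le_of_lt h1, h2, h3⟩

lemma H_fin : volume H ≠ ⊤ := by
  refine ((measure_mono ?_).trans_lt (measure_closedBall_lt_top (x := (0 : E)) (r := 2))).ne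
  rintro p ⟨h1, h2, h3⟩
  rw [mem_cb _ (by norm_num)]
  have : 1 ≤ √3 := by rw [Real.one_le_sqrt]; norm_num
  have : p 1 ≤ √3 * p 1 := by nlinarith
  nlinarith

end SoftDisk
namespace SoftDisk

/-- lattice coordinates -/
noncomputable def al (p : E) : ℝ := (p 0 - p 1 / √3) / 2
/-- lattice coordinates -/
noncomputable def be (p : E) : ℝ := p 1 / √3

lemma coord0 (p : E) : p 0 = 2 * al p + be p := by simp [al, be]; ring
lemma coord1 (p : E) : p 1 = √3 * be p := by simp [be]; field_simp

lemma al_sub (p q : E) : al (p - q) = al p - al q := by simp [al]; ring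
lemma be_sub (p q : E) : be (p - q) = be p - be q := by simp [be]; ring

/-- the hexagonal lattice -/
noncomputable def La (z : ℤ × ℤ) : E := !₂[2 * (z.1 : ℝ) + z.2, √3 * z.2]

@[simp] lemma al_La (z : ℤ × ℤ) : al (La z) = z.1 := by simp [al, La]
@[simp] lemma be_La (z : ℤ × ℤ) : be (La z) = z.2 := by simp [be, La]

lemma ab_ext {p q : E} (h : al p = al q) (h' : be p = be q) : p = q := by
  apply ext2
  · rw [coord0, coord0 q, h, h']
  · rw [coord1, coord1 q, h']

lemma norm_ab (p : E) : ‖p‖ ^ 2 = 4 * (al p ^ 2 + al p * be p + be p ^ 2) := by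
  have h3 : √3 ^ 2 = (3 : ℝ) := Real.sq_sqrt (by norm_num)
  rw [nsq, coord0, coord1]
  linear_combination be p ^ 2 * h3

lemma La_sub (z w : ℤ × ℤ) : La z - La w = La (z - w) := by
  apply ab_ext
  · rw [al_sub]; simp
  · rw [be_sub]; simp

lemma La_sep (z w : ℤ × ℤ) (h : z ≠ w) : 2 ≤ ‖La z - La w‖ := by
  rw [La_sub, ← sq_le_sq₀ (by norm_num) (norm_nonneg _), norm_ab, al_La, be_La]
  set u := z - w with hu
  have hu0 : u ≠ 0 := sub_ne_zero.2 h
  have : 1 ≤ u.1 ^ 2 + u.1 * u.2 + u.2 ^ 2 := by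
    by_contra hc
    have h1 : u.1 ^ 2 + u.1 * u.2 + u.2 ^ 2 ≤ 0 := by linarith
    have h2 : u.1 = 0 := by
      have : u.1 ^ 2 = 0 := by nlinarith [sq_nonneg (u.1 + 2 * u.2), sq_nonneg u.1]
      exact pow_eq_zero_iff two_ne_zero |>.1 this
    have h3 : u.2 = 0 := by
      have : u.2 ^ 2 = 0 := by nlinarith [sq_nonneg (u.2 + 2 * u.1), sq_nonneg u.2]
      exact pow_eq_zero_iff two_ne_zero |>.1 this
    exact hu0 (Prod.ext h2 h3)
  have : (1 : ℝ) ≤ (u.1 : ℝ) ^ 2 + u.1 * u.2 + (u.2 : ℝ) ^ 2 := by exact_mod_cast this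
  linarith

/-- union of disks -/
def P (l : ℝ) : Set E := ⋃ z : ℤ × ℤ, closedBall (La z) l

lemma P_pre (l : ℝ) (w : ℤ × ℤ) : (fun x => x - La w) ⁻¹' P l = P l := by
  ext x
  simp only [P, Set.mem_preimage, Set.mem_iUnion, mem_closedBall, dist_eq_norm]
  constructor
  · rintro ⟨z, hz⟩
    refine ⟨z + w, ?_⟩
    convert hz using 2
    have := La_sub (z + w) w
    rw [add_sub_cancel_right] at this
    rw [← this]; abel
  · rintro ⟨z, hz⟩
    refine ⟨z - w, ?_⟩
    convert hz using 2
    rw [← La_sub]; abel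

lemma measP (l : ℝ) : MeasurableSet (P l) := MeasurableSet.iUnion fun _ => measurableSet_closedBall

/-- fundamental domain -/
def F : Set E := {p | (0 ≤ al p ∧ al p < 1) ∧ (0 ≤ be p ∧ be p < 1)}

lemma contal : Continuous al := by unfold al; fun_prop
lemma contbe : Continuous be := by unfold be; fun_prop

lemma measF : MeasurableSet F := by
  have : F = (al ⁻¹' Set.Ico 0 1) ∩ (be ⁻¹' Set.Ico 0 1) := by ext p; rfl
  rw [this]
  exact (measurableSet_Ico.preimage contal.measurable).inter
    (measurableSet_Ico.preimage contbe.measurable)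

/-- standard triangle -/
noncomputable def t0 : Fin 3 → E := ![La (0, 0), La (1, 0), La (0, 1)]

lemma t0_reg : ∀ i j : Fin 3, i ≠ j → ‖t0 i - t0 j‖ = 2 := by
  intro i j hij
  have key : ∀ p : E, ‖p‖ ^ 2 = 4 → ‖p‖ = 2 := by
    intro p hp
    rw [← sq_eq_sq₀ (norm_nonneg _) (by norm_num), hp]; norm_num
  apply key
  rw [norm_ab, al_sub, be_sub]
  fin_cases i <;> fin_cases j <;> first | exact absurd rfl hij | (simp [t0])

lemma mem_D0 (x : E) : x ∈ convexHull ℝ (Set.range t0) ↔ 0 ≤ al x ∧ 0 ≤ be x ∧ al x + be x ≤ 1 := by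
  have e : ∀ a b : ℝ, x - t0 0 = a • (t0 1 - t0 0) + b • (t0 2 - t0 0) ↔ al x = a ∧ be x = b := by
    intro a b
    have h1 : al (a • (t0 1 - t0 0) + b • (t0 2 - t0 0)) = a := by
      simp [t0, La, al]
    have h2 : be (a • (t0 1 - t0 0) + b • (t0 2 - t0 0)) = b := by
      simp [t0, La, be]
    have h3 : x - t0 0 = x := by
      apply ext2 <;> simp [t0, La]
    rw [h3]
    constructor
    · intro h; constructor
      · rw [h, h1]
      · rw [h, h2]
    · rintro ⟨h, h'⟩
      exact ab_ext (h.trans h1.symm) (h'.trans h2.symm)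
  simp only [mem_hull, e]
  constructor
  · rintro ⟨a, b, h1, h2, h3, rfl, rfl⟩; exact ⟨h1, h2, h3⟩
  · rintro ⟨h1, h2, h3⟩; exact ⟨_, _, h1, h2, h3, rfl, rfl⟩

lemma null_be : volume {p : E | be p = 0} = 0 := by
  convert null_p1 using 2
  ext p
  simp only [Set.mem_ofPred_eq]
  rw [coord1]; simp

lemma null_al : volume {p : E | al p = 0} = 0 := by
  have h : La (1, 0) ≠ La (-1, 1) := by
    intro h
    have := congrArg al h
    norm_num at this
  convert null_bisector h using 2
  ext p
  simp only [Set.mem_ofPred_eq]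
  rw [← sq_eq_sq₀ (norm_nonneg _) (norm_nonneg _), norm_ab, norm_ab]
  simp only [al_sub, be_sub, al_La, be_La]
  push_cast
  constructor <;> intro h <;> nlinarith

lemma null_ab : volume {p : E | al p + be p = 1} = 0 := by
  have h : La (0, 0) ≠ La (1, 1) := by
    intro h
    have := congrArg al h
    norm_num at this
  convert null_bisector h using 2
  ext p
  simp only [Set.mem_ofPred_eq]
  rw [← sq_eq_sq₀ (norm_nonneg _) (norm_nonneg _), norm_ab, norm_ab]
  simp only [al_sub, be_sub, al_La, be_La]
  push_cast
  constructor <;> intro h <;> nlinarith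

lemma F_dens (l : ℝ) (s : ENNReal)
    (hs : volume (convexHull ℝ (Set.range t0) ∩ ⋃ i : Fin 3, closedBall (t0 i) l) =
      s * volume (convexHull ℝ (Set.range t0))) :
    s * volume F ≤ volume (F ∩ P l) := by
  set D := convexHull ℝ (Set.range t0) with hD
  set A := ⋃ i : Fin 3, closedBall (t0 i) l with hA
  have hAm : MeasurableSet A := MeasurableSet.iUnion fun _ => measurableSet_closedBall
  have hDm : MeasurableSet D := by
    have h := (Set.finite_range t0).isCompact_convexHull (𝕜 := ℝ)
    exact h.measurableSet
  set D' : Set E := {p | 0 < al p ∧ 0 < be p ∧ al p + be p < 1} with hD'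
  have hD'm : MeasurableSet D' := by
    have : D' = {p | 0 < al p} ∩ ({p | 0 < be p} ∩ {p | al p + be p < 1}) := by
      ext p; rfl
    rw [this]
    have := contal
    have := contbe
    exact ((isOpen_lt (by fun_prop) (by fun_prop)).inter
    ((isOpen_lt (by fun_prop) (by fun_prop)).inter (isOpen_lt (by fun_prop) (by fun_prop)))).measurableSet
  have h1 : volume (D ∩ A) ≤ volume (D' ∩ A) := by
    have sub : D ∩ A ⊆ (D' ∩ A) ∪ ({p : E | al p = 0} ∪ ({p : E | be p = 0} ∪
        {p : E | al p + be p = 1})) := by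
      rintro x ⟨hx, hxA⟩
      rw [mem_D0] at hx
      obtain ⟨ha, hb, hc⟩ := hx
      rcases ha.eq_or_lt with h | ha
      · exact Or.inr (Or.inl h.symm)
      rcases hb.eq_or_lt with h | hb
      · exact Or.inr (Or.inr (Or.inl h.symm))
      rcases hc.eq_or_lt with h | hc
      · exact Or.inr (Or.inr (Or.inr h))
      exact Or.inl ⟨⟨ha, hb, hc⟩, hxA⟩
    calc _ ≤ _ := measure_mono sub
      _ ≤ _ := measure_union_le _ _
      _ = _ := by
        rw [measure_union_null null_al (measure_union_null null_be null_ab), add_zero]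
  set w := La (1, 1)
  have hr : ∀ X : Set E, MeasurableSet X → volume ((fun x => w - x) ⁻¹' X) = volume X := fun X hX =>
    (Measure.measurePreserving_sub_left volume w).measure_preimage hX.nullMeasurableSet
  have hF : volume F ≤ volume D + volume D := by
    nth_rw 2 [← hr D hDm]
    refine (measure_mono ?_).trans (measure_union_le _ _)
    rintro x ⟨⟨a, b⟩, c, d⟩
    rcases le_total (al x + be x) 1 with h | h
    · left; rw [mem_D0]; exact ⟨a, c, h⟩
    · right
      rw [Set.mem_preimage, mem_D0, al_sub, be_sub]
      simp only [w, al_La, be_La]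
      push_cast
      refine ⟨?_, ?_, ?_⟩ <;> linarith
  calc s * volume F ≤ s * (volume D + volume D) := by gcongr
    _ = volume (D ∩ A) + volume (D ∩ A) := by rw [hs, mul_add]
    _ ≤ volume (D' ∩ A) + volume (D' ∩ A) := by gcongr
    _ = volume (D' ∩ A) + volume ((fun x => w - x) ⁻¹' (D' ∩ A)) := by
      rw [hr _ (hD'm.inter hAm)]
    _ = volume ((D' ∩ A) ∪ ((fun x => w - x) ⁻¹' (D' ∩ A))) := by
      rw [measure_union _ ((hD'm.inter hAm).preimage (by fun_prop))]
      rw [Set.disjoint_left]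
      rintro x ⟨⟨_, _, h1⟩, _⟩ ⟨⟨_, _, h2⟩, _⟩
      rw [al_sub, be_sub] at h2
      simp only [w, al_La, be_La] at h2
      push_cast at h2
      linarith
    _ ≤ volume (F ∩ P l) := by
      apply measure_mono
      rintro x (⟨⟨a, b, c⟩, hx⟩ | ⟨⟨a, b, c⟩, hx⟩)
      · refine ⟨⟨⟨by linarith, by linarith⟩, by linarith, by linarith⟩, ?_⟩
        obtain ⟨i, hi⟩ := Set.mem_iUnion.1 hx
        rw [P, Set.mem_iUnion]
        fin_cases i
        · exact ⟨_, hi⟩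
        · exact ⟨_, hi⟩
        · exact ⟨_, hi⟩
      · simp only [al_sub, be_sub, w, al_La, be_La] at a b c
        push_cast at a b c
        refine ⟨⟨⟨by linarith, by linarith⟩, by linarith, by linarith⟩, ?_⟩
        obtain ⟨i, hi⟩ := Set.mem_iUnion.1 hx
        rw [P, Set.mem_iUnion]
        have key : ∀ z : ℤ × ℤ, w - x ∈ closedBall (La z) l → x ∈ closedBall (La ((1, 1) - z)) l := by
          intro z hz
          rw [mem_closedBall, dist_eq_norm] at hz ⊢
          rw [← La_sub, norm_sub_rev]
          have e : La (1, 1) - La z - x = w - x - La z := by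
            change La (1, 1) - La z - x = La (1, 1) - x - La z
            abel
          rw [e]; exact hz
        fin_cases i
        · exact ⟨_, key _ hi⟩
        · exact ⟨_, key _ hi⟩
        · exact ⟨_, key _ hi⟩

lemma lower (l : ℝ) (s : ENNReal)
    (hs : volume (convexHull ℝ (Set.range t0) ∩ ⋃ i : Fin 3, closedBall (t0 i) l) =
      s * volume (convexHull ℝ (Set.range t0))) (R : ℝ) :
    s * volume (closedBall (0 : E) (R - 8)) ≤ volume (P l ∩ closedBall 0 R) := by
  set Fz : ℤ × ℤ → Set E := fun z => (fun x => x - La z) ⁻¹' F with hFz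
  have hm : ∀ z, MeasurableSet (Fz z) := fun z => measF.preimage (by fun_prop)
  have hbd : ∀ x ∈ F, ‖x‖ ≤ 4 := by
    rintro x ⟨⟨a, b⟩, c, d⟩
    rw [← sq_le_sq₀ (norm_nonneg _) (by norm_num), norm_ab]
    nlinarith
  have hdz : Pairwise (Function.onFun Disjoint Fz) := by
    intro z w hzw
    rw [Function.onFun, Set.disjoint_left]
    rintro x ⟨h1, h2⟩ ⟨h3, h4⟩
    simp only [al_sub, be_sub, al_La, be_La] at h1 h2 h3 h4
    apply hzw
    have fl : ∀ (y : ℝ) (n m : ℤ), (0 ≤ y - n ∧ y - n < 1) → (0 ≤ y - m ∧ y - m < 1) → n = m := by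
      intro y n m h h'
      have e1 : ⌊y⌋ = n := Int.floor_eq_iff.2 ⟨by linarith [h.1], by linarith [h.2]⟩
      have e2 : ⌊y⌋ = m := Int.floor_eq_iff.2 ⟨by linarith [h'.1], by linarith [h'.2]⟩
      rw [← e1, e2]
    exact Prod.ext (fl _ _ _ h1 h3) (fl _ _ _ h2 h4)
  set J : Set (ℤ × ℤ) := {z | ‖La z‖ ≤ R - 4} with hJ
  calc s * volume (closedBall (0 : E) (R - 8)) ≤ s * volume (⋃ z ∈ J, Fz z) := by
        gcongr
        intro x hx
        rw [mem_closedBall_zero_iff] at hx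
        have hxF : x ∈ Fz (⌊al x⌋, ⌊be x⌋) := by
          refine ⟨⟨?_, ?_⟩, ?_, ?_⟩ <;> simp only [al_sub, be_sub, al_La, be_La]
          · linarith [Int.floor_le (al x)]
          · linarith [Int.lt_floor_add_one (al x)]
          · linarith [Int.floor_le (be x)]
          · linarith [Int.lt_floor_add_one (be x)]
        refine Set.mem_biUnion (x := (⌊al x⌋, ⌊be x⌋)) ?_ hxF
        have h1 := hbd _ hxF
        have h2 := norm_sub_le x (x - La (⌊al x⌋, ⌊be x⌋))
        rw [sub_sub_cancel] at h2
        change ‖La (⌊al x⌋, ⌊be x⌋)‖ ≤ R - 4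
        linarith
    _ = s * ∑' z : J, volume (Fz z) := by
        rw [measure_biUnion (Set.to_countable _) (fun z _ w _ h => hdz h) (fun z _ => hm z)]
    _ = ∑' z : J, s * volume F := by
        rw [← ENNReal.tsum_mul_left]
        congr 1; ext z
        rw [hFz, vol_pre_sub _ measF]
    _ ≤ ∑' z : J, volume (F ∩ P l) := ENNReal.tsum_le_tsum fun _ => F_dens l s hs
    _ = ∑' z : J, volume (Fz z ∩ P l) := by
        congr 1; ext z
        rw [hFz]
        nth_rw 2 [← P_pre l z]
        rw [← Set.preimage_inter, vol_pre_sub _ (measF.inter (measP l))]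
    _ = volume (⋃ z ∈ J, (Fz z ∩ P l)) := by
        rw [measure_biUnion (Set.to_countable _) _ (fun z _ => (hm z).inter (measP l))]
        intro z _ w _ h
        exact (hdz h).mono Set.inter_subset_left Set.inter_subset_left
    _ ≤ _ := by
        apply measure_mono
        apply Set.iUnion₂_subset
        rintro z hz x ⟨h1, h2⟩
        refine ⟨h2, ?_⟩
        have h3 := hbd _ h1
        have h4 : ‖La z‖ ≤ R - 4 := hz
        rw [mem_closedBall_zero_iff]
        have := norm_add_le (x - La z) (La z)
        rw [sub_add_cancel] at this
        linarith

lemma ball_real (R : ℝ) (hR : 0 ≤ R) :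
    (volume (closedBall (0 : E) R)).toReal = R ^ 2 * (volume (ball (0 : E) 1)).toReal := by
  rw [Measure.addHaar_closedBall _ _ hR, finrankE, ENNReal.toReal_mul, ENNReal.toReal_ofReal (by positivity)]

end SoftDisk

open Filter SoftDisk in
/-- In the plane, for `0 ≤ λ < 2/√3 - 1` and a regular triangle `T² = conv{t 1, t 2, t 3}` of
side length `2`, the supremum over all infinite packings of unit disks of the upper density of
their outer parallel domains of outer radius `λ` equals
`σ̄₂(λ) = vol₂(T² ∩ ⋃ (t i + (1+λ)B²)) / vol₂(T²)`, and it is attained by some packing. -/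
theorem planar_soft_disk_density_eq_triangle_bound (lam : ℝ) (hlam0 : 0 ≤ lam)
    (hlam1 : lam < 2 / Real.sqrt 3 - 1)
    (t : Fin 3 → EuclideanSpace ℝ (Fin 2))
    (ht : ∀ i j : Fin 3, i ≠ j → ‖t i - t j‖ = 2) :
    IsGreatest
      {x : ℝ | ∃ c : ℕ → EuclideanSpace ℝ (Fin 2),
        (∀ j k : ℕ, j ≠ k → 2 ≤ ‖c j - c k‖) ∧
        x = Filter.limsup (fun R : ℝ =>
          (volume ((⋃ i : ℕ, closedBall (c i) (1 + lam)) ∩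
            closedBall (0 : EuclideanSpace ℝ (Fin 2)) R)).toReal /
          (volume (closedBall (0 : EuclideanSpace ℝ (Fin 2)) R)).toReal) Filter.atTop}
      ((volume (convexHull ℝ (Set.range t) ∩
          ⋃ i : Fin 3, closedBall (t i) (1 + lam))).toReal /
        (volume (convexHull ℝ (Set.range t))).toReal) := by
  set l := 1 + lam with hl
  have hl0 : 0 < l := by linarith
  have hl2 : 3 * l ^ 2 < 4 := by
    have h30 : 0 < √3 := by positivity
    have h1 : l < 2 / √3 := by linarith
    rw [lt_div_iff₀ h30] at h1
    have h2 : (l * √3) ^ 2 < 2 ^ 2 := by gcongr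
    rw [mul_pow, Real.sq_sqrt (by norm_num)] at h2
    linarith
  set s : ENNReal := volume (H ∩ closedBall 0 l) / volume H with hs
  have hsH : volume (H ∩ closedBall 0 l) = s * volume H :=
    (ENNReal.div_mul_cancel H_pos H_fin).symm
  have hsfin : s ≠ ⊤ := ENNReal.div_ne_top (measure_inter_lt_top_of_left_ne_top H_fin).ne H_pos
  obtain ⟨T1, T2⟩ := T_vol l hl0.le
  have hT0 : volume (T 1) ≠ 0 := by rw [T1]; simp [H_pos]
  have hTf : volume (T 1) ≠ ⊤ := by rw [T1]; exact ENNReal.mul_ne_top (by simp) H_fin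
  have hsT : volume (T 1 ∩ closedBall 0 l) = s * volume (T 1) := by
    rw [T1, T2, hsH]; ring
  have hval : (volume (convexHull ℝ (Set.range t) ∩ ⋃ i : Fin 3, closedBall (t i) l)).toReal /
        (volume (convexHull ℝ (Set.range t))).toReal = s.toReal := by
    obtain ⟨D1, D2⟩ := D_vol l t ht
    rw [D1, D2, hs, ENNReal.toReal_div, ENNReal.toReal_mul, ENNReal.toReal_mul,
      mul_div_mul_left _ _ (by norm_num)]
  rw [hval]
  set ω := (volume (ball (0 : E) 1)).toReal with hω
  have hω0 : 0 < ω := ENNReal.toReal_pos (measure_ball_pos _ _ (by norm_num)).ne' measure_ball_lt_top.ne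
  have lim : ∀ a : ℝ, Tendsto (fun R : ℝ => s.toReal * ((R + a) ^ 2 * ω) / (R ^ 2 * ω)) atTop
      (nhds s.toReal) := by
    intro a
    have h1 : Tendsto (fun R : ℝ => s.toReal * (1 + a * R⁻¹) ^ 2) atTop
        (nhds (s.toReal * (1 + a * 0) ^ 2)) :=
      (((tendsto_inv_atTop_zero.const_mul a).const_add 1).pow 2).const_mul _
    simp only [mul_zero, add_zero, one_pow, mul_one] at h1
    refine h1.congr' ?_
    filter_upwards [eventually_gt_atTop 0] with R hR
    field_simp
  have fin : ∀ (X : Set E) (R : ℝ), volume (X ∩ closedBall 0 R) ≠ ⊤ := fun X R =>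
    ((measure_mono Set.inter_subset_right).trans_lt measure_closedBall_lt_top).ne
  have ub : ∀ c : ℕ → E, (∀ j k : ℕ, j ≠ k → 2 ≤ ‖c j - c k‖) →
      ∀ᶠ R : ℝ in atTop, (volume ((⋃ i : ℕ, closedBall (c i) l) ∩ closedBall (0 : E) R)).toReal /
          (volume (closedBall (0 : E) R)).toReal ≤ s.toReal * ((R + 4) ^ 2 * ω) / (R ^ 2 * ω) := by
    intro c hc
    filter_upwards [eventually_gt_atTop 0] with R hR
    rw [ball_real R hR.le]
    gcongr
    rw [hω, ← ball_real (R + 4) (by linarith), ← ENNReal.toReal_mul]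
    exact ENNReal.toReal_mono (ENNReal.mul_ne_top hsfin measure_closedBall_lt_top.ne)
      (upper l hl0 hl2 s hT0 hTf hsT c hc R)
  constructor
  · obtain ⟨e⟩ : Nonempty (ℕ ≃ ℤ × ℤ) := ⟨(Denumerable.eqv (ℤ × ℤ)).symm⟩
    have hc : ∀ j k : ℕ, j ≠ k → 2 ≤ ‖La (e j) - La (e k)‖ :=
      fun j k hjk => La_sep _ _ (fun h => hjk (e.injective h))
    refine ⟨fun n => La (e n), hc, ?_⟩
    have hP : (⋃ i : ℕ, closedBall (La (e i)) l) = P l :=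
      e.surjective.iUnion_comp fun z => closedBall (La z) l
    symm
    apply Tendsto.limsup_eq
    refine tendsto_of_tendsto_of_tendsto_of_le_of_le' (lim (-8)) (lim 4) ?_ (ub _ hc)
    filter_upwards [eventually_gt_atTop 8] with R hR
    rw [ball_real R (by linarith), hP]
    gcongr
    rw [hω, ← ball_real (R + -8) (by linarith), ← ENNReal.toReal_mul]
    refine ENNReal.toReal_mono (fin _ _) (lower l s ?_ R)
    obtain ⟨D1, D2⟩ := D_vol l t0 t0_reg
    rw [D1, D2, hsH]; ring
  · rintro x ⟨c, hc, rfl⟩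
    rw [← (lim 4).limsup_eq]
    refine limsup_le_limsup (ub c hc) ?_ (lim 4).isBoundedUnder_le
    refine IsBoundedUnder.isCoboundedUnder_le ⟨0, ?_⟩
    rw [eventually_map]
    exact Eventually.of_forall fun R => by positivity
end

section
/- Let 0 ≤ λ < 2/√3 − 1, set ℓ = 1 + λ, and let φ₀ = arctan(1/√2). Then for every infinite packing of unit balls in E³ with centers c_1, c_2, …, one has limsup_{R→∞} vol_3((⋃_i (c_i + ℓB³)) ∩ RB³) / vol_3(RB³) ≤ ((20√6·φ₀ − 4√6·π − 10π)·ℓ³ + 18π·ℓ² − 6π) / (3π − 15φ₀ + 5√2). -/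
open MeasureTheory Metric


namespace SoftBall

/-- the angle `φ₀` -/
noncomputable def phi : ℝ := Real.arctan (1 / Real.sqrt 2)

/-- the density bound -/
noncomputable def dens (l : ℝ) : ℝ :=
  ((20 * Real.sqrt 6 * phi - 4 * Real.sqrt 6 * Real.pi - 10 * Real.pi) * l ^ 3
    + 18 * Real.pi * l ^ 2 - 6 * Real.pi) / (3 * Real.pi - 15 * phi + 5 * Real.sqrt 2)

/-- local density at squared distance `s` -/
noncomputable def gg (l s : ℝ) : ℝ := (min 1 (l / Real.sqrt s)) ^ 3

lemma sqrt_two_sq : Real.sqrt 2 * Real.sqrt 2 = 2 := Real.mul_self_sqrt (by norm_num)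
lemma sqrt_three_sq : Real.sqrt 3 * Real.sqrt 3 = 3 := Real.mul_self_sqrt (by norm_num)
lemma sqrt_six : Real.sqrt 6 = Real.sqrt 2 * Real.sqrt 3 := by
  rw [← Real.sqrt_mul (by norm_num)]; norm_num

lemma cos_phi : Real.cos phi = Real.sqrt 2 / Real.sqrt 3 := by
  unfold phi
  rw [Real.cos_arctan, div_pow, Real.sq_sqrt (by norm_num)]
  rw [show (1 : ℝ) + 1 ^ 2 / 2 = 3 / 2 by norm_num, Real.sqrt_div (by norm_num)]
  rw [one_div, inv_div]

lemma sin_phi : Real.sin phi = 1 / Real.sqrt 3 := by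
  unfold phi
  rw [Real.sin_arctan, div_pow, Real.sq_sqrt (by norm_num)]
  rw [show (1 : ℝ) + 1 ^ 2 / 2 = 3 / 2 by norm_num, Real.sqrt_div (by norm_num)]
  have : 0 < Real.sqrt 2 := by positivity
  field_simp

lemma phi_pos : 0 < phi := Real.arctan_pos.2 (by positivity)
lemma phi_lt : phi < Real.pi / 2 := Real.arctan_lt_pi_div_two _

lemma arcsin_phi : Real.arcsin (Real.sqrt 2 / Real.sqrt 3) = Real.pi / 2 - phi := by
  rw [← cos_phi, ← Real.sin_pi_div_two_sub]
  apply Real.arcsin_sin <;> linarith [phi_pos, phi_lt, Real.pi_pos]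

lemma phi_le : phi ≤ 1 / Real.sqrt 2 := by
  have h := Real.le_tan phi_pos.le phi_lt
  rwa [show Real.tan phi = 1 / Real.sqrt 2 from Real.tan_arctan _] at h

lemma sqrt2_lo : 1.4142 < Real.sqrt 2 := Real.lt_sqrt_of_sq_lt (by norm_num)
lemma sqrt2_hi : Real.sqrt 2 < 1.4143 := by rw [Real.sqrt_lt' (by norm_num)]; norm_num
lemma sqrt3_lo : 1.732 < Real.sqrt 3 := Real.lt_sqrt_of_sq_lt (by norm_num)
lemma sqrt3_hi : Real.sqrt 3 < 1.7321 := by rw [Real.sqrt_lt' (by norm_num)]; norm_num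
lemma sqrt6_lo : 2.4494 < Real.sqrt 6 := Real.lt_sqrt_of_sq_lt (by norm_num)
lemma sqrt6_hi : Real.sqrt 6 < 2.4495 := by rw [Real.sqrt_lt' (by norm_num)]; norm_num

lemma den_pos : 0 < 3 * Real.pi - 15 * phi + 5 * Real.sqrt 2 := by
  have h1 : phi ≤ Real.sqrt 2 / 2 := by
    have h := phi_le
    have e : 1 / Real.sqrt 2 = Real.sqrt 2 / 2 := by
      rw [div_eq_div_iff (by positivity) (by norm_num)]; linarith [sqrt_two_sq]
    rwa [e] at h
  linarith [Real.pi_gt_three, sqrt2_hi]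

/-- lower numerical bound for `φ₀` -/
lemma phi_lo : 0.613 < phi := by
  by_contra hcon
  push Not at hcon
  -- cos (phi/2) ≥ 1 - phi^2/8
  have h1 := Real.one_sub_sq_div_two_le_cos (x := phi / 2)
  have h2 : Real.cos phi = 2 * Real.cos (phi / 2) ^ 2 - 1 := by
    rw [← Real.cos_two_mul]; ring_nf
  have h3 : Real.cos phi < 0.81651 := by
    have a : Real.sqrt 2 < 1.414214 := by rw [Real.sqrt_lt' (by norm_num)]; norm_num
    have b : 1.73205 < Real.sqrt 3 := Real.lt_sqrt_of_sq_lt (by norm_num)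
    rw [cos_phi, div_lt_iff₀ (by positivity)]
    linarith
  have h4 : (0.953025 : ℝ) < 1 - (phi / 2) ^ 2 / 2 := by nlinarith [phi_pos]
  nlinarith

/-- key numerical bound -/
lemma dens_lower (l : ℝ) (h1 : 1 ≤ l) (h2 : l < 2 / Real.sqrt 3) :
    l ^ 3 * (Real.sqrt 2 / Real.sqrt 3) * (3 / 4) ≤ dens l := by
  unfold dens
  rw [le_div_iff₀ den_pos]
  have hs3 : 0 < Real.sqrt 3 := by positivity
  set y := l * Real.sqrt 3 / 2 with hy
  have hl : l = 2 * y / Real.sqrt 3 := by rw [hy]; field_simp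
  have hy1 : y ≤ 1 := by
    rw [lt_div_iff₀ hs3] at h2; rw [hy]; linarith
  have hy0 : 0.866 ≤ y := by rw [hy]; nlinarith [sqrt3_lo]
  have h3 : 0 ≤ (1 - y) * (3 * y ^ 2 - y - 1) := by
    apply mul_nonneg (by linarith); nlinarith
  have h4 : (27 * Real.sqrt 3 / 4) * l ^ 3 ≤ 18 * l ^ 2 - 6 := by
    have e1 : (27 * Real.sqrt 3 / 4) * l ^ 3 = 18 * y ^ 3 := by
      rw [hy]; have := sqrt_three_sq
      have e : Real.sqrt 3 ^ 3 = 3 * Real.sqrt 3 := by rw [pow_succ, pow_two, this]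
      ring_nf; rw [e]; ring
    have e2 : 18 * l ^ 2 = 24 * y ^ 2 := by
      rw [hy]; have := Real.sq_sqrt (show (0:ℝ) ≤ 3 by norm_num)
      ring_nf; rw [this]; ring
    rw [e1, e2]; nlinarith
  have hq : Real.sqrt 2 / Real.sqrt 3 < 0.8166 := by
    rw [div_lt_iff₀ hs3]; linarith [sqrt2_hi, sqrt3_lo]
  have hd : 3 * Real.pi - 15 * phi + 5 * Real.sqrt 2 < 7.3025 := by
    linarith [Real.pi_lt_d4, phi_lo, sqrt2_hi]
  have hA : (Real.sqrt 2 / Real.sqrt 3) * (3 / 4) * (3 * Real.pi - 15 * phi + 5 * Real.sqrt 2)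
      ≤ 4.4726 := by
    have : 0 < Real.sqrt 2 / Real.sqrt 3 := by positivity
    nlinarith [den_pos]
  have hB : 30.017 ≤ 20 * Real.sqrt 6 * phi := by nlinarith [phi_lo, sqrt6_lo]
  have hC : 4 * Real.sqrt 6 * Real.pi ≤ 30.7828 := by
    nlinarith [Real.pi_lt_d4, sqrt6_hi, Real.pi_gt_three]
  have hD : 36.72 ≤ Real.pi * (27 * Real.sqrt 3 / 4) := by
    nlinarith [Real.pi_gt_d4, sqrt3_lo]
  have hl3 : 0 < l ^ 3 := by positivity
  have h5 : Real.pi * ((27 * Real.sqrt 3 / 4) * l ^ 3) ≤ Real.pi * (18 * l ^ 2 - 6) :=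
    mul_le_mul_of_nonneg_left h4 Real.pi_pos.le
  have h6 : (Real.sqrt 2 / Real.sqrt 3) * (3 / 4) * (3 * Real.pi - 15 * phi + 5 * Real.sqrt 2)
      - (20 * Real.sqrt 6 * phi - 4 * Real.sqrt 6 * Real.pi - 10 * Real.pi)
      - Real.pi * (27 * Real.sqrt 3 / 4) ≤ 0 := by
    linarith [Real.pi_lt_d4]
  nlinarith [mul_nonneg hl3.le (neg_nonneg.2 h6)]

end SoftBall


namespace SoftBall

lemma gg_nonneg (l s : ℝ) (hl : 0 ≤ l) : 0 ≤ gg l s := by unfold gg; positivity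
lemma gg_le_one (l s : ℝ) (hl : 0 ≤ l) : gg l s ≤ 1 := by
  unfold gg; exact pow_le_one₀ (by positivity) (min_le_left _ _)

lemma gg_measurable (l : ℝ) : Measurable (gg l) := by unfold gg; fun_prop

lemma gg_anti (l s t : ℝ) (hl : 0 ≤ l) (hs : 0 < s) (hst : s ≤ t) : gg l t ≤ gg l s := by
  unfold gg
  have : 0 < Real.sqrt s := Real.sqrt_pos.2 hs
  gcongr

lemma gg_small (l s : ℝ) (hl : 0 ≤ l) (hs0 : 0 < s) (hs : s ≤ l ^ 2) : gg l s = 1 := by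
  unfold gg
  have : Real.sqrt s ≤ l := by rw [Real.sqrt_le_left hl]; exact hs
  rw [min_eq_left, one_pow]
  rwa [le_div_iff₀ (Real.sqrt_pos.2 hs0), one_mul]

lemma gg_big (l s : ℝ) (hs0 : 0 < s) (hs : l ^ 2 ≤ s) :
    gg l s = l ^ 3 / Real.sqrt s ^ 3 := by
  unfold gg
  have : l ≤ Real.sqrt s := Real.le_sqrt_of_sq_le hs
  rw [min_eq_right, div_pow]
  rwa [div_le_iff₀ (Real.sqrt_pos.2 hs0), one_mul]

lemma l_sq (l : ℝ) (h1 : 1 ≤ l) (h2 : l < 2 / Real.sqrt 3) : l ^ 2 < 4 / 3 := by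
  rw [lt_div_iff₀ (by positivity)] at h2
  have := sqrt_three_sq
  have h3 : 0 < l * Real.sqrt 3 := by positivity
  nlinarith

lemma inv_sqrt_two_sq : (1 / Real.sqrt 2) ^ 2 = 1 / 2 := by
  rw [div_pow, Real.sq_sqrt (by norm_num)]; norm_num
lemma inv_sqrt_three_sq : (1 / Real.sqrt 3) ^ 2 = 1 / 3 := by
  rw [div_pow, Real.sq_sqrt (by norm_num)]; norm_num

lemma sqrt_three_half : Real.sqrt (3 / 2) = Real.sqrt 3 / Real.sqrt 2 :=
  Real.sqrt_div (by norm_num) _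

lemma gg_cont (l : ℝ) (s : Set ℝ) : ContinuousOn (fun y : ℝ => y * gg l (1 + y ^ 2)) s := by
  have : Continuous (fun y : ℝ => y * gg l (1 + y ^ 2)) := by
    unfold gg
    have h : ∀ y : ℝ, Real.sqrt (1 + y ^ 2) ≠ 0 := fun y => by positivity
    fun_prop (disch := exact h _)
  exact this.continuousOn

lemma radial_integral (l : ℝ) (h1 : 1 ≤ l) (h2 : l < 2 / Real.sqrt 3) :
    ∫ y in (0 : ℝ)..(1 / Real.sqrt 2), y * gg l (1 + y ^ 2)
      = (l ^ 2 - 1) / 2 + l ^ 2 - l ^ 3 * (Real.sqrt 2 / Real.sqrt 3) := by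
  have hl2 := l_sq l h1 h2
  have hl0 : 0 < l := by linarith
  set a := Real.sqrt (l ^ 2 - 1) with ha
  have ha0 : 0 ≤ a := Real.sqrt_nonneg _
  have ha2 : a ^ 2 = l ^ 2 - 1 := Real.sq_sqrt (by nlinarith)
  have hab : a ≤ 1 / Real.sqrt 2 := by
    apply Real.sqrt_le_iff.2
    refine ⟨by positivity, ?_⟩
    rw [inv_sqrt_two_sq]; linarith
  rw [← intervalIntegral.integral_add_adjacent_intervals (b := a)
    ((gg_cont l _).intervalIntegrable) ((gg_cont l _).intervalIntegrable)]
  have e1 : ∫ y in (0 : ℝ)..a, y * gg l (1 + y ^ 2) = ∫ y in (0 : ℝ)..a, y := by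
    apply intervalIntegral.integral_congr
    intro y hy
    rw [Set.uIcc_of_le ha0] at hy
    have : y ^ 2 ≤ a ^ 2 := pow_le_pow_left₀ hy.1 hy.2 2
    simp only
    rw [gg_small l _ hl0.le (by positivity) (by linarith), mul_one]
  have e2 : ∫ y in a..(1 / Real.sqrt 2), y * gg l (1 + y ^ 2)
      = (- l ^ 3 * (Real.sqrt (1 + (1 / Real.sqrt 2) ^ 2))⁻¹)
        - (- l ^ 3 * (Real.sqrt (1 + a ^ 2))⁻¹) := by
    apply intervalIntegral.integral_eq_sub_of_hasDerivAt
      (f := fun y => - l ^ 3 * (Real.sqrt (1 + y ^ 2))⁻¹)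
    · intro y hy
      rw [Set.uIcc_of_le hab] at hy
      have : a ^ 2 ≤ y ^ 2 := pow_le_pow_left₀ ha0 hy.1 2
      rw [gg_big l _ (by positivity) (by linarith)]
      have hp : (0 : ℝ) < 1 + y ^ 2 := by positivity
      have hs : 0 < Real.sqrt (1 + y ^ 2) := Real.sqrt_pos.2 hp
      have hd : HasDerivAt (fun y : ℝ => 1 + y ^ 2) (2 * y) y := by
        simpa using (hasDerivAt_pow 2 y).const_add 1
      have hd2 := (hd.sqrt hp.ne').fun_inv hs.ne'
      have hd3 := hd2.const_mul (-l ^ 3)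
      refine hd3.congr_deriv ?_
      field_simp
    · exact (gg_cont l _).intervalIntegrable
  rw [e1, e2, integral_id, inv_sqrt_two_sq, ha2]
  rw [show (1 : ℝ) + (l ^ 2 - 1) = l ^ 2 by ring, Real.sqrt_sq hl0.le,
    show (1 : ℝ) + 1 / 2 = 3 / 2 by norm_num, sqrt_three_half]
  field_simp
  ring

lemma disc_integral (l : ℝ) (h1 : 1 ≤ l) (h2 : l < 2 / Real.sqrt 3) :
    ∫ y in ball (0 : ℂ) (1 / Real.sqrt 2), gg l (1 + ‖y‖ ^ 2)
      = Real.pi * (3 * l ^ 2 - 1 - 2 * l ^ 3 * (Real.sqrt 2 / Real.sqrt 3)) := by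
  have h := integral_fun_norm_addHaar (volume : Measure ℂ)
    ((Set.Iio (1 / Real.sqrt 2)).indicator (fun t => gg l (1 + t ^ 2)))
  have e0 : ∀ y : ℂ, (Set.Iio (1 / Real.sqrt 2)).indicator (fun t => gg l (1 + t ^ 2)) ‖y‖
      = (ball (0 : ℂ) (1 / Real.sqrt 2)).indicator (fun y => gg l (1 + ‖y‖ ^ 2)) y := by
    intro y
    simp only [Set.indicator, Set.mem_Iio, mem_ball_zero_iff]
  simp_rw [e0] at h
  rw [integral_indicator measurableSet_ball] at h
  rw [h]
  have e1 : (volume : Measure ℂ).real (ball 0 1) = Real.pi := by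
    simp [Measure.real, Complex.volume_ball]
  rw [e1, Complex.finrank_real_complex]
  have e2 : ∫ y in Set.Ioi (0 : ℝ), y ^ (2 - 1) •
      (Set.Iio (1 / Real.sqrt 2)).indicator (fun t => gg l (1 + t ^ 2)) y
      = ∫ y in (0 : ℝ)..(1 / Real.sqrt 2), y * gg l (1 + y ^ 2) := by
    rw [intervalIntegral.integral_of_le (by positivity), integral_Ioc_eq_integral_Ioo]
    have : ∀ y : ℝ, y ^ (2 - 1) •
      (Set.Iio (1 / Real.sqrt 2)).indicator (fun t => gg l (1 + t ^ 2)) y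
      = (Set.Iio (1 / Real.sqrt 2)).indicator (fun t => t * gg l (1 + t ^ 2)) y := by
      intro y
      simp only [Set.indicator]; split_ifs <;> simp
    simp_rw [this]
    rw [setIntegral_indicator measurableSet_Iio, Set.Ioi_inter_Iio]
  rw [e2, radial_integral l h1 h2]
  simp only [smul_eq_mul, nsmul_eq_mul]
  push_cast
  ring

/-- the one-dimensional density of the segment integral -/
noncomputable def kk (l D u : ℝ) : ℝ :=
  2 * Real.sqrt (1 / 2 - u ^ 2) * (D - l ^ 3 * (Real.sqrt 2 / Real.sqrt 3) / (1 + u ^ 2))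

lemma chord_integral (l D u : ℝ) (h1 : 1 ≤ l) (h2 : l < 2 / Real.sqrt 3)
    (hu : 1 / Real.sqrt 3 ≤ u) (hu2 : u ≤ 1 / Real.sqrt 2) :
    ∫ v in (-Real.sqrt (1 / 2 - u ^ 2))..(Real.sqrt (1 / 2 - u ^ 2)),
      (D - gg l (1 + (u ^ 2 + v ^ 2))) = kk l D u := by
  have hl2 := l_sq l h1 h2
  have h3 : 1 / 3 ≤ u ^ 2 := by
    rw [← inv_sqrt_three_sq]; exact pow_le_pow_left₀ (by positivity) hu 2
  have h4 : u ^ 2 ≤ 1 / 2 := by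
    rw [← inv_sqrt_two_sq]; exact pow_le_pow_left₀ (le_trans (by positivity) hu) hu2 2
  set V := Real.sqrt (1 / 2 - u ^ 2) with hV
  have hV2 : V ^ 2 = 1 / 2 - u ^ 2 := Real.sq_sqrt (by linarith)
  have hc : Continuous (fun v : ℝ => D - gg l (1 + (u ^ 2 + v ^ 2))) := by
    unfold gg
    have h : ∀ v : ℝ, Real.sqrt (1 + (u ^ 2 + v ^ 2)) ≠ 0 := fun y => by positivity
    fun_prop (disch := exact h _)
  have hF := intervalIntegral.integral_eq_sub_of_hasDerivAt (a := -V) (b := V)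
    (f := fun v => D * v - l ^ 3 / (1 + u ^ 2) * (v * (Real.sqrt (1 + (u ^ 2 + v ^ 2)))⁻¹))
    (f' := fun v => D - gg l (1 + (u ^ 2 + v ^ 2))) ?_ (hc.intervalIntegrable _ _)
  · rw [hF]
    simp only [neg_sq, hV2]
    rw [show (1 : ℝ) + (u ^ 2 + (1 / 2 - u ^ 2)) = 3 / 2 by ring, sqrt_three_half]
    unfold kk
    rw [← hV]
    have : 0 < 1 + u ^ 2 := by positivity
    field_simp
    ring
  · intro v _
    have hp : (0 : ℝ) < 1 + (u ^ 2 + v ^ 2) := by positivity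
    have hs : 0 < Real.sqrt (1 + (u ^ 2 + v ^ 2)) := Real.sqrt_pos.2 hp
    have hss := Real.sq_sqrt hp.le
    rw [gg_big l _ (by positivity) (by nlinarith [sq_nonneg v])]
    have hd : HasDerivAt (fun v : ℝ => 1 + (u ^ 2 + v ^ 2)) (2 * v) v := by
      simpa using ((hasDerivAt_pow 2 v).const_add (u ^ 2)).const_add 1
    have hd2 := (hd.sqrt hp.ne').fun_inv hs.ne'
    have hd3 := ((hasDerivAt_id v).mul hd2).const_mul (l ^ 3 / (1 + u ^ 2))
    have hd4 := ((hasDerivAt_id v).const_mul D).sub hd3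
    refine HasDerivAt.congr_deriv (f := fun v => D * v - l ^ 3 / (1 + u ^ 2) *
      (v * (Real.sqrt (1 + (u ^ 2 + v ^ 2)))⁻¹)) hd4 ?_
    have : 0 < 1 + u ^ 2 := by positivity
    simp only [id]
    set S := Real.sqrt (1 + (u ^ 2 + v ^ 2))
    have hS : 1 + u ^ 2 = S ^ 2 - v ^ 2 := by rw [hss]; ring
    rw [hS] at this ⊢
    field_simp
    ring

lemma kk_cont (l D : ℝ) : Continuous (kk l D) := by
  unfold kk
  have h : ∀ v : ℝ, 1 + v ^ 2 ≠ 0 := fun y => by positivity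
  fun_prop (disch := exact h _)

lemma kk_nonneg (l u : ℝ) (h1 : 1 ≤ l) (h2 : l < 2 / Real.sqrt 3)
    (hu : 1 / Real.sqrt 3 ≤ u) : 0 ≤ kk l (dens l) u := by
  have h3 : 1 / 3 ≤ u ^ 2 := by
    rw [← inv_sqrt_three_sq]; exact pow_le_pow_left₀ (by positivity) hu 2
  unfold kk
  apply mul_nonneg (by positivity)
  have := dens_lower l h1 h2
  rw [sub_nonneg]
  refine le_trans ?_ this
  rw [div_le_iff₀ (by positivity)]
  have : 0 ≤ l ^ 3 * (Real.sqrt 2 / Real.sqrt 3) := by positivity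
  nlinarith

end SoftBall


namespace SoftBall

lemma gg_plane_measurable (l h : ℝ) (k : ℝ) :
    Measurable (fun y : ℂ => gg l (h + k * ‖y‖ ^ 2)) :=
  (gg_measurable l).comp (by fun_prop)

lemma gg_plane_measurable' (l h : ℝ) :
    Measurable (fun y : ℂ => gg l (h + ‖y‖ ^ 2)) :=
  (gg_measurable l).comp (by fun_prop)

lemma integrableOn_bdd {f : ℂ → ℝ} (hf : Measurable f) (C : ℝ) (hC : ∀ y, ‖f y‖ ≤ C)
    (s : Set ℂ) (R : ℝ) (hs : s ⊆ ball 0 R) : IntegrableOn f s := by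
  have hfin : volume s < ⊤ := lt_of_le_of_lt (measure_mono hs) measure_ball_lt_top
  exact Measure.integrableOn_of_bounded hfin.ne hf.aestronglyMeasurable
    (Filter.Eventually.of_forall hC)

lemma gg_integrableOn (l h k D : ℝ) (hl : 0 ≤ l) (s : Set ℂ) (R : ℝ) (hs : s ⊆ ball 0 R) :
    IntegrableOn (fun y : ℂ => D - gg l (h + k * ‖y‖ ^ 2)) s := by
  apply integrableOn_bdd (measurable_const.sub (gg_plane_measurable l h k)) (|D| + 1) _ s R hs
  intro y
  rw [Real.norm_eq_abs]
  refine (abs_sub _ _).trans ?_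
  rw [abs_of_nonneg (gg_nonneg l _ hl)]
  linarith [gg_le_one l (h + k * ‖y‖ ^ 2) hl]

lemma gg_integrableOn' (l h D : ℝ) (hl : 0 ≤ l) (s : Set ℂ) (R : ℝ) (hs : s ⊆ ball 0 R) :
    IntegrableOn (fun y : ℂ => D - gg l (h + ‖y‖ ^ 2)) s := by
  simpa using gg_integrableOn l h 1 D hl s R hs

/-- circular segment -/
def seg (d : ℝ) : Set ℂ := {y | y ∈ ball (0 : ℂ) (1 / Real.sqrt 2) ∧ d ≤ y.re}

lemma seg_measurable (d : ℝ) : MeasurableSet (seg d) := by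
  apply measurableSet_ball.inter
  exact measurableSet_le measurable_const Complex.measurable_re

lemma seg_integral (l D d : ℝ) (h1 : 1 ≤ l) (h2 : l < 2 / Real.sqrt 3)
    (hd : 1 / Real.sqrt 3 ≤ d) (hd2 : d ≤ 1 / Real.sqrt 2) :
    ∫ y in seg d, (D - gg l (1 + ‖y‖ ^ 2)) = ∫ u in d..(1 / Real.sqrt 2), kk l D u := by
  have hl : 0 ≤ l := by linarith
  have hd0 : 0 < d := lt_of_lt_of_le (by positivity) hd
  rw [← integral_indicator (seg_measurable d)]
  set F := (seg d).indicator (fun y : ℂ => D - gg l (1 + ‖y‖ ^ 2)) with hF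
  have hintg : Integrable F := by
    rw [integrable_indicator_iff (seg_measurable d)]
    exact gg_integrableOn' l 1 D hl _ _ (fun y hy => hy.1)
  have mp := Complex.volume_preserving_equiv_real_prod.symm
  have e1 := mp.integral_comp (MeasurableEquiv.measurableEmbedding _) F
  have hintg2 := (mp.integrable_comp_emb (MeasurableEquiv.measurableEmbedding _)).2 hintg
  rw [← e1]
  rw [Measure.volume_eq_prod] at hintg2 ⊢
  rw [integral_prod (fun x => F (Complex.measurableEquivRealProd.symm x)) hintg2]
  rw [intervalIntegral.integral_of_le hd2, integral_Ioc_eq_integral_Ioo,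
    ← integral_Ico_eq_integral_Ioo, ← integral_indicator measurableSet_Ico]
  congr 1
  ext u
  have hval : ∀ v : ℝ, F (Complex.measurableEquivRealProd.symm (u, v))
      = (if (u ^ 2 + v ^ 2 < 1 / 2 ∧ d ≤ u) then D - gg l (1 + (u ^ 2 + v ^ 2)) else 0) := by
    intro v
    have hn : ‖(Complex.measurableEquivRealProd.symm (u, v))‖ ^ 2 = u ^ 2 + v ^ 2 := by
      rw [← Complex.normSq_eq_norm_sq, Complex.normSq_apply]
      simp [Complex.measurableEquivRealProd_symm_apply]; ring
    have hmem : (Complex.measurableEquivRealProd.symm (u, v)) ∈ seg d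
        ↔ (u ^ 2 + v ^ 2 < 1 / 2 ∧ d ≤ u) := by
      unfold seg
      rw [Set.mem_ofPred_eq, mem_ball_zero_iff, ← hn, ← inv_sqrt_two_sq]
      rw [pow_lt_pow_iff_left₀ (norm_nonneg _) (by positivity) (by norm_num)]
      simp [Complex.measurableEquivRealProd_symm_apply]
    rw [hF]
    by_cases h : (u ^ 2 + v ^ 2 < 1 / 2 ∧ d ≤ u)
    · rw [if_pos h, Set.indicator_of_mem (hmem.2 h), hn]
    · rw [if_neg h, Set.indicator_of_notMem (fun hh => h (hmem.1 hh))]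
  simp only [hval]
  by_cases hu : u ∈ Set.Ico d (1 / Real.sqrt 2)
  · rw [Set.indicator_of_mem hu]
    rw [← chord_integral l D u h1 h2 (hd.trans hu.1) hu.2.le]
    have hu2 : u ^ 2 < 1 / 2 := by
      rw [← inv_sqrt_two_sq]
      exact pow_lt_pow_left₀ hu.2 (hd0.le.trans hu.1) (by norm_num)
    rw [intervalIntegral.integral_of_le (by linarith [Real.sqrt_nonneg (1 / 2 - u ^ 2)]),
      integral_Ioc_eq_integral_Ioo, ← integral_indicator measurableSet_Ioo]
    congr 1
    ext v
    simp only [Set.indicator]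
    have : (u ^ 2 + v ^ 2 < 1 / 2 ∧ d ≤ u) ↔
        v ∈ Set.Ioo (-Real.sqrt (1 / 2 - u ^ 2)) (Real.sqrt (1 / 2 - u ^ 2)) := by
      rw [Set.mem_Ioo, ← abs_lt, Real.lt_sqrt (abs_nonneg _), sq_abs]
      constructor
      · intro h; linarith [h.1]
      · intro h; exact ⟨by linarith, hu.1⟩
    simp only [this]
  · rw [Set.indicator_of_notMem hu]
    have : ∀ v : ℝ, ¬ (u ^ 2 + v ^ 2 < 1 / 2 ∧ d ≤ u) := by
      intro v hv
      apply hu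
      refine ⟨hv.2, ?_⟩
      rw [← inv_sqrt_two_sq] at hv
      apply lt_of_pow_lt_pow_left₀ 2 (by positivity)
      nlinarith [sq_nonneg v]
    simp only [if_neg (this _), integral_zero]

/-- closed form of the extreme segment integral -/
lemma kk_integral (l D : ℝ) :
    ∫ u in (1 / Real.sqrt 3)..(1 / Real.sqrt 2), kk l D u
      = D * (phi / 2 - Real.sqrt 2 / 6)
        - l ^ 3 * (Real.pi / 3 - 2 * Real.sqrt 6 / 3 * phi) := by
  have hs2 : 0 < Real.sqrt 2 := by positivity
  have hs3 : 0 < Real.sqrt 3 := by positivity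
  have h22 := Real.sq_sqrt (show (0:ℝ) ≤ 2 by norm_num)
  have h33 := Real.sq_sqrt (show (0:ℝ) ≤ 3 by norm_num)
  have hle : 1 / Real.sqrt 3 ≤ 1 / Real.sqrt 2 := by
    apply one_div_le_one_div_of_le hs2
    exact Real.sqrt_le_sqrt (by norm_num)
  set f : ℝ → ℝ := fun u =>
    D * (u * Real.sqrt (1 / 2 - u ^ 2) + 1 / 2 * Real.arcsin (Real.sqrt 2 * u))
    - 2 * l ^ 3 * (Real.sqrt 2 / Real.sqrt 3) *
      (Real.sqrt 3 / Real.sqrt 2 * Real.arcsin (Real.sqrt 3 * (u * (Real.sqrt (1 + u ^ 2))⁻¹))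
        - Real.arcsin (Real.sqrt 2 * u)) with hf
  have key := intervalIntegral.integral_eq_sub_of_hasDerivAt_of_le (f := f) (f' := kk l D) hle
    ?_ ?_ ((kk_cont l D).intervalIntegrable _ _)
  · rw [key, hf]
    simp only
    rw [inv_sqrt_two_sq, inv_sqrt_three_sq]
    have a1 : Real.sqrt 2 * (1 / Real.sqrt 2) = 1 := by field_simp
    have a2 : Real.sqrt 2 * (1 / Real.sqrt 3) = Real.sqrt 2 / Real.sqrt 3 := by ring
    have a3 : Real.sqrt 3 * (1 / Real.sqrt 2 * (Real.sqrt (1 + 1 / 2))⁻¹) = 1 := by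
      rw [show (1 : ℝ) + 1 / 2 = 3 / 2 by norm_num, sqrt_three_half]; field_simp
    have a4 : Real.sqrt 3 * (1 / Real.sqrt 3 * (Real.sqrt (1 + 1 / 3))⁻¹) = Real.sqrt 3 / 2 := by
      rw [show (1 : ℝ) + 1 / 3 = 2 ^ 2 / 3 by norm_num, Real.sqrt_div (by norm_num),
        Real.sqrt_sq (by norm_num)]; field_simp
    have a5 : Real.arcsin (Real.sqrt 3 / 2) = Real.pi / 3 := by
      rw [← Real.sin_pi_div_three]
      apply Real.arcsin_sin <;> linarith [Real.pi_pos]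
    have a6 : Real.sqrt (1 / 2 - 1 / 3) = 1 / (Real.sqrt 2 * Real.sqrt 3) := by
      rw [show (1 / 2 - 1 / 3 : ℝ) = 1 / 6 by norm_num, Real.sqrt_div (by norm_num), sqrt_six,
        Real.sqrt_one]
    rw [a1, a2, a3, a4, a5, a6, arcsin_phi, Real.arcsin_one, sub_self, Real.sqrt_zero, sqrt_six]
    have a7 : 1 / Real.sqrt 3 * (1 / (Real.sqrt 2 * Real.sqrt 3)) = Real.sqrt 2 / 6 := by
      field_simp; rw [h22, h33]; norm_num
    have a8 : Real.sqrt 2 / Real.sqrt 3 = Real.sqrt 2 * Real.sqrt 3 / 3 := by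
      field_simp; rw [h33]
    have a9 : Real.sqrt 3 / Real.sqrt 2 = Real.sqrt 2 * Real.sqrt 3 / 2 := by
      field_simp; rw [h22]
    rw [a7, a8, a9]
    have a10 : Real.sqrt 2 * Real.sqrt 3 / 3 * (Real.sqrt 2 * Real.sqrt 3 / 2) = 1 := by
      ring_nf; rw [h22, h33]; norm_num
    linear_combination (- 2 * l ^ 3 * (Real.pi / 2 - Real.pi / 3)) * a10
  · apply Continuous.continuousOn
    have h : ∀ v : ℝ, Real.sqrt (1 + v ^ 2) ≠ 0 := fun y => by positivity
    rw [hf]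
    have c1 : Continuous (fun u : ℝ => Real.arcsin (Real.sqrt 2 * u)) :=
      Real.continuous_arcsin.comp (by fun_prop)
    have c2 : Continuous (fun u : ℝ =>
        Real.arcsin (Real.sqrt 3 * (u * (Real.sqrt (1 + u ^ 2))⁻¹))) :=
      Real.continuous_arcsin.comp (by fun_prop (disch := exact h _))
    fun_prop
  · intro u hu
    have hu0 : 0 < u := lt_trans (by positivity) hu.1
    have hu2 : u ^ 2 < 1 / 2 := by
      rw [← inv_sqrt_two_sq]
      exact pow_lt_pow_left₀ hu.2 hu0.le (by norm_num)
    have hp : 0 < 1 / 2 - u ^ 2 := by linarith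
    have hV : 0 < Real.sqrt (1 / 2 - u ^ 2) := Real.sqrt_pos.2 hp
    have hV2 := Real.sq_sqrt hp.le
    have hq : 0 < 1 + u ^ 2 := by positivity
    have hW : 0 < Real.sqrt (1 + u ^ 2) := Real.sqrt_pos.2 hq
    have hW2 := Real.sq_sqrt hq.le
    have d0 : HasDerivAt (fun v : ℝ => 1 / 2 - v ^ 2) (-(2 * u)) u := by
      exact ((hasDerivAt_pow 2 u).const_sub (1 / 2)).congr_deriv (by norm_num)
    have d1 : HasDerivAt (fun v : ℝ => 1 + v ^ 2) (2 * u) u := by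
      simpa using (hasDerivAt_pow 2 u).const_add 1
    have d2 := (hasDerivAt_id u).mul (d0.sqrt hp.ne')
    have b1 : Real.sqrt 2 * u < 1 := by
      have := hu.2
      rw [lt_div_iff₀ hs2] at this; linarith
    have b1' : 0 < Real.sqrt 2 * u := by positivity
    have d3 := (Real.hasDerivAt_arcsin (x := Real.sqrt 2 * u) (by linarith) b1.ne).comp u
      ((hasDerivAt_id u).const_mul (Real.sqrt 2))
    have d4 := (((hasDerivAt_id u).mul ((d1.sqrt hq.ne').fun_inv hW.ne'))).const_mul (Real.sqrt 3)
    have hx2 : (Real.sqrt 3 * (u * (Real.sqrt (1 + u ^ 2))⁻¹)) ^ 2 = 3 * u ^ 2 / (1 + u ^ 2) := by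
      rw [mul_pow, mul_pow, h33, inv_pow, hW2]; ring
    have hx0 : 0 < Real.sqrt 3 * (u * (Real.sqrt (1 + u ^ 2))⁻¹) := by positivity
    have hx1 : Real.sqrt 3 * (u * (Real.sqrt (1 + u ^ 2))⁻¹) < 1 := by
      have : (Real.sqrt 3 * (u * (Real.sqrt (1 + u ^ 2))⁻¹)) ^ 2 < 1 := by
        rw [hx2, div_lt_one hq]; linarith
      nlinarith
    have d5 := (Real.hasDerivAt_arcsin (x := Real.sqrt 3 * (u * (Real.sqrt (1 + u ^ 2))⁻¹))
      (by linarith) hx1.ne).comp u d4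
    have d6 := ((d2.add (d3.const_mul (1 / 2))).const_mul D).sub
      (((d5.const_mul (Real.sqrt 3 / Real.sqrt 2)).sub d3).const_mul
        (2 * l ^ 3 * (Real.sqrt 2 / Real.sqrt 3)))
    refine HasDerivAt.congr_deriv (f := f) d6 ?_
    have r1 : Real.sqrt (1 - (Real.sqrt 2 * u) ^ 2) = Real.sqrt 2 * Real.sqrt (1 / 2 - u ^ 2) := by
      rw [← Real.sqrt_mul (by norm_num), mul_pow, h22]; ring_nf
    have r2 : Real.sqrt (1 - (Real.sqrt 3 * (u * (Real.sqrt (1 + u ^ 2))⁻¹)) ^ 2)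
        = Real.sqrt 2 * Real.sqrt (1 / 2 - u ^ 2) / Real.sqrt (1 + u ^ 2) := by
      rw [hx2, ← Real.sqrt_mul (by norm_num), ← Real.sqrt_div (by linarith)]
      congr 1; field_simp; ring
    simp only [id]
    rw [r1, r2]
    unfold kk
    set V := Real.sqrt (1 / 2 - u ^ 2)
    set W := Real.sqrt (1 + u ^ 2)
    have hu2V : u ^ 2 = 1 / 2 - V ^ 2 := by rw [hV2]; ring
    have g1 : 1 * V + u * (-(2 * u) / (2 * V)) +
        1 / 2 * (1 / (Real.sqrt 2 * V) * (Real.sqrt 2 * 1)) = 2 * V := by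
      field_simp; rw [hu2V]; ring
    have g2 : Real.sqrt 3 / Real.sqrt 2 * (1 / (Real.sqrt 2 * V / W) *
          (Real.sqrt 3 * (1 * W⁻¹ + u * (-(2 * u / (2 * W)) / W ^ 2))))
        - 1 / (Real.sqrt 2 * V) * (Real.sqrt 2 * 1) = V / (1 + u ^ 2) := by
      rw [← hW2]
      field_simp
      rw [h22, h33, hV2, hW2]; ring
    have g3 := congrArg (fun t => D * t) g1
    have g4 := congrArg (fun t => 2 * l ^ 3 * (Real.sqrt 2 / Real.sqrt 3) * t) g2
    rw [g3, g4]
    ring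

end SoftBall

open scoped Pointwise

namespace SoftBall

/-- rotated circular segment -/
def rseg (e : ℂ) (d : ℝ) : Set ℂ :=
  {y | y ∈ ball (0 : ℂ) (1 / Real.sqrt 2) ∧ d ≤ (y * (starRingEnd ℂ) e).re}

lemma rseg_measurable (e : ℂ) (d : ℝ) : MeasurableSet (rseg e d) := by
  apply measurableSet_ball.inter
  have h : Measurable (fun y : ℂ => (y * (starRingEnd ℂ) e).re) := by fun_prop
  exact measurableSet_le measurable_const h

lemma rseg_integral (l D d : ℝ) (e : ℂ) (he : ‖e‖ = 1) :
    ∫ y in rseg e d, (D - gg l (1 + ‖y‖ ^ 2)) = ∫ y in seg d, (D - gg l (1 + ‖y‖ ^ 2)) := by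
  set a : Circle := ⟨(starRingEnd ℂ) e, by simp [Submonoid.unitSphere, he]⟩ with ha
  have hmp := (rotation a).measurePreserving
  have h := hmp.setIntegral_preimage_emb (rotation a).toHomeomorph.measurableEmbedding
    (fun y => (D - gg l (1 + ‖y‖ ^ 2))) (seg d)
  rw [← h]
  have hset : (rotation a) ⁻¹' seg d = rseg e d := by
    ext y
    have : (rotation a) y = y * (starRingEnd ℂ) e := by
      rw [rotation_apply, mul_comm]
    simp only [Set.mem_preimage, seg, rseg, Set.mem_ofPred_eq, mem_ball_zero_iff,
      this, norm_mul, RCLike.norm_conj, he, mul_one]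
  rw [hset]
  simp only [LinearIsometryEquiv.norm_map]

lemma disc_balance (l : ℝ) (h1 : 1 ≤ l) (h2 : l < 2 / Real.sqrt 3) :
    ∫ y in ball (0 : ℂ) (1 / Real.sqrt 2), (dens l - gg l (1 + ‖y‖ ^ 2))
      = 5 * ∫ u in (1 / Real.sqrt 3)..(1 / Real.sqrt 2), kk l (dens l) u := by
  have hl : 0 ≤ l := by linarith
  have hg := gg_integrableOn' l 1 0 hl (ball (0 : ℂ) (1 / Real.sqrt 2)) _ le_rfl
  have hg' : IntegrableOn (fun y : ℂ => gg l (1 + ‖y‖ ^ 2)) (ball (0 : ℂ) (1 / Real.sqrt 2)) := by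
    simpa using hg.neg
  rw [integral_sub (by exact integrableOn_const measure_ball_lt_top.ne) hg']
  rw [disc_integral l h1 h2, kk_integral]
  have hv : (volume : Measure ℂ).real (ball 0 (1 / Real.sqrt 2)) = Real.pi / 2 := by
    simp only [Measure.real, Complex.volume_ball, ENNReal.toReal_mul, ENNReal.toReal_pow]
    rw [ENNReal.toReal_ofReal (by positivity), inv_sqrt_two_sq]
    simp; ring
  rw [setIntegral_const, hv, smul_eq_mul]
  have hden := den_pos
  have hD : dens l * (3 * Real.pi - 15 * phi + 5 * Real.sqrt 2) =
    ((20 * Real.sqrt 6 * phi - 4 * Real.sqrt 6 * Real.pi - 10 * Real.pi) * l ^ 3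
    + 18 * Real.pi * l ^ 2 - 6 * Real.pi) := by
    unfold dens; rw [div_mul_cancel₀ _ hden.ne']
  have a8 : Real.sqrt 2 / Real.sqrt 3 = Real.sqrt 6 / 3 := by
    rw [sqrt_six, div_eq_div_iff (by positivity) (by norm_num), mul_assoc, sqrt_three_sq]
  rw [a8]
  linear_combination (1 / 6) * hD

/-- the planar inequality at height one -/
lemma planar_one {ι : Type*} (l : ℝ) (h1 : 1 ≤ l) (h2 : l < 2 / Real.sqrt 3)
    (Q : Finset ι) (hQ : Q.card ≤ 5) (e : ι → ℂ) (d : ι → ℝ) (he : ∀ i ∈ Q, ‖e i‖ = 1)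
    (hd : ∀ i ∈ Q, 1 / Real.sqrt 3 ≤ d i) (hd2 : ∀ i ∈ Q, d i ≤ 1 / Real.sqrt 2)
    (hdisj : ∀ i ∈ Q, ∀ j ∈ Q, i ≠ j → Disjoint (rseg (e i) (d i)) (rseg (e j) (d j))) :
    0 ≤ ∫ y in ball (0 : ℂ) (1 / Real.sqrt 2) \ ⋃ i ∈ Q, rseg (e i) (d i),
      (dens l - gg l (1 + ‖y‖ ^ 2)) := by
  have hl : 0 ≤ l := by linarith
  have hsub : (⋃ i ∈ Q, rseg (e i) (d i)) ⊆ ball (0 : ℂ) (1 / Real.sqrt 2) := by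
    intro y hy
    simp only [Set.mem_iUnion] at hy
    obtain ⟨i, _, hi⟩ := hy
    exact hi.1
  have hm : MeasurableSet (⋃ i ∈ Q, rseg (e i) (d i)) :=
    Finset.measurableSet_biUnion _ (fun i _ => rseg_measurable _ _)
  rw [setIntegral_sdiff hm (gg_integrableOn' l 1 _ hl _ _ le_rfl) hsub]
  rw [integral_biUnion_finset Q (fun i _ => rseg_measurable _ _)
    (fun i hi j hj hij => hdisj i hi j hj hij)
    (fun i _ => gg_integrableOn' l 1 _ hl _ _ (fun y hy => hy.1)), disc_balance l h1 h2]
  set Q0 := ∫ u in (1 / Real.sqrt 3)..(1 / Real.sqrt 2), kk l (dens l) u with hQ0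
  have hle : 1 / Real.sqrt 3 ≤ 1 / Real.sqrt 2 := by
    apply one_div_le_one_div_of_le (by positivity)
    exact Real.sqrt_le_sqrt (by norm_num)
  have hQ0n : 0 ≤ Q0 := by
    apply intervalIntegral.integral_nonneg hle
    intro u hu
    exact kk_nonneg l u h1 h2 hu.1
  have hb : ∀ i ∈ Q, ∫ y in rseg (e i) (d i), (dens l - gg l (1 + ‖y‖ ^ 2)) ≤ Q0 := by
    intro i hi
    rw [rseg_integral l _ _ _ (he i hi), seg_integral l _ _ h1 h2 (hd i hi) (hd2 i hi), hQ0]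
    rw [← intervalIntegral.integral_add_adjacent_intervals (a := 1 / Real.sqrt 3) (b := d i)
      ((kk_cont l _).intervalIntegrable _ _) ((kk_cont l _).intervalIntegrable _ _)]
    have : 0 ≤ ∫ u in (1 / Real.sqrt 3)..(d i), kk l (dens l) u := by
      apply intervalIntegral.integral_nonneg (hd i hi)
      intro u hu
      exact kk_nonneg l u h1 h2 hu.1
    linarith
  have hs := Finset.sum_le_card_nsmul Q _ Q0 hb
  rw [nsmul_eq_mul] at hs
  have : (Q.card : ℝ) ≤ 5 := by exact_mod_cast hQ
  nlinarith

/-- face region in the plane at height `h` -/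
def faceRegion {ι : Type*} (R : ℝ) (Q : Finset ι) (e : ι → ℂ) (d : ι → ℝ) : Set ℂ :=
  {y | y ∈ ball (0 : ℂ) R ∧ ∀ i ∈ Q, (y * (starRingEnd ℂ) (e i)).re < d i}

lemma planar_h {ι : Type*} (l : ℝ) (h1 : 1 ≤ l) (h2 : l < 2 / Real.sqrt 3)
    (t R : ℝ) (ht : 1 ≤ t) (hR : 0 < R) (hRt : R ^ 2 = 3 / 2 - t)
    (Q : Finset ι) (hQ : Q.card ≤ 5) (e : ι → ℂ) (d : ι → ℝ) (he : ∀ i ∈ Q, ‖e i‖ = 1)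
    (hd0 : ∀ i ∈ Q, 0 ≤ d i)
    (hd : ∀ i ∈ Q, 2 / 3 * R ^ 2 ≤ d i ^ 2) (hd2 : ∀ i ∈ Q, d i ≤ R)
    (hdisj : ∀ i ∈ Q, ∀ j ∈ Q, i ≠ j → ∀ y ∈ ball (0 : ℂ) R,
      d i ≤ (y * (starRingEnd ℂ) (e i)).re → d j ≤ (y * (starRingEnd ℂ) (e j)).re → False) :
    0 ≤ ∫ y in faceRegion R Q e d, (dens l - gg l (t + ‖y‖ ^ 2)) := by
  have hl : 0 ≤ l := by linarith
  set c := R * Real.sqrt 2 with hc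
  have hc0 : 0 < c := by positivity
  have hc2 : c ^ 2 = 3 - 2 * t := by
    rw [hc, mul_pow, Real.sq_sqrt (by norm_num), hRt]; ring
  set S' := ball (0 : ℂ) (1 / Real.sqrt 2) \ ⋃ i ∈ Q, rseg (e i) (d i / c) with hS'
  have hRc : R = c * (1 / Real.sqrt 2) := by rw [hc]; field_simp
  have hre : ∀ (y : ℂ) i, (((c : ℝ) • y) * (starRingEnd ℂ) (e i)).re
      = c * (y * (starRingEnd ℂ) (e i)).re := by
    intro y i
    rw [smul_mul_assoc, Complex.real_smul, Complex.re_ofReal_mul]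
  have hball : ∀ y : ℂ, c • y ∈ ball (0 : ℂ) R ↔ y ∈ ball (0 : ℂ) (1 / Real.sqrt 2) := by
    intro y
    rw [mem_ball_zero_iff, mem_ball_zero_iff, norm_smul, Real.norm_eq_abs, abs_of_pos hc0, hRc]
    exact mul_lt_mul_iff_right₀ hc0
  have hset : faceRegion R Q e d = c • S' := by
    ext z
    rw [Set.mem_smul_set_iff_inv_smul_mem₀ hc0.ne']
    set y := c⁻¹ • z with hy
    have hz : z = c • y := by rw [hy, smul_smul, mul_inv_cancel₀ hc0.ne', one_smul]
    rw [hz, hS']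
    simp only [faceRegion, Set.mem_ofPred_eq, hball, hre, Set.mem_sdiff, Set.mem_iUnion, rseg,
      not_exists]
    constructor
    · rintro ⟨a, b⟩
      refine ⟨a, fun i hi hh => ?_⟩
      have := hh.2
      rw [div_le_iff₀ hc0] at this
      linarith [b i hi]
    · rintro ⟨a, b⟩
      refine ⟨a, fun i hi => ?_⟩
      by_contra hcon
      push Not at hcon
      exact b i hi ⟨a, by rw [div_le_iff₀ hc0]; linarith⟩
  have hsc := Measure.setIntegral_comp_smul_of_pos (volume : Measure ℂ)
    (fun y : ℂ => dens l - gg l (t + ‖y‖ ^ 2)) S' hc0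
  rw [← hset, Complex.finrank_real_complex, smul_eq_mul] at hsc
  have hcc : 0 < (c ^ 2)⁻¹ := by positivity
  have hp := planar_one l h1 h2 Q hQ e (fun i => d i / c) he ?_ ?_ ?_
  · have hmono : ∫ y in S', (dens l - gg l (1 + ‖y‖ ^ 2))
        ≤ ∫ y in S', (dens l - gg l (t + ‖c • y‖ ^ 2)) := by
      have hn : ∀ y : ℂ, ‖c • y‖ ^ 2 = c ^ 2 * ‖y‖ ^ 2 := by
        intro y; rw [norm_smul, mul_pow, Real.norm_eq_abs, sq_abs]
      simp_rw [hn]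
      apply setIntegral_mono_on (gg_integrableOn' l 1 _ hl _ _ Set.sdiff_subset)
        (gg_integrableOn l t _ _ hl _ _ Set.sdiff_subset)
      · exact measurableSet_ball.diff
          (Finset.measurableSet_biUnion _ (fun i _ => rseg_measurable _ _))
      · intro y hy
        have hy1 := hy.1
        rw [mem_ball_zero_iff] at hy1
        have hy2 : ‖y‖ ^ 2 < 1 / 2 := by
          rw [← inv_sqrt_two_sq]; exact pow_lt_pow_left₀ hy1 (norm_nonneg _) (by norm_num)
        have : gg l (t + c ^ 2 * ‖y‖ ^ 2) ≤ gg l (1 + ‖y‖ ^ 2) := by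
          apply gg_anti l _ _ hl (by positivity)
          rw [hc2]; nlinarith
        linarith
    have h3 : 0 ≤ (c ^ 2)⁻¹ * ∫ y in faceRegion R Q e d, (dens l - gg l (t + ‖y‖ ^ 2)) := by
      rw [← hsc]; exact hp.trans hmono
    exact nonneg_of_mul_nonneg_right h3 hcc
  · intro i hi
    have a := hd i hi
    rw [← pow_le_pow_iff_left₀ (by positivity) (div_nonneg (hd0 i hi) hc0.le) two_ne_zero]
    rw [inv_sqrt_three_sq, div_pow, le_div_iff₀ (by positivity), hc2]
    linarith
  · intro i hi
    rw [div_le_iff₀ hc0]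
    linarith [hd2 i hi]
  · intro i hi j hj hij
    rw [Set.disjoint_left]
    intro y hyi hyj
    apply hdisj i hi j hj hij (c • y) ((hball y).2 hyi.1)
    · rw [hre]; have := hyi.2; rw [div_le_iff₀ hc0] at this; linarith
    · rw [hre]; have := hyj.2; rw [div_le_iff₀ hc0] at this; linarith

end SoftBall

open scoped Pointwise

namespace SoftBall

section Geometry
variable {V : Type*} [NormedAddCommGroup V] [InnerProductSpace ℝ V]

lemma edge_dist (x p q : V) (hxp : ‖x - p‖ = ‖x‖) (hxq : ‖x - q‖ ≤ ‖x‖)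
    (hq : 2 ≤ ‖q‖) (hpq : 2 ≤ ‖p - q‖) (hx : ‖x‖ ^ 2 < 3 / 2) :
    16 ≤ ‖x‖ ^ 2 * (16 - ‖p‖ ^ 2) := by
  set E := ‖x‖ ^ 2 with hE
  set c := q - x with hc
  have hcE : ‖c‖ ^ 2 ≤ E := by
    rw [hc, norm_sub_rev]; exact pow_le_pow_left₀ (norm_nonneg _) hxq 2
  have e1 : ‖x - p‖ ^ 2 = E := by rw [hxp]
  have e1' := norm_sub_sq_real x p
  have e2 : ‖q‖ ^ 2 = ‖c + x‖ ^ 2 := by rw [hc]; congr 2; abel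
  have e3 : ‖p - q‖ ^ 2 = ‖c + (x - p)‖ ^ 2 := by
    rw [norm_sub_rev, hc]; congr 2; abel
  have e2' := norm_add_sq_real c x
  have e3' := norm_add_sq_real c (x - p)
  have hq2 : 4 ≤ ‖q‖ ^ 2 := by nlinarith
  have hpq2 : 4 ≤ ‖p - q‖ ^ 2 := by nlinarith
  have e4 : ‖x + (x - p)‖ ^ 2 = 4 * E - ‖p‖ ^ 2 := by
    rw [norm_add_sq_real, e1, inner_sub_right, real_inner_self_eq_norm_sq]
    linarith
  have e5 : 4 - 2 * E ≤ inner ℝ c (x + (x - p)) := by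
    rw [inner_add_right]; linarith
  have e6 := real_inner_le_norm c (x + (x - p))
  have e7 : (4 - 2 * E) ^ 2 ≤ ‖c‖ ^ 2 * ‖x + (x - p)‖ ^ 2 := by
    rw [← mul_pow]
    apply pow_le_pow_left₀ (by linarith)
    exact e5.trans e6
  have e8 : ‖c‖ ^ 2 * ‖x + (x - p)‖ ^ 2 ≤ E * (4 * E - ‖p‖ ^ 2) := by
    rw [← e4]; gcongr
  nlinarith

lemma no_vertex (x p q s : V) (hxp : ‖x - p‖ ≤ ‖x‖) (hxq : ‖x - q‖ ≤ ‖x‖) (hxs : ‖x - s‖ ≤ ‖x‖)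
    (hp : 2 ≤ ‖p‖) (hq : 2 ≤ ‖q‖) (hs : 2 ≤ ‖s‖) (hpq : 2 ≤ ‖p - q‖) (hps : 2 ≤ ‖p - s‖)
    (hqs : 2 ≤ ‖q - s‖) (hx : ‖x‖ ^ 2 < 3 / 2) : False := by
  have sq4 : ∀ r : ℝ, 2 ≤ r → 4 ≤ r ^ 2 := fun r hr => by nlinarith
  have k1 := pow_le_pow_left₀ (norm_nonneg _) hxp 2
  have k2 := pow_le_pow_left₀ (norm_nonneg _) hxq 2
  have k3 := pow_le_pow_left₀ (norm_nonneg _) hxs 2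
  have h1 := sq4 _ hp
  have h2 := sq4 _ hq
  have h3 := sq4 _ hs
  have h4 := sq4 _ hpq
  have h5 := sq4 _ hps
  have h6 := sq4 _ hqs
  have n := sq_nonneg ‖x + (x - p) + (x - q) + (x - s)‖
  have e : ‖x + (x - p) + (x - q) + (x - s)‖ ^ 2
      = 4 * (‖x‖ ^ 2 + ‖x - p‖ ^ 2 + ‖x - q‖ ^ 2 + ‖x - s‖ ^ 2)
        - (‖p‖ ^ 2 + ‖q‖ ^ 2 + ‖s‖ ^ 2 + ‖p - q‖ ^ 2 + ‖p - s‖ ^ 2 + ‖q - s‖ ^ 2) := by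
    simp only [← real_inner_self_eq_norm_sq, inner_add_left, inner_add_right, inner_sub_left,
      inner_sub_right, real_inner_comm]
    ring
  linarith

end Geometry

/-- pure algebra behind the five-sides bound -/
lemma count_algebra (h t R X Z d X' Z' d' c : ℝ) (ht : h ^ 2 = t) (h0 : 0 < h) (ht1 : 1 ≤ t)
    (ht2 : t < 3 / 2)
    (hR0 : 0 < R) (hR : R ^ 2 = 3 / 2 - t) (hX : 0 < X) (hX' : 0 < X') (hd0 : 0 < d)
    (hd0' : 0 < d') (hd : d < R) (hd' : d' < R)
    (hc : X ^ 2 + Z ^ 2 = t + 2 * d * X) (hc' : X' ^ 2 + Z' ^ 2 = t + 2 * d' * X')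
    (a1 : 4 ≤ X ^ 2 + (Z + h) ^ 2) (a2 : 4 ≤ X ^ 2 + (Z - h) ^ 2)
    (a1' : 4 ≤ X' ^ 2 + (Z' + h) ^ 2) (a2' : 4 ≤ X' ^ 2 + (Z' - h) ^ 2)
    (b : 4 ≤ X ^ 2 + X' ^ 2 - 2 * X * X' * c + (Z - Z') ^ 2) : c < 1 / 2 := by
  by_contra hcon
  push Not at hcon
  set A := t + d * X - 2 with hA
  set A' := t + d' * X' - 2 with hA'
  have z1 : |h * Z| ≤ A := by rw [abs_le]; constructor <;> nlinarith
  have z2 : |h * Z'| ≤ A' := by rw [abs_le]; constructor <;> nlinarith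
  have hA0 : 0 ≤ A := (abs_nonneg _).trans z1
  have hA0' : 0 ≤ A' := (abs_nonneg _).trans z2
  have z3 : - (t * (Z * Z')) ≤ A * A' := by
    have : |h * Z| * |h * Z'| ≤ A * A' := mul_le_mul z1 z2 (abs_nonneg _) hA0
    rw [← abs_mul] at this
    have h2 := neg_abs_le (h * Z * (h * Z'))
    have h3 : h * Z * (h * Z') = t * (Z * Z') := by rw [← ht]; ring
    rw [h3] at h2 this
    linarith
  have hXX : 0 < X * X' := mul_pos hX hX'
  have b2 : 0 ≤ 2 * A + 2 * A' - 2 * t + 4 - X * X' - 2 * (Z * Z') := by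
    have m : X * X' * (1 / 2) ≤ X * X' * c := mul_le_mul_of_nonneg_left hcon hXX.le
    have e1 : X ^ 2 + X' ^ 2 - 2 * X * X' * c + (Z - Z') ^ 2
      = (X ^ 2 + Z ^ 2) + (X' ^ 2 + Z' ^ 2) - 2 * (X * X' * c) - 2 * (Z * Z') := by ring
    rw [e1, hc, hc'] at b
    linarith
  have b3 : t * (X * X') ≤ t * (2 * A + 2 * A' - 2 * t + 4) + 2 * (A * A') := by
    have m := mul_nonneg (show (0 : ℝ) ≤ t by linarith) b2
    have e1 : t * (2 * A + 2 * A' - 2 * t + 4 - X * X' - 2 * (Z * Z'))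
      = t * (2 * A + 2 * A' - 2 * t + 4) - t * (X * X') - 2 * (t * (Z * Z')) := by ring
    linarith
  have k1 : A + (2 - t) < R * X := by
    have : d * X < R * X := mul_lt_mul_of_pos_right hd hX
    linarith
  have k2 : A' + (2 - t) < R * X' := by
    have : d' * X' < R * X' := mul_lt_mul_of_pos_right hd' hX'
    linarith
  have k3 : (A + (2 - t)) * (A' + (2 - t)) < (3 / 2 - t) * (X * X') := by
    rw [← hR]
    calc _ < (R * X) * (R * X') := mul_lt_mul'' k1 k2 (by linarith) (by linarith)
      _ = _ := by ring
  -- combine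
  have k4 : t * ((A + (2 - t)) * (A' + (2 - t))) <
      (3 / 2 - t) * (t * (2 * A + 2 * A' - 2 * t + 4) + 2 * (A * A')) := by
    calc _ < t * ((3 / 2 - t) * (X * X')) := mul_lt_mul_of_pos_left k3 (by linarith)
      _ = (3 / 2 - t) * (t * (X * X')) := by ring
      _ ≤ _ := mul_le_mul_of_nonneg_left b3 (by linarith)
  have p1 : 0 ≤ A * A' * (t - 1) := mul_nonneg (mul_nonneg hA0 hA0') (by linarith)
  have p2 : 0 ≤ (A + A') * (t * (t - 1)) := by
    apply mul_nonneg (by linarith); apply mul_nonneg <;> linarith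
  have p3 : 0 ≤ t * (2 - t) * (t - 1) := by
    apply mul_nonneg; apply mul_nonneg
    all_goals linarith
  clear_value A A'
  have e2 : t * ((A + (2 - t)) * (A' + (2 - t))) -
      (3 / 2 - t) * (t * (2 * A + 2 * A' - 2 * t + 4) + 2 * (A * A'))
      = 3 * (A * A' * (t - 1)) + (A + A') * (t * (t - 1)) + t * (2 - t) * (t - 1) := by ring
  linarith

lemma exists_angle (z : ℂ) (hz : ‖z‖ = 1) (hre : z.re < 1 / 2) :
    ∃ θ : ℝ, Real.pi / 3 ≤ θ ∧ θ < 5 * Real.pi / 3 ∧ z.re = Real.cos θ ∧ z.im = Real.sin θ := by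
  have hpi := Real.pi_pos
  have hcos : z.re = Real.cos z.arg := by
    have := Complex.norm_mul_cos_arg z; rw [hz, one_mul] at this; exact this.symm
  have hsin : z.im = Real.sin z.arg := by
    have := Complex.norm_mul_sin_arg z; rw [hz, one_mul] at this; exact this.symm
  have h1 := Complex.neg_pi_lt_arg z
  have h2 := Complex.arg_le_pi z
  have h3 : Real.pi / 3 < |z.arg| := by
    by_contra hcon
    push Not at hcon
    have : Real.cos (Real.pi / 3) ≤ Real.cos |z.arg| :=
      Real.cos_le_cos_of_nonneg_of_le_pi (abs_nonneg _) (by linarith) hcon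
    rw [Real.cos_abs, Real.cos_pi_div_three, ← hcos] at this
    linarith
  rcases le_or_gt 0 z.arg with h | h
  · rw [abs_of_nonneg h] at h3
    exact ⟨z.arg, h3.le, by linarith, hcos, hsin⟩
  · rw [abs_of_neg h] at h3
    refine ⟨z.arg + 2 * Real.pi, by linarith, by linarith, ?_, ?_⟩
    · rw [Real.cos_add_two_pi, hcos]
    · rw [Real.sin_add_two_pi, hsin]

lemma card_le_five {ι : Type*} (Q : Finset ι) (e : ι → ℂ) (he : ∀ i ∈ Q, ‖e i‖ = 1)
    (hsep : ∀ i ∈ Q, ∀ j ∈ Q, i ≠ j → (e i * (starRingEnd ℂ) (e j)).re < 1 / 2) :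
    Q.card ≤ 5 := by
  classical
  by_contra hcon
  push Not at hcon
  have hpi := Real.pi_pos
  obtain ⟨i0, hi0⟩ : Q.Nonempty := Finset.card_pos.1 (by omega)
  set Q' := Q.erase i0 with hQ'
  have hcard : 5 ≤ Q'.card := by rw [hQ', Finset.card_erase_of_mem hi0]; omega
  have hang : ∀ i, ∃ θ : ℝ, i ∈ Q' → (Real.pi / 3 ≤ θ ∧ θ < 5 * Real.pi / 3 ∧
      (e i * (starRingEnd ℂ) (e i0)).re = Real.cos θ ∧
      (e i * (starRingEnd ℂ) (e i0)).im = Real.sin θ) := by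
    intro i
    by_cases hi : i ∈ Q'
    · have hi' := Finset.mem_erase.1 hi
      obtain ⟨θ, hθ⟩ := exists_angle (e i * (starRingEnd ℂ) (e i0))
        (by rw [norm_mul, RCLike.norm_conj, he i hi'.2, he i0 hi0, one_mul])
        (hsep i hi'.2 i0 hi0 hi'.1)
      exact ⟨θ, fun _ => hθ⟩
    · exact ⟨0, fun h => absurd h hi⟩
  choose θ hθ using hang
  have hmaps : ∀ i ∈ Q', ⌊(θ i - Real.pi / 3) / (Real.pi / 3)⌋ ∈ Finset.Ico (0 : ℤ) 4 := by
    intro i hi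
    obtain ⟨a, b, _⟩ := hθ i hi
    rw [Finset.mem_Ico]
    constructor
    · rw [Int.le_floor]; push_cast; apply div_nonneg <;> linarith
    · rw [Int.floor_lt]; push_cast; rw [div_lt_iff₀ (by linarith)]; linarith
  obtain ⟨i, hi, j, hj, hij, hfl⟩ := Finset.exists_ne_map_eq_of_card_lt_of_maps_to
    (by rw [Int.card_Ico]; simp; omega) hmaps
  have habs := Int.abs_sub_lt_one_of_floor_eq_floor hfl
  rw [← sub_div, abs_div, abs_of_pos (show 0 < Real.pi / 3 by linarith),
    div_lt_one (by linarith)] at habs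
  have hdiff : |θ i - θ j| < Real.pi / 3 := by
    rw [show θ i - θ j = (θ i - Real.pi / 3) - (θ j - Real.pi / 3) by ring]; exact habs
  have hcos : 1 / 2 ≤ Real.cos (θ i - θ j) := by
    rw [← Real.cos_abs, ← Real.cos_pi_div_three]
    exact Real.cos_le_cos_of_nonneg_of_le_pi (abs_nonneg _) (by linarith) hdiff.le
  have hi' := Finset.mem_erase.1 hi
  have hj' := Finset.mem_erase.1 hj
  obtain ⟨_, _, ci, si⟩ := hθ i hi
  obtain ⟨_, _, cj, sj⟩ := hθ j hj
  have hn0 : (e i0).re * (e i0).re + (e i0).im * (e i0).im = 1 := by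
    rw [← Complex.normSq_apply, Complex.normSq_eq_norm_sq, he i0 hi0]; norm_num
  have hlt := hsep i hi'.2 j hj'.2 hij
  rw [Real.cos_sub, ← ci, ← cj, ← si, ← sj] at hcos
  simp only [Complex.mul_re, Complex.mul_im, Complex.conj_re, Complex.conj_im] at hcos hlt
  have : ((e i).re * (e i0).re - (e i).im * -(e i0).im) * ((e j).re * (e i0).re - (e j).im * -(e i0).im)
      + ((e i).re * -(e i0).im + (e i).im * (e i0).re) * ((e j).re * -(e i0).im + (e j).im * (e i0).re)
      = ((e i).re * (e j).re - (e i).im * -(e j).im)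
        * ((e i0).re * (e i0).re + (e i0).im * (e i0).im) := by ring
  rw [this, hn0, mul_one] at hcos
  linarith

end SoftBall

open scoped Pointwise

namespace SoftBall

def cone (h : ℝ) (S : Set ℂ) : Set (ℝ × ℂ) := {p | 0 < p.1 ∧ p.1 ≤ h ∧ (h / p.1 : ℝ) • p.2 ∈ S}

lemma cone_measurable (h : ℝ) (S : Set ℂ) (hS : MeasurableSet S) : MeasurableSet (cone h S) := by
  have h1 : MeasurableSet {p : ℝ × ℂ | 0 < p.1} := measurableSet_lt measurable_const measurable_fst
  have h2 : MeasurableSet {p : ℝ × ℂ | p.1 ≤ h} := measurableSet_le measurable_fst measurable_const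
  have h3 : MeasurableSet {p : ℝ × ℂ | (h / p.1 : ℝ) • p.2 ∈ S} := by
    have : Measurable fun p : ℝ × ℂ => (h / p.1 : ℝ) • p.2 := by fun_prop
    exact this hS
  exact h1.inter (h2.inter h3)

lemma cone_radial_integral (h a : ℝ) (hh : 0 < h) (ha : 0 ≤ a) (hah : a ≤ h) :
    ∫⁻ z in Set.Ioc 0 a, ENNReal.ofReal ((z / h) ^ 2) = ENNReal.ofReal (h / 3 * (a / h) ^ 3) := by
  rw [← ofReal_integral_eq_lintegral_ofReal]
  · congr 1
    rw [← intervalIntegral.integral_of_le ha]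
    simp only [div_pow]
    rw [intervalIntegral.integral_div, integral_pow]
    field_simp
    norm_num
    ring
  · apply Continuous.integrableOn_Ioc
    fun_prop
  · filter_upwards with z; positivity

lemma slice_eq (l h z : ℝ) (hz : 0 < z) (hzh : z ≤ h) (S : Set ℂ) :
    (Prod.mk z ⁻¹' (cone h S ∩ {p : ℝ × ℂ | p.1 ^ 2 + ‖p.2‖ ^ 2 ≤ l ^ 2}))
      = (z / h) • {y | y ∈ S ∧ z ^ 2 * (h ^ 2 + ‖y‖ ^ 2) ≤ l ^ 2 * h ^ 2} := by
  have hh : 0 < h := hz.trans_le hzh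
  have hzh0 : z / h ≠ 0 := (div_pos hz hh).ne'
  ext w
  rw [Set.mem_smul_set_iff_inv_smul_mem₀ hzh0, inv_div]
  simp only [cone, Set.mem_preimage, Set.mem_inter_iff, Set.mem_ofPred_eq]
  have e : z ^ 2 * (h ^ 2 + ‖(h / z) • w‖ ^ 2) = (z ^ 2 + ‖w‖ ^ 2) * h ^ 2 := by
    rw [norm_smul, Real.norm_eq_abs, abs_of_pos (div_pos hh hz)]
    field_simp
  rw [e, mul_le_mul_iff_left₀ (by positivity)]
  tauto

lemma cone_volume (l h : ℝ) (hl : 0 < l) (hh : 0 < h) (S : Set ℂ) (hS : MeasurableSet S) :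
    volume (cone h S ∩ {p : ℝ × ℂ | p.1 ^ 2 + ‖p.2‖ ^ 2 ≤ l ^ 2})
      = ENNReal.ofReal (h / 3) * ∫⁻ y in S, ENNReal.ofReal (gg l (h ^ 2 + ‖y‖ ^ 2)) := by
  have hm : MeasurableSet (cone h S ∩ {p : ℝ × ℂ | p.1 ^ 2 + ‖p.2‖ ^ 2 ≤ l ^ 2}) := by
    apply (cone_measurable h S hS).inter
    apply measurableSet_le <;> fun_prop
  rw [Measure.volume_eq_prod, Measure.prod_apply hm]
  have hTm : MeasurableSet {p : ℝ × ℂ | (0 < p.1 ∧ p.1 ≤ h) ∧ p.2 ∈ S ∧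
      p.1 ^ 2 * (h ^ 2 + ‖p.2‖ ^ 2) ≤ l ^ 2 * h ^ 2} := by
    refine MeasurableSet.inter (MeasurableSet.inter ?_ ?_) (MeasurableSet.inter ?_ ?_)
    · exact measurableSet_lt measurable_const measurable_fst
    · exact measurableSet_le measurable_fst measurable_const
    · exact measurable_snd hS
    · exact measurableSet_le (f := fun p : ℝ × ℂ => p.1 ^ 2 * (h ^ 2 + ‖p.2‖ ^ 2)) (by fun_prop) measurable_const
  set T := {p : ℝ × ℂ | (0 < p.1 ∧ p.1 ≤ h) ∧ p.2 ∈ S ∧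
      p.1 ^ 2 * (h ^ 2 + ‖p.2‖ ^ 2) ≤ l ^ 2 * h ^ 2} with hT
  set F : ℝ → ℂ → ENNReal := fun z y => T.indicator (fun p => ENNReal.ofReal ((p.1 / h) ^ 2)) (z, y)
    with hF
  have hFm : Measurable (Function.uncurry F) := by
    have : Function.uncurry F = T.indicator (fun p => ENNReal.ofReal ((p.1 / h) ^ 2)) := by
      ext ⟨z, y⟩; rfl
    rw [this]
    exact Measurable.indicator (by fun_prop) hTm
  have hslice : ∀ z : ℝ, volume (Prod.mk z ⁻¹' (cone h S ∩ {p : ℝ × ℂ | p.1 ^ 2 + ‖p.2‖ ^ 2 ≤ l ^ 2}))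
      = ∫⁻ y, F z y := by
    intro z
    by_cases hz : 0 < z ∧ z ≤ h
    · rw [slice_eq l h z hz.1 hz.2, Measure.addHaar_smul, Complex.finrank_real_complex,
        abs_of_nonneg (by positivity)]
      have hY : MeasurableSet {y | y ∈ S ∧ z ^ 2 * (h ^ 2 + ‖y‖ ^ 2) ≤ l ^ 2 * h ^ 2} := by
        apply hS.inter
        exact measurableSet_le (f := fun y : ℂ => z ^ 2 * (h ^ 2 + ‖y‖ ^ 2)) (by fun_prop) measurable_const
      rw [← setLIntegral_const, ← lintegral_indicator hY]
      congr 1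
      ext y
      have hmem : (z, y) ∈ T ↔ y ∈ S ∧ z ^ 2 * (h ^ 2 + ‖y‖ ^ 2) ≤ l ^ 2 * h ^ 2 := by
        simp only [hT, Set.mem_ofPred_eq, hz, true_and, and_self]
      simp only [hF]
      by_cases hy : y ∈ {y | y ∈ S ∧ z ^ 2 * (h ^ 2 + ‖y‖ ^ 2) ≤ l ^ 2 * h ^ 2}
      · rw [Set.indicator_of_mem (hmem.2 hy), Set.indicator_of_mem hy]
      · rw [Set.indicator_of_notMem (fun h => hy (hmem.1 h)), Set.indicator_of_notMem hy]
    · have h1 : (Prod.mk z ⁻¹' (cone h S ∩ {p : ℝ × ℂ | p.1 ^ 2 + ‖p.2‖ ^ 2 ≤ l ^ 2})) = ∅ := by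
        ext w
        simp only [cone, Set.mem_preimage, Set.mem_inter_iff, Set.mem_ofPred_eq, Set.mem_empty_iff_false, iff_false]
        tauto
      rw [h1, measure_empty]
      symm
      rw [lintegral_eq_zero_iff (by exact hFm.of_uncurry_left)]
      filter_upwards with y
      simp only [hF, Pi.zero_apply]
      rw [Set.indicator_of_notMem]
      simp only [hT, Set.mem_ofPred_eq]
      tauto
  simp_rw [hslice]
  rw [lintegral_lintegral_swap hFm.aemeasurable, ← lintegral_const_mul']
  swap
  · exact ENNReal.ofReal_ne_top
  rw [← lintegral_indicator hS]
  congr 1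
  ext y
  by_cases hy : y ∈ S
  · rw [Set.indicator_of_mem hy]
    have hs : 0 < h ^ 2 + ‖y‖ ^ 2 := by positivity
    set s := h ^ 2 + ‖y‖ ^ 2 with hsdef
    have hsq : 0 < Real.sqrt s := Real.sqrt_pos.2 hs
    set a := h * min 1 (l / Real.sqrt s) with ha
    have ha0 : 0 ≤ a := by positivity
    have hah : a ≤ h := by
      calc a ≤ h * 1 := mul_le_mul_of_nonneg_left (min_le_left _ _) hh.le
        _ = h := mul_one _
    have e1 : ∀ z, F z y = (Set.Ioc 0 a).indicator (fun z => ENNReal.ofReal ((z / h) ^ 2)) z := by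
      intro z
      simp only [hF]
      have : (z, y) ∈ T ↔ z ∈ Set.Ioc 0 a := by
        simp only [hT, Set.mem_ofPred_eq, Set.mem_Ioc, hy, true_and, ← hsdef]
        rw [ha, mul_min_of_nonneg _ _ hh.le, le_min_iff, mul_one, and_assoc]
        apply and_congr_right; intro hz
        apply and_congr_right; intro hzh
        rw [mul_div_assoc', le_div_iff₀ hsq, ← sq_le_sq₀ (a := z * Real.sqrt s) (by positivity) (by positivity), mul_pow, mul_pow,
          Real.sq_sqrt hs.le, mul_comm (l ^ 2)]
      by_cases hz : z ∈ Set.Ioc 0 a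
      · rw [Set.indicator_of_mem hz, Set.indicator_of_mem (this.2 hz)]
      · rw [Set.indicator_of_notMem hz, Set.indicator_of_notMem (fun h => hz (this.1 h))]
    simp_rw [e1]
    rw [lintegral_indicator measurableSet_Ioc, cone_radial_integral h a hh ha0 hah,
      ENNReal.ofReal_mul (by positivity)]
    congr 2
    rw [ha, mul_div_cancel_left₀ _ hh.ne']
    rfl
  · rw [Set.indicator_of_notMem hy]
    have e1 : ∀ z, F z y = 0 := by
      intro z
      simp only [hF]
      rw [Set.indicator_of_notMem]
      simp only [hT, Set.mem_ofPred_eq]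
      tauto
    simp [e1]

/-- Conclusion for cones over planar regions. -/
lemma cone_bound (l h r : ℝ) (h1 : 1 ≤ l) (h2 : l < 2 / Real.sqrt 3) (hh : 0 < h) (hr : 0 < r)
    (S : Set ℂ) (hS : MeasurableSet S)
    (hSr : ∀ y ∈ S, h ^ 2 + ‖y‖ ^ 2 ≤ r ^ 2) 
    (hintg : 0 ≤ ∫ y in S, (dens l - gg l (h ^ 2 + ‖y‖ ^ 2))) :
    volume (cone h S ∩ {p : ℝ × ℂ | p.1 ^ 2 + ‖p.2‖ ^ 2 ≤ l ^ 2})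
      ≤ ENNReal.ofReal (dens l) * volume (cone h S ∩ {p : ℝ × ℂ | p.1 ^ 2 + ‖p.2‖ ^ 2 ≤ r ^ 2}) := by
  have hl : 0 < l := by linarith
  rw [cone_volume l h hl hh S hS, cone_volume r h hr hh S hS, mul_left_comm]
  gcongr
  have hSb : S ⊆ ball 0 (r + 1) := by
    intro y hy
    have := hSr y hy
    rw [mem_ball_zero_iff]
    nlinarith [norm_nonneg y]
  have hfin : volume S < ⊤ := (measure_mono hSb).trans_lt measure_ball_lt_top
  have hd0 : 0 ≤ dens l := le_trans (by positivity) (dens_lower l h1 h2)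
  have e1 : ∫⁻ y in S, ENNReal.ofReal (gg r (h ^ 2 + ‖y‖ ^ 2)) = volume S := by
    rw [← setLIntegral_one]
    apply setLIntegral_congr_fun hS
    intro y hy
    have h3 : gg r (h ^ 2 + ‖y‖ ^ 2) = 1 := by
      unfold gg
      rw [min_eq_left, one_pow]
      rw [le_div_iff₀ (Real.sqrt_pos.2 (by positivity)), one_mul]
      exact Real.sqrt_le_iff.2 ⟨hr.le, hSr y hy⟩
    simp [h3]
  rw [e1]
  have hgi : IntegrableOn (fun y : ℂ => gg l (h ^ 2 + ‖y‖ ^ 2)) S := by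
    refine Measure.integrableOn_of_bounded (M := 1) hfin.ne ?_ ?_
    · have := gg_measurable l
      exact Measurable.aestronglyMeasurable (by fun_prop)
    · filter_upwards with y
      rw [Real.norm_eq_abs, abs_of_nonneg]
      · apply gg_le_one <;> positivity
      · apply gg_nonneg <;> positivity
  rw [← ofReal_integral_eq_lintegral_ofReal hgi]
  · rw [integral_sub (integrableOn_const (C := dens l) hfin.ne) hgi, setIntegral_const, smul_eq_mul] at hintg
    rw [← ENNReal.ofReal_toReal hfin.ne, ← ENNReal.ofReal_mul hd0]
    apply ENNReal.ofReal_le_ofReal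
    rw [Measure.real] at hintg
    linarith
  · filter_upwards with y
    apply gg_nonneg <;> positivity

end SoftBall

open scoped Pointwise

namespace SoftBall

abbrev V3 := WithLp 2 (ℝ × ℂ)

lemma v3_norm_sq (x : V3) : ‖x‖ ^ 2 = x.fst ^ 2 + ‖x.snd‖ ^ 2 := by
  rw [WithLp.prod_norm_sq_eq_of_L2, Real.norm_eq_abs, sq_abs]

lemma norm_le_iff_sq (a b : V3) : ‖a‖ ≤ ‖b‖ ↔ ‖a‖ ^ 2 ≤ ‖b‖ ^ 2 :=
  (sq_le_sq₀ (norm_nonneg _) (norm_nonneg _)).symm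

lemma complex_norm_sub_sq (y w : ℂ) :
    ‖y - w‖ ^ 2 = ‖y‖ ^ 2 - 2 * (y * (starRingEnd ℂ) w).re + ‖w‖ ^ 2 := by
  rw [norm_sub_sq_real, Complex.inner]
  have : (w * (starRingEnd ℂ) y).re = (y * (starRingEnd ℂ) w).re := by
    simp only [Complex.mul_re, Complex.conj_re, Complex.conj_im]; ring
  rw [this]

lemma half_plane_iff (h : ℝ) (y : ℂ) (q : V3) :
    ‖(WithLp.toLp 2 (h, y) : V3) - q‖ ≤ ‖(WithLp.toLp 2 (h, y) : V3)‖ ↔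
      ‖q‖ ^ 2 / 2 - h * q.fst ≤ (y * (starRingEnd ℂ) q.snd).re := by
  rw [norm_le_iff_sq, v3_norm_sq, v3_norm_sq, v3_norm_sq]
  simp only [WithLp.sub_fst, WithLp.sub_snd, WithLp.toLp_fst, WithLp.toLp_snd]
  rw [complex_norm_sub_sq]
  constructor <;> intro H <;> nlinarith

lemma face_integral (l h r : ℝ) (h1 : 1 ≤ l) (h2 : l < 2 / Real.sqrt 3) (h0 : 1 ≤ h) (hr : 0 < r)
    (hr2 : r ^ 2 = 3 / 2)
    (P : Finset V3) (p : V3) (hp : p = WithLp.toLp 2 (2 * h, 0)) (hpP : p ∈ P)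
    (hP : ∀ q ∈ P, 2 ≤ ‖q‖) (hPP : ∀ q ∈ P, ∀ s ∈ P, q ≠ s → 2 ≤ ‖q - s‖)
    (S : Set ℂ) (hS : S = {y | h ^ 2 + ‖y‖ ^ 2 < r ^ 2 ∧ ∀ q ∈ P, q ≠ p →
      ‖(WithLp.toLp 2 (h, y) : V3)‖ < ‖(WithLp.toLp 2 (h, y) : V3) - q‖}) :
    0 ≤ ∫ y in S, (dens l - gg l (h ^ 2 + ‖y‖ ^ 2)) := by
  classical
  rcases le_or_gt r h with hrh | hrh
  · have : S = ∅ := by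
      rw [hS]; ext y
      simp only [Set.mem_ofPred_eq, Set.mem_empty_iff_false, iff_false]
      intro H
      nlinarith [H.1, sq_nonneg ‖y‖]
    rw [this]; simp
  set t := h ^ 2 with ht
  have ht1 : 1 ≤ t := by nlinarith
  have ht2 : t < 3 / 2 := by nlinarith
  set R := Real.sqrt (3 / 2 - t) with hRdef
  have hR : 0 < R := Real.sqrt_pos.2 (by linarith)
  have hRt : R ^ 2 = 3 / 2 - t := Real.sq_sqrt (by linarith)
  have hxn : ∀ y : ℂ, ‖(WithLp.toLp 2 (h, y) : V3)‖ ^ 2 = t + ‖y‖ ^ 2 := fun y => by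
    rw [v3_norm_sq]; rfl
  have hpn : ‖p‖ ^ 2 = 4 * t := by rw [hp, v3_norm_sq]; simp; rw [ht]; ring
  have hxp : ∀ y : ℂ, ‖(WithLp.toLp 2 (h, y) : V3) - p‖ = ‖(WithLp.toLp 2 (h, y) : V3)‖ := by
    intro y
    rw [← sq_eq_sq₀ (norm_nonneg _) (norm_nonneg _), hp, v3_norm_sq, v3_norm_sq]
    simp only [WithLp.sub_fst, WithLp.sub_snd, WithLp.toLp_fst, WithLp.toLp_snd, sub_zero]
    ring
  have hball : ∀ y : ℂ, ‖y‖ < R ↔ t + ‖y‖ ^ 2 < 3 / 2 := by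
    intro y
    rw [← sq_lt_sq₀ (norm_nonneg _) hR.le, hRt, lt_sub_iff_add_lt']
  have key : ∀ q ∈ P, q ≠ p → ∀ y : ℂ, ‖y‖ < R →
      ‖q‖ ^ 2 / 2 - h * q.fst ≤ (y * (starRingEnd ℂ) q.snd).re → 2 / 3 * R ^ 2 ≤ ‖y‖ ^ 2 := by
    intro q hq hqp y hy hyq
    have := edge_dist (WithLp.toLp 2 (h, y) : V3) p q (hxp y) ((half_plane_iff h y q).2 hyq)
      (hP q hq) (hPP p hpP q hq hqp.symm) (by rw [hxn]; exact (hball y).1 hy)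
    rw [hxn, hpn] at this
    rw [hRt]
    nlinarith
  set Q := P.filter (fun q => q ≠ p ∧ ∃ y : ℂ, ‖y‖ < R ∧
    ‖q‖ ^ 2 / 2 - h * q.fst ≤ (y * (starRingEnd ℂ) q.snd).re) with hQ
  have hR23 : 0 < 2 / 3 * R ^ 2 := by positivity
  have hQP : ∀ q ∈ Q, q ∈ P ∧ q ≠ p ∧ ∃ y : ℂ, ‖y‖ < R ∧
    ‖q‖ ^ 2 / 2 - h * q.fst ≤ (y * (starRingEnd ℂ) q.snd).re := fun q hq => by
    rw [hQ, Finset.mem_filter] at hq; exact hq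
  have hw : ∀ q ∈ Q, 0 < ‖q.snd‖ := by
    intro q hq
    obtain ⟨hqP, hqp, y, hy, hyq⟩ := hQP q hq
    rw [norm_pos_iff]
    intro hw0
    have := key q hqP hqp 0 (by simpa using hR) (by rw [hw0] at hyq ⊢; simpa using hyq)
    simp at this
    nlinarith
  set e : V3 → ℂ := fun q => ((‖q.snd‖⁻¹ : ℝ) : ℂ) * q.snd with he
  set d : V3 → ℝ := fun q => (‖q‖ ^ 2 / 2 - h * q.fst) / ‖q.snd‖ with hd
  have hre : ∀ (q : V3) (y : ℂ), (y * (starRingEnd ℂ) (e q)).re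
      = (y * (starRingEnd ℂ) q.snd).re / ‖q.snd‖ := by
    intro q y
    simp only [he, map_mul, Complex.conj_ofReal]
    rw [mul_left_comm, Complex.re_ofReal_mul]
    field_simp
  have he1 : ∀ q ∈ Q, ‖e q‖ = 1 := by
    intro q hq
    have := hw q hq
    simp only [he, norm_mul, Complex.norm_real, norm_inv, norm_norm]
    field_simp
  have hiff : ∀ q ∈ Q, ∀ y : ℂ, d q ≤ (y * (starRingEnd ℂ) (e q)).re ↔
      ‖q‖ ^ 2 / 2 - h * q.fst ≤ (y * (starRingEnd ℂ) q.snd).re := by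
    intro q hq y
    rw [hre]
    exact div_le_div_iff_of_pos_right (hw q hq)
  have hd0 : ∀ q ∈ Q, 0 < d q := by
    intro q hq
    obtain ⟨hqP, hqp, -⟩ := hQP q hq
    by_contra hcon
    push Not at hcon
    have := key q hqP hqp 0 (by simpa using hR) ((hiff q hq 0).1 (by simpa using hcon))
    simp at this
    nlinarith
  have hdR : ∀ q ∈ Q, d q < R := by
    intro q hq
    obtain ⟨hqP, hqp, y, hy, hyq⟩ := hQP q hq
    have h3 := (hiff q hq y).2 hyq
    have h4 : (y * (starRingEnd ℂ) (e q)).re ≤ ‖y‖ := by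
      calc _ ≤ ‖y * (starRingEnd ℂ) (e q)‖ := Complex.re_le_norm _
        _ = ‖y‖ := by rw [norm_mul, RCLike.norm_conj, he1 q hq, mul_one]
    linarith
  have hdd : ∀ q ∈ Q, 2 / 3 * R ^ 2 ≤ d q ^ 2 := by
    intro q hq
    obtain ⟨hqP, hqp, -⟩ := hQP q hq
    have hn : ‖(d q : ℂ) * e q‖ = d q := by
      rw [norm_mul, he1 q hq, mul_one, Complex.norm_real, Real.norm_eq_abs, abs_of_pos (hd0 q hq)]
    have := key q hqP hqp ((d q : ℂ) * e q) (by rw [hn]; exact hdR q hq) ((hiff q hq _).1 ?_)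
    · rwa [hn] at this
    · rw [mul_assoc, Complex.mul_conj, Complex.normSq_eq_norm_sq, he1 q hq]
      simp
  have hcard : Q.card ≤ 5 := by
    apply card_le_five Q e he1
    intro q hq s hs hqs
    obtain ⟨hqP, hqp, -⟩ := hQP q hq
    obtain ⟨hsP, hsp, -⟩ := hQP s hs
    have hwq := hw q hq
    have hws := hw s hs
    have sq4 : ∀ x : V3, 2 ≤ ‖x‖ → 4 ≤ x.fst ^ 2 + ‖x.snd‖ ^ 2 := fun x hx => by
      rw [← v3_norm_sq]; nlinarith
    have dq : 2 * d q * ‖q.snd‖ = q.fst ^ 2 + ‖q.snd‖ ^ 2 - 2 * h * q.fst := by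
      simp only [hd]; rw [v3_norm_sq]; field_simp
    have ds : 2 * d s * ‖s.snd‖ = s.fst ^ 2 + ‖s.snd‖ ^ 2 - 2 * h * s.fst := by
      simp only [hd]; rw [v3_norm_sq]; field_simp
    have a2q := sq4 _ (hPP q hqP p hpP hqp)
    have a2s := sq4 _ (hPP s hsP p hpP hsp)
    have b := sq4 _ (hPP q hqP s hsP hqs)
    rw [hp] at a2q a2s
    simp only [WithLp.sub_fst, WithLp.sub_snd, WithLp.toLp_fst, WithLp.toLp_snd, sub_zero] at a2q a2s b
    rw [complex_norm_sub_sq] at b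
    have a1q := sq4 _ (hP q hqP)
    have a1s := sq4 _ (hP s hsP)
    apply count_algebra h t R ‖q.snd‖ (q.fst - h) (d q) ‖s.snd‖ (s.fst - h) (d s) _ ht.symm
      (by linarith) ht1 ht2 hR hRt hwq hws (hd0 q hq) (hd0 s hs) (hdR q hq) (hdR s hs)
    · rw [dq, ht]; ring
    · rw [ds, ht]; ring
    · linarith [show ‖q.snd‖ ^ 2 + (q.fst - h + h) ^ 2 = q.fst ^ 2 + ‖q.snd‖ ^ 2 by ring]
    · linarith [show ‖q.snd‖ ^ 2 + (q.fst - h - h) ^ 2 = (q.fst - 2 * h) ^ 2 + ‖q.snd‖ ^ 2 by ring]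
    · linarith [show ‖s.snd‖ ^ 2 + (s.fst - h + h) ^ 2 = s.fst ^ 2 + ‖s.snd‖ ^ 2 by ring]
    · linarith [show ‖s.snd‖ ^ 2 + (s.fst - h - h) ^ 2 = (s.fst - 2 * h) ^ 2 + ‖s.snd‖ ^ 2 by ring]
    · have hcc : (q.snd * (starRingEnd ℂ) s.snd).re =
          ‖q.snd‖ * ‖s.snd‖ * (e q * (starRingEnd ℂ) (e s)).re := by
        rw [hre]
        have : (e q * (starRingEnd ℂ) s.snd).re = (q.snd * (starRingEnd ℂ) s.snd).re / ‖q.snd‖ := by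
          simp only [he]
          rw [mul_assoc, Complex.re_ofReal_mul]; field_simp
        rw [this]
        field_simp
      rw [hcc] at b
      linarith [show (q.fst - h - (s.fst - h)) ^ 2 = (q.fst - s.fst) ^ 2 by ring]
  have hSeq : S = faceRegion R Q e d := by
    rw [hS]
    ext y
    simp only [faceRegion, Set.mem_ofPred_eq, mem_ball_zero_iff]
    rw [hball, hr2]
    apply and_congr_right
    intro hy
    constructor
    · intro H q hq
      obtain ⟨hqP, hqp, -⟩ := hQP q hq
      have := H q hqP hqp
      by_contra hcon
      push Not at hcon
      exact absurd ((half_plane_iff h y q).2 ((hiff q hq y).1 hcon)) (not_le.2 this)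
    · intro H q hqP hqp
      by_contra hcon
      push Not at hcon
      have h3 := (half_plane_iff h y q).1 hcon
      have hq : q ∈ Q := by
        rw [hQ, Finset.mem_filter]
        exact ⟨hqP, hqp, y, (hball y).2 hy, h3⟩
      exact absurd ((hiff q hq y).2 h3) (not_le.2 (H q hq))
  rw [hSeq]
  apply planar_h l h1 h2 t R ht1 hR hRt Q hcard e d he1 (fun q hq => (hd0 q hq).le) hdd
    (fun q hq => (hdR q hq).le)
  intro q hq s hs hqs y hy hyq hys
  obtain ⟨hqP, hqp, -⟩ := hQP q hq
  obtain ⟨hsP, hsp, -⟩ := hQP s hs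
  rw [mem_ball_zero_iff] at hy
  exact no_vertex (WithLp.toLp 2 (h, y) : V3) p q s (hxp y).le
    ((half_plane_iff h y q).2 ((hiff q hq y).1 hyq)) ((half_plane_iff h y s).2 ((hiff s hs y).1 hys))
    (hP p hpP) (hP q hqP) (hP s hsP) (hPP p hpP q hqP hqp.symm) (hPP p hpP s hsP hsp.symm)
    (hPP q hqP s hsP hqs) (by rw [hxn]; exact (hball y).1 hy)

end SoftBall

open scoped Pointwise

namespace SoftBall

section Gen
variable {E : Type*} [NormedAddCommGroup E] [InnerProductSpace ℝ E]

noncomputable def mm (q x : E) : ℝ := 2 * inner ℝ x q / ‖q‖ ^ 2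

def faceCone (r : ℝ) (P : Finset E) (p : E) : Set E :=
  {x | 0 < mm p x ∧ mm p x ≤ 1 ∧ ‖x‖ < mm p x * r ∧ ∀ q ∈ P, q ≠ p → mm q x < mm p x}

lemma mm_continuous (q : E) : Continuous (mm q) := by
  unfold mm; fun_prop

lemma mm_smul (q : E) (a : ℝ) (x : E) : mm q (a • x) = a * mm q x := by
  unfold mm; rw [real_inner_smul_left]; ring

lemma mm_le_one_iff (q x : E) (hq : 0 < ‖q‖) : mm q x ≤ 1 ↔ ‖x‖ ≤ ‖x - q‖ := by
  rw [← sq_le_sq₀ (norm_nonneg _) (norm_nonneg _), norm_sub_sq_real]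
  unfold mm
  rw [div_le_one (by positivity)]
  constructor <;> intro h <;> linarith

lemma mm_lt_one_iff (q x : E) (hq : 0 < ‖q‖) : mm q x < 1 ↔ ‖x‖ < ‖x - q‖ := by
  rw [← sq_lt_sq₀ (norm_nonneg _) (norm_nonneg _), norm_sub_sq_real]
  unfold mm
  rw [div_lt_one (by positivity)]
  constructor <;> intro h <;> linarith

lemma faceCone_measurable [MeasurableSpace E] [BorelSpace E] (r : ℝ) (P : Finset E) (p : E) :
    MeasurableSet (faceCone r P p) := by
  have hm : ∀ q : E, Measurable (mm q) := fun q => (mm_continuous q).measurable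
  have h1 : MeasurableSet {x : E | 0 < mm p x} := measurableSet_lt measurable_const (hm p)
  have h2 : MeasurableSet {x : E | mm p x ≤ 1} := measurableSet_le (hm p) measurable_const
  have h3 : MeasurableSet {x : E | ‖x‖ < mm p x * r} :=
    measurableSet_lt continuous_norm.measurable ((hm p).mul_const r)
  have h4 : MeasurableSet {x : E | ∀ q ∈ P, q ≠ p → mm q x < mm p x} := by
    have : {x : E | ∀ q ∈ P, q ≠ p → mm q x < mm p x}
        = ⋂ q ∈ P, {x : E | q ≠ p → mm q x < mm p x} := by
      ext x; simp only [Set.mem_iInter, Set.mem_ofPred_eq]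
    rw [this]
    refine Finset.measurableSet_biInter _ fun q _ => ?_
    by_cases hqp : q = p
    · simp [hqp]
    · simp only [ne_eq, hqp, not_false_eq_true, forall_const]
      exact measurableSet_lt (hm q) (hm p)
  exact h1.inter (h2.inter (h3.inter h4))

end Gen

lemma face_bound_coord (l h r : ℝ) (h1 : 1 ≤ l) (h2 : l < 2 / Real.sqrt 3) (h0 : 1 ≤ h) (hr : 0 < r)
    (hr2 : r ^ 2 = 3 / 2)
    (P : Finset V3) (p : V3) (hp : p = WithLp.toLp 2 (2 * h, 0)) (hpP : p ∈ P)
    (hP : ∀ q ∈ P, 2 ≤ ‖q‖) (hPP : ∀ q ∈ P, ∀ s ∈ P, q ≠ s → 2 ≤ ‖q - s‖) :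
    volume (faceCone r P p ∩ closedBall 0 l) ≤ ENNReal.ofReal (dens l) * volume (faceCone r P p) := by
  have hh : 0 < h := by linarith
  set S : Set ℂ := {y | h ^ 2 + ‖y‖ ^ 2 < r ^ 2 ∧ ∀ q ∈ P, q ≠ p →
      ‖(WithLp.toLp 2 (h, y) : V3)‖ < ‖(WithLp.toLp 2 (h, y) : V3) - q‖} with hS
  have hintg := face_integral l h r h1 h2 h0 hr hr2 P p hp hpP hP hPP S hS
  have hSm : MeasurableSet S := by
    have a1 : MeasurableSet {y : ℂ | h ^ 2 + ‖y‖ ^ 2 < r ^ 2} :=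
      measurableSet_lt (by fun_prop) measurable_const
    have a2 : MeasurableSet {y : ℂ | ∀ q ∈ P, q ≠ p →
        ‖(WithLp.toLp 2 (h, y) : V3)‖ < ‖(WithLp.toLp 2 (h, y) : V3) - q‖} := by
      have : {y : ℂ | ∀ q ∈ P, q ≠ p →
          ‖(WithLp.toLp 2 (h, y) : V3)‖ < ‖(WithLp.toLp 2 (h, y) : V3) - q‖}
          = ⋂ q ∈ P, {y : ℂ | q ≠ p →
          ‖(WithLp.toLp 2 (h, y) : V3)‖ < ‖(WithLp.toLp 2 (h, y) : V3) - q‖} := by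
        ext x; simp only [Set.mem_iInter, Set.mem_ofPred_eq]
      rw [this]
      refine Finset.measurableSet_biInter _ fun q _ => ?_
      have hc : Continuous fun y : ℂ => (WithLp.toLp 2 (h, y) : V3) := by fun_prop
      by_cases hqp : q = p
      · simp [hqp]
      · simp only [ne_eq, hqp, not_false_eq_true, forall_const]
        exact (isOpen_lt hc.norm (hc.sub continuous_const).norm).measurableSet
    exact a1.inter a2
  have hpn : ‖p‖ ^ 2 = 4 * h ^ 2 := by rw [hp, v3_norm_sq]; simp; ring
  have hmp : ∀ x : V3, mm p x = x.fst / h := by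
    intro x
    unfold mm
    rw [hpn, hp, WithLp.prod_inner_apply]
    simp
    field_simp
    ring
  have hcone : (WithLp.toLp 2 : ℝ × ℂ → V3) ⁻¹' faceCone r P p = cone h S := by
    ext ⟨z, w⟩
    simp only [faceCone, cone, Set.mem_preimage, Set.mem_ofPred_eq, hmp, WithLp.toLp_fst, hS]
    rw [div_le_one hh, div_pos_iff_of_pos_right hh]
    apply and_congr_right; intro hz
    apply and_congr_right; intro hzh
    have ha : 0 < z / h := div_pos hz hh
    have hX : (WithLp.toLp 2 (z, w) : V3) = (z / h) • (WithLp.toLp 2 (h, (h / z) • w) : V3) := by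
      rw [← WithLp.toLp_smul, Prod.smul_mk, smul_smul]
      congr 2
      · rw [smul_eq_mul]; field_simp
      · rw [show z / h * (h / z) = 1 by field_simp, one_smul]
    set X := (WithLp.toLp 2 (h, (h / z) • w) : V3) with hXdef
    have hXn : ‖X‖ ^ 2 = h ^ 2 + ‖(h / z) • w‖ ^ 2 := by rw [v3_norm_sq]; rfl
    rw [hX, norm_smul, Real.norm_eq_abs, abs_of_pos ha, mul_lt_mul_iff_right₀ ha,
      ← sq_lt_sq₀ (norm_nonneg _) hr.le, hXn]
    apply and_congr_right; intro _
    apply forall_congr'; intro q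
    apply forall_congr'; intro hq
    apply forall_congr'; intro _
    have hq2 := hP q hq
    rw [mm_smul, mul_lt_iff_lt_one_right ha, mm_lt_one_iff q X (by linarith)]
  have hball : ∀ a : ℝ, 0 ≤ a → (WithLp.toLp 2 : ℝ × ℂ → V3) ⁻¹' closedBall 0 a
      = {x : ℝ × ℂ | x.1 ^ 2 + ‖x.2‖ ^ 2 ≤ a ^ 2} := by
    intro a ha
    ext x
    rw [Set.mem_preimage, mem_closedBall_zero_iff, ← sq_le_sq₀ (norm_nonneg _) ha, v3_norm_sq]
    rfl
  have hmp := WithLp.volume_preserving_toLp ℝ ℂ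
  have hfm := faceCone_measurable r P p
  rw [← hmp.measure_preimage (hfm.inter isClosed_closedBall.measurableSet).nullMeasurableSet,
    ← hmp.measure_preimage hfm.nullMeasurableSet, Set.preimage_inter, hcone, hball l (by linarith)]
  refine (cone_bound l h r h1 h2 hh hr S hSm (fun y hy => hy.1.le) hintg).trans ?_
  gcongr
  exact Set.inter_subset_left

lemma exists_iso (p : EuclideanSpace ℝ (Fin 3)) :
    ∃ f : EuclideanSpace ℝ (Fin 3) ≃ₗᵢ[ℝ] V3, f p = WithLp.toLp 2 (‖p‖, 0) := by
  have hfr : Module.finrank ℝ V3 = 3 := by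
    rw [LinearEquiv.finrank_eq (WithLp.linearEquiv 2 ℝ (ℝ × ℂ))]
    simp
  let b := (stdOrthonormalBasis ℝ V3).reindex (finCongr hfr)
  let g := b.repr.symm
  have hn : ‖g p‖ = ‖(WithLp.toLp 2 (‖p‖, 0) : V3)‖ := by
    rw [LinearIsometryEquiv.norm_map, ← sq_eq_sq₀ (norm_nonneg _) (norm_nonneg _), v3_norm_sq]
    simp
  refine ⟨g.trans (Submodule.reflection (ℝ ∙ (g p - (WithLp.toLp 2 (‖p‖, 0) : V3)))ᗮ), ?_⟩
  rw [LinearIsometryEquiv.trans_apply]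
  exact Submodule.reflection_sub hn

lemma face_bound (l r : ℝ) (h1 : 1 ≤ l) (h2 : l < 2 / Real.sqrt 3) (hr : 0 < r)
    (hr2 : r ^ 2 = 3 / 2)
    (P : Finset (EuclideanSpace ℝ (Fin 3))) (p : EuclideanSpace ℝ (Fin 3)) (hpP : p ∈ P)
    (hP : ∀ q ∈ P, 2 ≤ ‖q‖) (hPP : ∀ q ∈ P, ∀ s ∈ P, q ≠ s → 2 ≤ ‖q - s‖) :
    volume (faceCone r P p ∩ closedBall 0 l) ≤ ENNReal.ofReal (dens l) * volume (faceCone r P p) := by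
  classical
  obtain ⟨f, hf⟩ := exists_iso p
  have hmm : ∀ q x, mm (f q) (f x) = mm q x := by
    intro q x; unfold mm; rw [LinearIsometryEquiv.inner_map_map, LinearIsometryEquiv.norm_map]
  have hpre : f ⁻¹' faceCone r (P.image f) (f p) = faceCone r P p := by
    ext x
    simp only [faceCone, Set.mem_preimage, Set.mem_ofPred_eq, hmm, Finset.forall_mem_image,
      LinearIsometryEquiv.norm_map, ne_eq, f.injective.eq_iff]
  have hpb : f ⁻¹' closedBall 0 l = closedBall 0 l := by
    ext x; simp
  have hmp := f.measurePreserving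
  have hfm := faceCone_measurable r (P.image f) (f p)
  have := face_bound_coord l (‖p‖ / 2) r h1 h2 (by linarith [hP p hpP]) hr hr2 (P.image f) (f p)
    (by rw [hf]; congr 2; ring) (Finset.mem_image_of_mem _ hpP)
    (by simpa [Finset.forall_mem_image] using hP)
    (by
      intro q hq s hs hqs
      obtain ⟨q', hq', rfl⟩ := Finset.mem_image.1 hq
      obtain ⟨s', hs', rfl⟩ := Finset.mem_image.1 hs
      rw [← map_sub, LinearIsometryEquiv.norm_map]
      exact hPP q' hq' s' hs' (fun h => hqs (by rw [h])))
  rwa [← hmp.measure_preimage (hfm.inter isClosed_closedBall.measurableSet).nullMeasurableSet,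
    ← hmp.measure_preimage hfm.nullMeasurableSet, Set.preimage_inter, hpre, hpb] at this

end SoftBall

open scoped Pointwise

namespace SoftBall

abbrev E3 := EuclideanSpace ℝ (Fin 3)

lemma hyperplane_null (v : E3) (hv : v ≠ 0) (c : ℝ) :
    volume {x : E3 | inner ℝ x v = c} = 0 := by
  rcases Set.eq_empty_or_nonempty {x : E3 | inner ℝ x v = c} with h | ⟨x0, hx0⟩
  · rw [h, measure_empty]
  · have hx0' : inner ℝ x0 v = c := hx0
    have e : {x : E3 | inner ℝ x v = c} = (fun x => x + (-x0)) ⁻¹' ((ℝ ∙ v)ᗮ : Submodule ℝ E3) := by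
      ext x
      rw [Set.mem_preimage, SetLike.mem_coe, Submodule.mem_orthogonal_singleton_iff_inner_left,
        inner_add_left, inner_neg_left, hx0', Set.mem_ofPred_eq]
      constructor <;> intro h <;> linarith
    rw [e, measure_preimage_add_right]
    apply Measure.addHaar_submodule
    intro htop
    have : v ∈ (ℝ ∙ v)ᗮ := by rw [htop]; trivial
    rw [Submodule.mem_orthogonal_singleton_iff_inner_left, inner_self_eq_zero] at this
    exact hv this

lemma tie_null (p q : E3) (hp : 0 < ‖p‖) (hq : 0 < ‖q‖) (hpq : p ≠ q) :
    volume {x : E3 | mm p x = mm q x} = 0 := by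
  set v := (‖p‖ ^ 2)⁻¹ • p - (‖q‖ ^ 2)⁻¹ • q with hv
  have hv0 : v ≠ 0 := by
    intro h0
    rw [hv, sub_eq_zero] at h0
    have hn := congrArg norm h0
    rw [norm_smul, norm_smul, Real.norm_of_nonneg (by positivity),
      Real.norm_of_nonneg (by positivity)] at hn
    have hn2 : ‖p‖ = ‖q‖ := by
      field_simp at hn
      exact hn.symm
    rw [hn2] at h0
    exact hpq (smul_right_injective _ (by positivity) h0)
  rw [← hyperplane_null v hv0 0]
  congr 1
  ext x
  simp only [Set.mem_ofPred_eq, mm, hv, inner_sub_right, inner_smul_right]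
  rw [div_eq_inv_mul, div_eq_inv_mul]
  constructor <;> intro h <;> linarith

lemma local_bound (l r : ℝ) (h1 : 1 ≤ l) (h2 : l < 2 / Real.sqrt 3) (hr : 0 < r)
    (hr2 : r ^ 2 = 3 / 2) (P : Finset E3)
    (hP : ∀ q ∈ P, 2 ≤ ‖q‖) (hPP : ∀ q ∈ P, ∀ s ∈ P, q ≠ s → 2 ≤ ‖q - s‖) :
    volume ({x : E3 | ∀ p ∈ P, mm p x ≤ 1} ∩ closedBall 0 l)
      ≤ ENNReal.ofReal (dens l) * volume ({x : E3 | ∀ p ∈ P, mm p x ≤ 1} ∩ closedBall 0 r) := by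
  classical
  have hl : 0 < l := by linarith
  have hlr : l < r := by
    have := l_sq l h1 h2
    nlinarith
  set N : Set E3 := {x | ‖x‖ ≤ r ∧ ∀ p ∈ P, r * mm p x ≤ ‖x‖} with hN
  have hNm : MeasurableSet N := by
    have a1 : MeasurableSet {x : E3 | ‖x‖ ≤ r} :=
      measurableSet_le continuous_norm.measurable measurable_const
    have a2 : MeasurableSet {x : E3 | ∀ p ∈ P, r * mm p x ≤ ‖x‖} := by
      have : {x : E3 | ∀ p ∈ P, r * mm p x ≤ ‖x‖} = ⋂ p ∈ P, {x : E3 | r * mm p x ≤ ‖x‖} := by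
        ext x; simp only [Set.mem_iInter, Set.mem_ofPred_eq]
      rw [this]
      refine Finset.measurableSet_biInter _ fun q _ => ?_
      exact measurableSet_le ((mm_continuous q).measurable.const_mul r) continuous_norm.measurable
    exact a1.inter a2
  set T : Set E3 := ⋃ p ∈ P, ⋃ q ∈ P.erase p, {x | mm p x = mm q x} with hT
  have hT0 : volume T = 0 := by
    rw [hT]
    refine (measure_biUnion_null_iff P.countable_toSet).2 fun p hp => ?_
    refine (measure_biUnion_null_iff (P.erase p).countable_toSet).2 fun q hq => ?_
    rw [Finset.mem_coe, Finset.mem_erase] at hq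
    exact tie_null p q (by linarith [hP p hp]) (by linarith [hP q hq.2]) hq.1.symm
  have hcover : ({x : E3 | ∀ p ∈ P, mm p x ≤ 1} ∩ closedBall 0 l) ⊆
      (l / r) • N ∪ (⋃ p ∈ P, (faceCone r P p ∩ closedBall 0 l)) ∪ T := by
    rintro x ⟨hxK, hxl⟩
    have hxl' : ‖x‖ ≤ l := mem_closedBall_zero_iff.1 hxl
    by_cases hxN : ∀ p ∈ P, r * mm p x ≤ ‖x‖
    · left; left
      rw [Set.mem_smul_set_iff_inv_smul_mem₀ (div_pos hl hr).ne', inv_div]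
      refine ⟨?_, fun p hp => ?_⟩
      · rw [norm_smul, Real.norm_of_nonneg (by positivity), div_mul_eq_mul_div, div_le_iff₀ hl]
        gcongr
      · rw [norm_smul, Real.norm_of_nonneg (by positivity), mm_smul, mul_left_comm]
        exact mul_le_mul_of_nonneg_left (hxN p hp) (by positivity)
    · push Not at hxN
      obtain ⟨p0, hp0, hp0x⟩ := hxN
      obtain ⟨p, hp, hmax⟩ := Finset.exists_max_image P (fun p => mm p x) ⟨p0, hp0⟩
      have hpx : ‖x‖ < r * mm p x :=
        hp0x.trans_le (mul_le_mul_of_nonneg_left (hmax p0 hp0) hr.le)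
      by_cases htie : ∃ q ∈ P.erase p, mm p x = mm q x
      · right
        obtain ⟨q, hq, hqe⟩ := htie
        simp only [hT, Set.mem_iUnion]
        exact ⟨p, hp, q, hq, hqe⟩
      · left; right
        push Not at htie
        simp only [Set.mem_iUnion]
        refine ⟨p, hp, ⟨?_, hxK p hp, by rw [mul_comm]; exact hpx, fun q hq hqp => ?_⟩, hxl⟩
        · have := (norm_nonneg x).trans_lt hpx
          exact (pos_iff_pos_of_mul_pos this).1 hr
        · exact lt_of_le_of_ne (hmax q hq) (htie q (Finset.mem_erase.2 ⟨hqp, hq⟩)).symm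
  have hsub : N ∪ (⋃ p ∈ P, faceCone r P p) ⊆ {x : E3 | ∀ p ∈ P, mm p x ≤ 1} ∩ closedBall 0 r := by
    rintro x (hx | hx)
    · refine ⟨fun p hp => ?_, mem_closedBall_zero_iff.2 hx.1⟩
      have := (hx.2 p hp).trans hx.1
      nlinarith
    · simp only [Set.mem_iUnion] at hx
      obtain ⟨p, hp, hx⟩ := hx
      refine ⟨fun q hq => ?_, mem_closedBall_zero_iff.2 ?_⟩
      · by_cases hqp : q = p
        · rw [hqp]; exact hx.2.1
        · exact (hx.2.2.2 q hq hqp).le.trans hx.2.1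
      · have a1 := hx.2.2.1
        have a2 := hx.2.1
        nlinarith
  have hdisj : Disjoint N (⋃ p ∈ P, faceCone r P p) := by
    rw [Set.disjoint_left]
    intro x hx hx'
    simp only [Set.mem_iUnion] at hx'
    obtain ⟨p, hp, hx'⟩ := hx'
    have := hx.2 p hp
    linarith [hx'.2.2.1]
  have hpd : Set.PairwiseDisjoint (P : Set E3) (fun p => faceCone r P p) := by
    intro p hp q hq hpq
    rw [Function.onFun, Set.disjoint_left]
    intro x hx hx'
    exact absurd (hx.2.2.2 q hq hpq.symm) (not_lt.2 (hx'.2.2.2 p hp hpq).le)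
  have hNb : volume ((l / r) • N) ≤ ENNReal.ofReal (dens l) * volume N := by
    rw [Measure.addHaar_smul, finrank_euclideanSpace_fin, abs_of_nonneg (by positivity)]
    gcongr
    refine le_trans ?_ (dens_lower l h1 h2)
    have hrs : Real.sqrt 2 / Real.sqrt 3 = 1 / r := by
      rw [div_eq_div_iff (by positivity) hr.ne', one_mul, ← sq_eq_sq₀ (by positivity) (by positivity),
        mul_pow, Real.sq_sqrt (by norm_num), Real.sq_sqrt (by norm_num), hr2]
      norm_num
    rw [hrs]
    have : (l / r) ^ 3 = l ^ 3 * (1 / r) * (2 / 3) := by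
      rw [div_pow, pow_succ r 2, hr2]; field_simp
    rw [this]
    apply mul_le_mul_of_nonneg_left (by norm_num) (by positivity)
  calc volume ({x : E3 | ∀ p ∈ P, mm p x ≤ 1} ∩ closedBall 0 l)
      ≤ volume ((l / r) • N ∪ (⋃ p ∈ P, (faceCone r P p ∩ closedBall 0 l)) ∪ T) := measure_mono hcover
    _ ≤ volume ((l / r) • N) + volume (⋃ p ∈ P, (faceCone r P p ∩ closedBall 0 l)) + 0 := by
        refine (measure_union_le _ _).trans ?_
        rw [hT0]
        gcongr
        exact measure_union_le _ _
    _ ≤ ENNReal.ofReal (dens l) * volume N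
        + ∑ p ∈ P, ENNReal.ofReal (dens l) * volume (faceCone r P p) := by
        rw [add_zero]
        refine add_le_add hNb ((measure_biUnion_finset_le _ _).trans ?_)
        exact Finset.sum_le_sum fun p hp => face_bound l r h1 h2 hr hr2 P p hp hP hPP
    _ = ENNReal.ofReal (dens l) * volume (N ∪ (⋃ p ∈ P, faceCone r P p)) := by
        rw [measure_union hdisj (Finset.measurableSet_biUnion _ fun p _ => faceCone_measurable r P p),
          measure_biUnion_finset hpd (fun p _ => faceCone_measurable r P p), mul_add, Finset.mul_sum]
    _ ≤ _ := by gcongr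

end SoftBall

open scoped Pointwise

namespace SoftBall

section Global
variable (c : ℕ → E3)

def cell (i : ℕ) : Set E3 := {x | ∀ j, ‖x - c i‖ ≤ ‖x - c j‖}

lemma cell_measurable (i : ℕ) : MeasurableSet (cell c i) := by
  have : cell c i = ⋂ j, {x | ‖x - c i‖ ≤ ‖x - c j‖} := by
    ext x; simp [cell]
  rw [this]
  refine MeasurableSet.iInter fun j => ?_
  exact (isClosed_le (by fun_prop) (by fun_prop)).measurableSet

lemma centers_finite (hc : ∀ j k : ℕ, j ≠ k → 2 ≤ ‖c j - c k‖)
    (a : E3) (M : ℝ) : {i : ℕ | ‖c i - a‖ ≤ M}.Finite := by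
  set s := {i : ℕ | ‖c i - a‖ ≤ M} with hs
  have := Measure.finite_const_le_meas_of_disjoint_iUnion (volume : Measure E3)
    (ε := volume (ball (0 : E3) 1)) (measure_ball_pos _ _ one_pos)
    (As := fun i : s => ball (c i) 1) (fun i => measurableSet_ball) ?_ ?_
  · have hu : {i : s | volume (ball (0 : E3) 1) ≤ volume (ball (c i) 1)} = Set.univ := by
      ext i
      simp only [Set.mem_ofPred_eq, Set.mem_univ, iff_true]
      rw [Measure.addHaar_ball_center volume (c i)]
    rw [hu, Set.finite_univ_iff] at this
    exact Set.toFinite s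
  · intro i j hij
    have h2 := hc i j (fun h => hij (Subtype.ext h))
    apply ball_disjoint_ball
    rw [dist_eq_norm]; linarith
  · refine ((measure_mono (Set.iUnion_subset fun i => ?_)).trans_lt
      (measure_ball_lt_top (x := a) (r := M + 1))).ne
    apply ball_subset_ball'
    rw [dist_eq_norm]
    linarith [show ‖c i - a‖ ≤ M from i.2]

lemma cell_aedisjoint (hc : ∀ j k : ℕ, j ≠ k → 2 ≤ ‖c j - c k‖)
    (i j : ℕ) (hij : i ≠ j) : volume (cell c i ∩ cell c j) = 0 := by
  have hne : c j - c i ≠ 0 := by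
    intro h
    have := hc j i hij.symm
    rw [h, norm_zero] at this
    linarith
  refine measure_mono_null ?_ (hyperplane_null (c j - c i) hne ((‖c j‖ ^ 2 - ‖c i‖ ^ 2) / 2))
  rintro x ⟨hx, hx'⟩
  have e : ‖x - c i‖ = ‖x - c j‖ := le_antisymm (hx j) (hx' i)
  have e2 := congrArg (fun t => t ^ 2) e
  simp only [norm_sub_sq_real] at e2
  rw [Set.mem_ofPred_eq, inner_sub_right]
  linarith

lemma cell_bound (hc : ∀ j k : ℕ, j ≠ k → 2 ≤ ‖c j - c k‖)
    (l r : ℝ) (h1 : 1 ≤ l) (h2 : l < 2 / Real.sqrt 3) (hr : 0 < r)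
    (hr2 : r ^ 2 = 3 / 2) (i : ℕ) :
    volume (cell c i ∩ closedBall (c i) l)
      ≤ ENNReal.ofReal (dens l) * volume (cell c i ∩ closedBall (c i) r) := by
  classical
  set J := ((centers_finite c hc (c i) 4).toFinset).erase i with hJ
  have hJm : ∀ j, j ∈ J ↔ j ≠ i ∧ ‖c j - c i‖ ≤ 4 := by
    intro j; rw [hJ, Finset.mem_erase, Set.Finite.mem_toFinset]; rfl
  set P := J.image (fun j => c j - c i) with hP
  have hpos : ∀ j, j ≠ i → 0 < ‖c j - c i‖ := fun j hj => by linarith [hc j i hj]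
  have hpre : ∀ ρ : ℝ, ρ ≤ 2 → (fun x => x + c i) ⁻¹' (cell c i ∩ closedBall (c i) ρ)
      = {x : E3 | ∀ p ∈ P, mm p x ≤ 1} ∩ closedBall 0 ρ := by
    intro ρ hρ
    ext x
    simp only [Set.mem_preimage, Set.mem_inter_iff, cell, Set.mem_ofPred_eq, mem_closedBall_iff_norm,
      add_sub_cancel_right, sub_zero, hP, Finset.forall_mem_image]
    apply and_congr_left
    intro hx
    have hxe : ∀ j, x + c i - c j = x - (c j - c i) := fun j => by abel
    constructor
    · intro H j hj
      rw [mm_le_one_iff _ _ (hpos j ((hJm j).1 hj).1), ← hxe]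
      exact H j
    · intro H j
      by_cases hji : j = i
      · rw [hji]; simp
      rw [hxe]
      by_cases hj : j ∈ J
      · exact (mm_le_one_iff _ _ (hpos j hji)).1 (H hj)
      · have h4 : 4 < ‖c j - c i‖ := by
          by_contra hcon
          exact hj ((hJm j).2 ⟨hji, not_lt.1 hcon⟩)
        have := norm_sub_norm_le (c j - c i) x
        rw [norm_sub_rev x]
        linarith
  have hl2 : l ≤ 2 := by nlinarith [l_sq l h1 h2]
  have hr22 : r ≤ 2 := by nlinarith
  have := local_bound l r h1 h2 hr hr2 P ?_ ?_
  · rwa [← hpre l hl2, ← hpre r hr22, measure_preimage_add_right, measure_preimage_add_right] at this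
  · rw [hP, Finset.forall_mem_image]
    intro j hj
    exact hc j i ((hJm j).1 hj).1
  · intro q hq s hs hqs
    obtain ⟨j, hj, rfl⟩ := Finset.mem_image.1 hq
    obtain ⟨k, hk, rfl⟩ := Finset.mem_image.1 hs
    rw [sub_sub_sub_cancel_right]
    exact hc j k (fun h => hqs (by rw [h]))

lemma global_bound (hc : ∀ j k : ℕ, j ≠ k → 2 ≤ ‖c j - c k‖)
    (l : ℝ) (h1 : 1 ≤ l) (h2 : l < 2 / Real.sqrt 3) (R : ℝ) :
    volume ((⋃ i : ℕ, closedBall (c i) l) ∩ closedBall (0 : E3) R)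
      ≤ ENNReal.ofReal (dens l) * volume (closedBall (0 : E3) (R + 4)) := by
  classical
  set r := Real.sqrt (3 / 2) with hrdef
  have hr : 0 < r := by positivity
  have hr2 : r ^ 2 = 3 / 2 := Real.sq_sqrt (by norm_num)
  have hl2 : l ≤ 2 := by nlinarith [l_sq l h1 h2]
  have hr22 : r ≤ 2 := by nlinarith
  set I := (centers_finite c hc 0 (R + 2)).toFinset with hI
  have hIm : ∀ i, i ∈ I ↔ ‖c i‖ ≤ R + 2 := by
    intro i; rw [hI, Set.Finite.mem_toFinset, Set.mem_ofPred_eq, sub_zero]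
  have hcover : (⋃ i : ℕ, closedBall (c i) l) ∩ closedBall (0 : E3) R ⊆
      ⋃ i ∈ I, cell c i ∩ closedBall (c i) l := by
    rintro x ⟨hx, hxR⟩
    obtain ⟨i0, hi0⟩ := Set.mem_iUnion.1 hx
    rw [mem_closedBall_iff_norm] at hi0
    rw [mem_closedBall_zero_iff] at hxR
    set s := (centers_finite c hc x l).toFinset with hs
    have hsm : ∀ i, i ∈ s ↔ ‖x - c i‖ ≤ l := by
      intro i; rw [hs, Set.Finite.mem_toFinset, Set.mem_ofPred_eq, norm_sub_rev]
    obtain ⟨i, hi, hmin⟩ := Finset.exists_min_image s (fun i => ‖x - c i‖) ⟨i0, (hsm i0).2 hi0⟩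
    have hil := (hsm i).1 hi
    simp only [Set.mem_iUnion]
    refine ⟨i, (hIm i).2 ?_, fun j => ?_, mem_closedBall_iff_norm.2 hil⟩
    · have := norm_sub_norm_le (c i) x
      rw [norm_sub_rev] at this
      linarith
    · by_cases hj : j ∈ s
      · exact hmin j hj
      · rw [hsm] at hj
        exact hil.trans (not_le.1 hj).le
  calc _ ≤ volume (⋃ i ∈ I, cell c i ∩ closedBall (c i) l) := measure_mono hcover
    _ ≤ ∑ i ∈ I, volume (cell c i ∩ closedBall (c i) l) := measure_biUnion_finset_le _ _
    _ ≤ ∑ i ∈ I, ENNReal.ofReal (dens l) * volume (cell c i ∩ closedBall (c i) r) :=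
        Finset.sum_le_sum fun i _ => cell_bound c hc l r h1 h2 hr hr2 i
    _ = ENNReal.ofReal (dens l) * volume (⋃ i ∈ I, cell c i ∩ closedBall (c i) r) := by
        rw [← Finset.mul_sum, measure_biUnion_finset₀]
        · intro i _ j _ hij
          exact measure_mono_null (Set.inter_subset_inter Set.inter_subset_left Set.inter_subset_left)
            (cell_aedisjoint c hc i j hij)
        · intro i _
          exact ((cell_measurable c i).inter isClosed_closedBall.measurableSet).nullMeasurableSet
    _ ≤ _ := by
        gcongr
        refine Set.iUnion₂_subset fun i hi => ?_
        refine Set.inter_subset_right.trans (closedBall_subset_closedBall' ?_)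
        rw [dist_zero_right]
        linarith [(hIm i).1 hi]

lemma ratio_bound (hc : ∀ j k : ℕ, j ≠ k → 2 ≤ ‖c j - c k‖)
    (l : ℝ) (h1 : 1 ≤ l) (h2 : l < 2 / Real.sqrt 3) (R : ℝ) (hR : 0 < R) :
    (volume ((⋃ i : ℕ, closedBall (c i) l) ∩ closedBall (0 : E3) R)).toReal /
      (volume (closedBall (0 : E3) R)).toReal ≤ dens l * (1 + 4 / R) ^ 3 := by
  have hd0 : 0 ≤ dens l := le_trans (by positivity) (dens_lower l h1 h2)
  have hb := global_bound c hc l h1 h2 R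
  have hfin : ENNReal.ofReal (dens l) * volume (closedBall (0 : E3) (R + 4)) ≠ ⊤ :=
    ENNReal.mul_ne_top ENNReal.ofReal_ne_top measure_closedBall_lt_top.ne
  have hb2 := ENNReal.toReal_mono hfin hb
  rw [ENNReal.toReal_mul, ENNReal.toReal_ofReal hd0,
    Measure.addHaar_closedBall volume (0 : E3) (by linarith), finrank_euclideanSpace_fin,
    ENNReal.toReal_mul, ENNReal.toReal_ofReal (by positivity)] at hb2
  have hB : 0 < (volume (ball (0 : E3) 1)).toReal :=
    ENNReal.toReal_pos (measure_ball_pos _ _ one_pos).ne' measure_ball_lt_top.ne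
  rw [Measure.addHaar_closedBall volume (0 : E3) hR.le, finrank_euclideanSpace_fin,
    ENNReal.toReal_mul, ENNReal.toReal_ofReal (by positivity), div_le_iff₀ (by positivity)]
  refine hb2.trans (le_of_eq ?_)
  field_simp

end Global

end SoftBall

theorem soft_ball_density_bound_dim_three (lam : ℝ) (hlam0 : 0 ≤ lam)
    (hlam1 : lam < 2 / Real.sqrt 3 - 1)
    (c : ℕ → EuclideanSpace ℝ (Fin 3))
    (hc : ∀ j k : ℕ, j ≠ k → 2 ≤ ‖c j - c k‖) :
    Filter.limsup (fun R : ℝ =>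
        (volume ((⋃ i : ℕ, closedBall (c i) (1 + lam)) ∩
          closedBall (0 : EuclideanSpace ℝ (Fin 3)) R)).toReal /
        (volume (closedBall (0 : EuclideanSpace ℝ (Fin 3)) R)).toReal) Filter.atTop ≤
      ((20 * Real.sqrt 6 * Real.arctan (1 / Real.sqrt 2) - 4 * Real.sqrt 6 * Real.pi -
          10 * Real.pi) * (1 + lam) ^ 3 + 18 * Real.pi * (1 + lam) ^ 2 - 6 * Real.pi) /
        (3 * Real.pi - 15 * Real.arctan (1 / Real.sqrt 2) + 5 * Real.sqrt 2) := by
  have key : Filter.Tendsto (fun R : ℝ => SoftBall.dens (1 + lam) * (1 + 4 / R) ^ 3) Filter.atTop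
      (nhds (SoftBall.dens (1 + lam))) := by
    have h4 : Filter.Tendsto (fun R : ℝ => 4 / R) Filter.atTop (nhds 0) :=
      Filter.Tendsto.const_div_atTop Filter.tendsto_id 4
    have := ((h4.const_add 1).pow 3).const_mul (SoftBall.dens (1 + lam))
    simpa using this
  have hdens : SoftBall.dens (1 + lam) = ((20 * Real.sqrt 6 * Real.arctan (1 / Real.sqrt 2)
      - 4 * Real.sqrt 6 * Real.pi -
          10 * Real.pi) * (1 + lam) ^ 3 + 18 * Real.pi * (1 + lam) ^ 2 - 6 * Real.pi) /
        (3 * Real.pi - 15 * Real.arctan (1 / Real.sqrt 2) + 5 * Real.sqrt 2) := rfl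
  rw [← hdens, ← key.limsup_eq]
  apply Filter.limsup_le_limsup
  · filter_upwards [Filter.eventually_gt_atTop 0] with R hR
    exact SoftBall.ratio_bound c hc (1 + lam) (by linarith) (by linarith) R hR
  · exact Filter.isCoboundedUnder_le_of_le (x := 0) _ (fun R => by positivity)
  · exact key.isBoundedUnder_le
end
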